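/- arXiv:1406.6956 — 2 statements merged into one kernel-verified Lean document; each statement's English description precedes it below -/
import Mathlib

section
/- For every α ∈ (1, 3/2) there exist a constant C > 0 and a family of functions F̂_{n,S} : ℕ^S → ℝ, indexed by integers n, S ≥ 1, such that for all integers n ≥ 2, all integers S ≥ 1, and all P ∈ M_S, under the Poissonized sampling model with parameter n one has E_P[(F̂_{n,S}(Z) − F_α(P))²] ≤ C·(n·ln n)^{−2(α−1)}; in particular the bound is uniform over all support sizes S. -/
open scoped BigOperators ENNReal

/-- The probability simplex on `S` outcomes. -/
def simplex (S : ℕ) : Set (Fin S → ℝ) :=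
  {P | (∀ i, 0 ≤ P i) ∧ ∑ i, P i = 1}

/-- Joint pmf of independent Poisson observations `Z i ~ Poisson (lam * P i)`. -/
noncomputable def poissonPMF (S : ℕ) (lam : ℝ) (P : Fin S → ℝ) (z : Fin S → ℕ) : ℝ :=
  ∏ i, Real.exp (-(lam * P i)) * (lam * P i) ^ (z i) / (Nat.factorial (z i) : ℝ)

/-- Expected squared error of an estimator under the Poissonized model. -/
noncomputable def poissonRisk (S : ℕ) (lam : ℝ) (P : Fin S → ℝ) (t : ℝ)
    (est : (Fin S → ℕ) → ℝ) : ℝ≥0∞ :=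
  ∑' z : Fin S → ℕ, ENNReal.ofReal (poissonPMF S lam P z * (est z - t) ^ 2)

/-- Minimax risk for estimating `F P` under the Poissonized model. -/
noncomputable def poissonMinimax (S : ℕ) (lam : ℝ) (F : (Fin S → ℝ) → ℝ) : ℝ≥0∞ :=
  ⨅ est : (Fin S → ℕ) → ℝ, ⨆ P ∈ simplex S, poissonRisk S lam P (F P) est

/-- The power-sum functional `F_α(P) = ∑ i, (P i)^α` (real power; `0^α = 0` for `α > 0`). -/
noncomputable def Falpha (S : ℕ) (α : ℝ) (P : Fin S → ℝ) : ℝ :=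
  ∑ i, P i ^ α

section PolynomialApproximation

open Polynomial Finset

/-- Coefficient bound for the Chebyshev polynomials shifted to `[0, 1]`. -/
lemma exists_polynomial_eval_eq_cos (n : ℕ) : ∃ p : ℝ[X], p.natDegree ≤ n ∧
    (∀ j, |p.coeff j| ≤ 7 ^ n) ∧
    ∀ t : ℝ, p.eval ((1 + Real.cos t) / 2) = Real.cos (n * t) := by
  induction n using Nat.twoStepInduction with
  | zero =>
    refine ⟨1, by simp, fun j => ?_, by simp⟩
    rw [coeff_one]; split_ifs <;> simp
  | one =>
    refine ⟨C 2 * X - C 1, by compute_degree, fun j => ?_, fun t => by simp; ring⟩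
    rw [coeff_sub, coeff_C_mul, coeff_X, coeff_C]
    split_ifs <;> norm_num
  | more n ih1 ih2 =>
    obtain ⟨p, hpd, hpc, hpe⟩ := ih1
    obtain ⟨q, hqd, hqc, hqe⟩ := ih2
    refine ⟨C 4 * (X * q) - C 2 * q - p, ?_, fun j => ?_, fun t => ?_⟩
    · have h1 : (C 4 * (X * q)).natDegree ≤ n + 2 :=
        (natDegree_C_mul_le _ _).trans (natDegree_mul_le.trans (by
          have := natDegree_X_le (R := ℝ); omega))
      have h2 : (C 2 * q).natDegree ≤ n + 2 := (natDegree_C_mul_le _ _).trans (by omega)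
      exact (natDegree_sub_le_of_le (natDegree_sub_le_of_le h1 h2) (by omega : _ ≤ n + 2)).trans
        (by simp)
    · have hX : |(X * q).coeff j| ≤ 7 ^ (n + 1) := by
        cases j with
        | zero => simp
        | succ j => rw [coeff_X_mul]; exact hqc j
      rw [coeff_sub, coeff_sub, coeff_C_mul, coeff_C_mul]
      have h1 := abs_le.1 hX
      have h2 := abs_le.1 (hqc j)
      have h3 := abs_le.1 (hpc j)
      have h7 : (0 : ℝ) < 7 ^ n := by positivity
      rw [pow_succ] at h1 h2
      rw [abs_le, pow_succ, pow_succ]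
      constructor <;> linarith
    · have e1 : Real.cos ((n + 2 : ℕ) * t) = 2 * Real.cos t * Real.cos ((n + 1 : ℕ) * t)
          - Real.cos (n * t) := by
        have h1 : ((n + 2 : ℕ) : ℝ) * t = (n + 1 : ℕ) * t + t := by push_cast; ring
        have h2 : (n : ℝ) * t = (n + 1 : ℕ) * t - t := by push_cast; ring
        rw [h1, h2, Real.cos_add, Real.cos_sub]; ring
      rw [e1, ← hpe, ← hqe]
      simp; ring

/-- A nontrivial character sums to zero over equidistributed nodes. -/
lemma sum_cos_equidistributed {N : ℕ} {k : ℤ} (hk : k ≠ 0) (hkN : |k| < N) (t : ℝ) :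
    ∑ l ∈ range N, Real.cos (k * (t - 2 * Real.pi * l / N)) = 0 := by
  have hN : (0 : ℝ) < N := by
    have : (0 : ℤ) < N := lt_of_le_of_lt (abs_nonneg k) hkN
    exact_mod_cast this
  have hs : Real.sin (k * Real.pi / N) ≠ 0 := by
    intro h
    obtain ⟨j, hj⟩ := Real.sin_eq_zero_iff.1 h
    have hj' : (j : ℝ) * N = k := by
      field_simp at hj
      nlinarith [Real.pi_pos]
    have hj'' : j * N = k := by exact_mod_cast hj'
    have : j ≠ 0 := by rintro rfl; simp at hj''; exact hk hj''.symm
    rw [← hj'', abs_mul, Nat.abs_cast] at hkN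
    nlinarith [Int.one_le_abs this]
  have key : ∀ l : ℕ, 2 * Real.sin (k * Real.pi / N) * Real.cos (k * (t - 2 * Real.pi * l / N)) =
      Real.sin (k * t - 2 * k * Real.pi * l / N + k * Real.pi / N) -
      Real.sin (k * t - 2 * k * Real.pi * (l + 1 : ℕ) / N + k * Real.pi / N) := by
    intro l
    have e : (k * t - 2 * k * Real.pi * (l + 1 : ℕ) / N + k * Real.pi / N : ℝ) =
      k * (t - 2 * Real.pi * l / N) - k * Real.pi / N := by push_cast; field_simp; ring
    have e' : (k * t - 2 * k * Real.pi * l / N + k * Real.pi / N : ℝ) =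
      k * (t - 2 * Real.pi * l / N) + k * Real.pi / N := by field_simp
    rw [e, e', Real.sin_add, Real.sin_sub]; ring
  have h2 : 2 * Real.sin (k * Real.pi / N) *
      ∑ l ∈ range N, Real.cos (k * (t - 2 * Real.pi * l / N)) = 0 := by
    rw [mul_sum, sum_congr rfl fun l _ => key l,
      sum_range_sub' (fun l : ℕ => Real.sin (k * t - 2 * k * Real.pi * l / N + k * Real.pi / N))]
    have e : (k * t - 2 * k * Real.pi * N / N + k * Real.pi / N : ℝ) =
      k * t - 2 * k * Real.pi * (0 : ℕ) / N + k * Real.pi / N - k * (2 * Real.pi) := by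
      field_simp; push_cast; ring
    rw [e, Real.sin_sub_int_mul_two_pi]; simp
  simpa [hs] using h2

lemma sum_cos_equidistributed_eq_ite {N : ℕ} {k : ℤ} (hkN : |k| < N) (t : ℝ) :
    ∑ l ∈ range N, Real.cos (k * (t - 2 * Real.pi * l / N)) = if k = 0 then (N : ℝ) else 0 := by
  split_ifs with h
  · simp [h]
  · exact sum_cos_equidistributed h hkN t

/-- The weights of the Fejér–Korovkin kernel. -/
noncomputable def korovkinWeight (m j : ℕ) : ℝ := Real.sin ((j + 1) * (Real.pi / (m + 1)))

/-- The (unnormalized) Fejér–Korovkin kernel. -/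
noncomputable def korovkinKernel (m : ℕ) (u : ℝ) : ℝ :=
  ∑ j ∈ range m, ∑ k ∈ range m,
    korovkinWeight m j * korovkinWeight m k * Real.cos (((j : ℤ) - (k : ℤ) : ℤ) * u)

lemma korovkinKernel_nonneg (m : ℕ) (u : ℝ) : 0 ≤ korovkinKernel m u := by
  have : korovkinKernel m u = (∑ j ∈ range m, korovkinWeight m j * Real.cos (j * u)) ^ 2 +
      (∑ j ∈ range m, korovkinWeight m j * Real.sin (j * u)) ^ 2 := by
    rw [korovkinKernel, sq, sq, sum_mul_sum, sum_mul_sum, ← sum_add_distrib]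
    refine sum_congr rfl fun j _ => ?_
    rw [← sum_add_distrib]
    refine sum_congr rfl fun k _ => ?_
    push_cast
    rw [sub_mul, Real.cos_sub]; ring
  rw [this]; positivity

lemma korovkinWeight_last {m : ℕ} : korovkinWeight m m = 0 := by
  have : ((m : ℝ) + 1) * (Real.pi / (m + 1)) = Real.pi := by field_simp
  rw [korovkinWeight, this, Real.sin_pi]

lemma sum_korovkinWeight_mul_succ (m : ℕ) :
    ∑ j ∈ range m, korovkinWeight m j * korovkinWeight m (j + 1) =
      Real.cos (Real.pi / (m + 1)) * ∑ j ∈ range m, korovkinWeight m j ^ 2 := by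
  set h := Real.pi / ((m : ℝ) + 1) with hh
  let a : ℕ → ℝ := fun j => Real.sin (j * h) * Real.sin ((j + 1) * h)
  have h1 : ∑ j ∈ range m, korovkinWeight m j * korovkinWeight m (j + 1) =
      ∑ j ∈ range m, a (j + 1) := by
    refine sum_congr rfl fun j _ => ?_
    simp [korovkinWeight, a, hh]
  have h2 : ∑ j ∈ range m, a (j + 1) = ∑ j ∈ range m, a j := by
    have := sum_range_sub a m
    rw [sum_sub_distrib] at this
    have am : a m = 0 := by
      have : ((m : ℝ) + 1) * h = Real.pi := by rw [hh]; field_simp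
      simp [a, this]
    have a0 : a 0 = 0 := by simp [a]
    linarith
  have h3 : ∑ j ∈ range m, (a (j + 1) + a j) =
      2 * (Real.cos h * ∑ j ∈ range m, korovkinWeight m j ^ 2) := by
    rw [mul_sum, mul_sum]
    refine sum_congr rfl fun j _ => ?_
    have e1 : Real.sin (((j + 1 : ℕ) + 1) * h) =
        Real.sin ((j + 1) * h) * Real.cos h + Real.cos ((j + 1) * h) * Real.sin h := by
      rw [← Real.sin_add]; congr 1; push_cast; ring
    have e2 : Real.sin (j * h) =
        Real.sin ((j + 1) * h) * Real.cos h - Real.cos ((j + 1) * h) * Real.sin h := by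
      rw [← Real.sin_sub]; congr 1; ring
    simp only [a, korovkinWeight, ← hh, e1, e2]
    push_cast; ring
  rw [sum_add_distrib, ← h2, ← h1] at h3
  linarith

lemma sum_korovkinKernel (m : ℕ) (t : ℝ) :
    ∑ l ∈ range (2 * m), korovkinKernel m (t - 2 * Real.pi * l / (2 * m : ℕ)) =
      (2 * m : ℕ) * ∑ j ∈ range m, korovkinWeight m j ^ 2 := by
  simp only [korovkinKernel]
  rw [sum_comm, mul_sum]
  refine sum_congr rfl fun j hj => ?_
  rw [sum_comm]
  rw [mem_range] at hj
  rw [sum_eq_single_of_mem j (mem_range.2 hj)]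
  · simp [sq]
  · intro k hk hkj
    rw [mem_range] at hk
    rw [← mul_sum, sum_cos_equidistributed (by omega) (by rw [abs_lt]; omega), mul_zero]

lemma sum_korovkinKernel_mul_cos (m : ℕ) (t : ℝ) :
    ∑ l ∈ range (2 * m), korovkinKernel m (t - 2 * Real.pi * l / (2 * m : ℕ)) *
        Real.cos (t - 2 * Real.pi * l / (2 * m : ℕ)) =
      (2 * m : ℕ) * (Real.cos (Real.pi / (m + 1)) * ∑ j ∈ range m, korovkinWeight m j ^ 2) := by
  have hprod : ∀ (i : ℤ) (u : ℝ), Real.cos (i * u) * Real.cos u =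
      (Real.cos ((i + 1 : ℤ) * u) + Real.cos ((i - 1 : ℤ) * u)) / 2 := by
    intro i u
    push_cast
    rw [add_mul, sub_mul, one_mul, Real.cos_add, Real.cos_sub]; ring
  have hinner : ∀ j ∈ range m, ∀ k ∈ range m, ∑ l ∈ range (2 * m),
      korovkinWeight m j * korovkinWeight m k *
        Real.cos (((j : ℤ) - (k : ℤ) : ℤ) * (t - 2 * Real.pi * l / (2 * m : ℕ))) *
        Real.cos (t - 2 * Real.pi * l / (2 * m : ℕ)) =
      (2 * m : ℕ) / 2 * ((if k = j + 1 then korovkinWeight m j * korovkinWeight m k else 0) +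
        (if j = k + 1 then korovkinWeight m k * korovkinWeight m j else 0)) := by
    intro j hj k hk
    rw [mem_range] at hj hk
    simp_rw [mul_assoc _ _ (Real.cos (t - _)), hprod]
    rw [← mul_sum, ← sum_div, sum_add_distrib,
      sum_cos_equidistributed_eq_ite (by rw [abs_lt]; omega),
      sum_cos_equidistributed_eq_ite (by rw [abs_lt]; omega)]
    have e1 : ((j : ℤ) - k + 1 = 0) ↔ k = j + 1 := by omega
    have e2 : ((j : ℤ) - k - 1 = 0) ↔ j = k + 1 := by omega
    simp only [e1, e2]
    split_ifs <;> ring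
  have hshift : ∀ j ∈ range m, ∑ k ∈ range m,
      (if k = j + 1 then korovkinWeight m j * korovkinWeight m k else 0) =
        korovkinWeight m j * korovkinWeight m (j + 1) := by
    intro j hj
    rw [mem_range] at hj
    rw [sum_ite_eq' (range m) (j + 1) (fun k => korovkinWeight m j * korovkinWeight m k)]
    split_ifs with h
    · rfl
    · have : j + 1 = m := by rw [mem_range] at h; omega
      rw [this, korovkinWeight_last, mul_zero]
  simp only [korovkinKernel, sum_mul]
  rw [sum_comm]
  have : ∀ j ∈ range m, ∑ l ∈ range (2 * m), ∑ k ∈ range m,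
      korovkinWeight m j * korovkinWeight m k *
        Real.cos (((j : ℤ) - (k : ℤ) : ℤ) * (t - 2 * Real.pi * l / (2 * m : ℕ))) *
        Real.cos (t - 2 * Real.pi * l / (2 * m : ℕ)) = ∑ k ∈ range m,
      (2 * m : ℕ) / 2 * ((if k = j + 1 then korovkinWeight m j * korovkinWeight m k else 0) +
        (if j = k + 1 then korovkinWeight m k * korovkinWeight m j else 0)) := by
    intro j hj
    rw [sum_comm]
    exact sum_congr rfl fun k hk => hinner j hj k hk
  rw [sum_congr rfl this]
  simp_rw [← mul_sum, sum_add_distrib]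
  rw [sum_congr rfl hshift, sum_comm (s := range m) (t := range m), sum_congr rfl hshift,
    sum_korovkinWeight_mul_succ]
  ring

lemma abs_rpow_sub_rpow_le {a b γ : ℝ} (ha : 0 ≤ a) (hb : 0 ≤ b) (h0 : 0 ≤ γ) (h1 : γ ≤ 1) :
    |a ^ γ - b ^ γ| ≤ |a - b| ^ γ := by
  wlog hab : b ≤ a generalizing a b
  · rw [abs_sub_comm, abs_sub_comm a]; exact this hb ha (le_of_not_ge hab)
  rw [abs_of_nonneg (sub_nonneg.2 (Real.rpow_le_rpow hb hab h0)), abs_of_nonneg (sub_nonneg.2 hab)]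
  have := Real.rpow_add_le_add_rpow (sub_nonneg.2 hab) hb h0 h1
  rw [sub_add_cancel] at this
  linarith

lemma abs_abs_cos_sub_abs_cos_le (a b : ℝ) :
    |(|Real.cos a| - |Real.cos b|)| ≤ |Real.sin (a - b)| := by
  have key : ∀ a b : ℝ, |Real.cos a| ≤ |Real.cos b| + |Real.sin (a - b)| := by
    intro a b
    have : Real.cos a = Real.cos b * Real.cos (a - b) - Real.sin b * Real.sin (a - b) := by
      rw [← Real.cos_add]; congr 1; ring
    rw [this]
    refine (abs_sub _ _).trans ?_
    rw [abs_mul, abs_mul]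
    exact add_le_add (mul_le_of_le_one_right (abs_nonneg _) (Real.abs_cos_le_one _))
      (mul_le_of_le_one_left (abs_nonneg _) (Real.abs_sin_le_one _))
  have h1 := key a b
  have h2 := key b a
  rw [← neg_sub a b, Real.sin_neg, abs_neg] at h2
  rw [abs_le]; constructor <;> linarith

lemma half_one_add_cos_rpow (β t : ℝ) :
    ((1 + Real.cos t) / 2) ^ β = |Real.cos (t / 2)| ^ (2 * β) := by
  have : (1 + Real.cos t) / 2 = |Real.cos (t / 2)| ^ (2 : ℝ) := by
    rw [Real.rpow_two, sq_abs, Real.cos_sq]; ring_nf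
  rw [this, ← Real.rpow_mul (abs_nonneg _)]

lemma abs_half_one_add_cos_rpow_sub_le {β : ℝ} (h0 : 0 < β) (h1 : β ≤ 1 / 2) {m : ℕ} (hm : 1 ≤ m)
    (s t : ℝ) : |((1 + Real.cos s) / 2) ^ β - ((1 + Real.cos t) / 2) ^ β| ≤
      (m : ℝ) ^ (-(2 * β)) * (1 + m ^ 2 * (1 - Real.cos (t - s)) / 2) := by
  have hm0 : (0 : ℝ) < m := by exact_mod_cast hm
  rw [half_one_add_cos_rpow, half_one_add_cos_rpow]
  refine (abs_rpow_sub_rpow_le (abs_nonneg _) (abs_nonneg _) (by linarith) (by linarith)).trans ?_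
  refine (Real.rpow_le_rpow (abs_nonneg _) (abs_abs_cos_sub_abs_cos_le _ _) (by linarith)).trans ?_
  set x := |Real.sin (s / 2 - t / 2)| with hx
  have hx0 : 0 ≤ x := abs_nonneg _
  have hxs : (1 - Real.cos (t - s)) / 2 = x ^ 2 := by
    have h := Real.cos_sq (s / 2 - t / 2)
    have e : 2 * (s / 2 - t / 2) = -(t - s) := by ring
    rw [e, Real.cos_neg] at h
    rw [hx, sq_abs, Real.sin_sq]; linarith
  rw [mul_div_assoc, hxs, Real.rpow_neg hm0.le, inv_mul_eq_div,
    le_div_iff₀ (Real.rpow_pos_of_pos hm0 _), ← Real.mul_rpow hx0 hm0.le]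
  rcases le_total (x * m) 1 with h | h
  · have := Real.rpow_le_one (by positivity) h (by linarith : 0 ≤ 2 * β)
    nlinarith [sq_nonneg (m * x)]
  · have := Real.rpow_le_rpow_of_exponent_le h (by linarith : 2 * β ≤ 2)
    rw [Real.rpow_two] at this
    nlinarith

lemma sum_korovkinKernel_mul_abs_le {β : ℝ} (h0 : 0 < β) (h1 : β ≤ 1 / 2) {m : ℕ} (hm : 1 ≤ m)
    (t : ℝ) : ∑ l ∈ range (2 * m), korovkinKernel m (t - 2 * Real.pi * l / (2 * m : ℕ)) *
        |((1 + Real.cos (2 * Real.pi * l / (2 * m : ℕ))) / 2) ^ β - ((1 + Real.cos t) / 2) ^ β| ≤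
      4 * (m : ℝ) ^ (-(2 * β)) * ((2 * m : ℕ) * ∑ j ∈ range m, korovkinWeight m j ^ 2) := by
  have hm0 : (0 : ℝ) < m := by exact_mod_cast hm
  set W : ℝ := ∑ j ∈ range m, korovkinWeight m j ^ 2 with hW
  have hW0 : 0 ≤ W := sum_nonneg fun _ _ => sq_nonneg _
  have step : ∀ l ∈ range (2 * m), korovkinKernel m (t - 2 * Real.pi * l / (2 * m : ℕ)) *
        |((1 + Real.cos (2 * Real.pi * l / (2 * m : ℕ))) / 2) ^ β - ((1 + Real.cos t) / 2) ^ β| ≤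
      (m : ℝ) ^ (-(2 * β)) * ((1 + m ^ 2 / 2) *
          korovkinKernel m (t - 2 * Real.pi * l / (2 * m : ℕ)) -
        m ^ 2 / 2 * (korovkinKernel m (t - 2 * Real.pi * l / (2 * m : ℕ)) *
          Real.cos (t - 2 * Real.pi * l / (2 * m : ℕ)))) := by
    intro l _
    refine (mul_le_mul_of_nonneg_left (abs_half_one_add_cos_rpow_sub_le h0 h1 hm _ _)
      (korovkinKernel_nonneg _ _)).trans (le_of_eq ?_)
    ring
  refine (sum_le_sum step).trans ?_
  rw [← mul_sum, sum_sub_distrib, ← mul_sum, ← mul_sum, sum_korovkinKernel,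
    sum_korovkinKernel_mul_cos, ← hW]
  have hc : 1 - Real.cos (Real.pi / (m + 1)) ≤ (Real.pi / (m + 1)) ^ 2 / 2 := by
    linarith [Real.one_sub_sq_div_two_le_cos (x := Real.pi / (m + 1))]
  have hpi : (m : ℝ) ^ 2 * (Real.pi / (m + 1)) ^ 2 ≤ 12 := by
    rw [← mul_pow]
    have h3 : (m : ℝ) * (Real.pi / (m + 1)) ≤ Real.pi := by
      rw [mul_div_assoc', div_le_iff₀ (by positivity)]
      nlinarith [Real.pi_pos]
    have h4 : 0 ≤ (m : ℝ) * (Real.pi / (m + 1)) := by positivity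
    nlinarith [Real.pi_lt_d2]
  have hfin : (1 + (m : ℝ) ^ 2 / 2) - m ^ 2 / 2 * Real.cos (Real.pi / (m + 1)) ≤ 4 := by
    have := mul_le_mul_of_nonneg_left hc (by positivity : (0 : ℝ) ≤ m ^ 2 / 2)
    nlinarith
  have e : (1 + (m : ℝ) ^ 2 / 2) * ((2 * m : ℕ) * W) -
      m ^ 2 / 2 * ((2 * m : ℕ) * (Real.cos (Real.pi / (m + 1)) * W)) =
      ((1 + (m : ℝ) ^ 2 / 2) - m ^ 2 / 2 * Real.cos (Real.pi / (m + 1))) * ((2 * m : ℕ) * W) := by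
    ring
  rw [e, mul_comm (4 : ℝ), mul_assoc]
  gcongr

/-- Jackson-type approximation of `y ↦ y ^ β` on `[0, 1]`, with a bound on the coefficients. -/
theorem exists_polynomial_approx_rpow {β : ℝ} (h0 : 0 < β) (h1 : β ≤ 1 / 2) {m : ℕ} (hm : 1 ≤ m) :
    ∃ p : ℝ[X], p.natDegree ≤ m ∧ (∀ j, |p.coeff j| ≤ 28 ^ m) ∧
      ∀ y ∈ Set.Icc (0 : ℝ) 1, |p.eval y - y ^ β| ≤ 4 * (m : ℝ) ^ (-(2 * β)) := by
  choose R hRd hRc hRe using exists_polynomial_eval_eq_cos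
  set W : ℝ := ∑ j ∈ range m, korovkinWeight m j ^ 2 with hW
  have hm0 : (0 : ℝ) < m := by exact_mod_cast hm
  have hW0 : 0 < W := by
    refine sum_pos (fun j hj => pow_pos (Real.sin_pos_of_pos_of_lt_pi (by positivity) ?_) 2)
      ⟨0, mem_range.2 hm⟩
    rw [mem_range] at hj
    have : (j : ℝ) + 1 < m + 1 := by exact_mod_cast Nat.succ_lt_succ hj
    rw [mul_div_assoc', div_lt_iff₀ (by positivity)]
    nlinarith [Real.pi_pos]
  have hN0 : (0 : ℝ) < (2 * m : ℕ) := by push_cast; positivity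
  let s : ℕ → ℝ := fun l => 2 * Real.pi * l / (2 * m : ℕ)
  let f : ℝ → ℝ := fun t => ((1 + Real.cos t) / 2) ^ β
  have hf01 : ∀ t, 0 ≤ f t ∧ f t ≤ 1 := fun t => by
    have h2 := Real.neg_one_le_cos t
    have h3 := Real.cos_le_one t
    exact ⟨Real.rpow_nonneg (by linarith) _, Real.rpow_le_one (by linarith) (by linarith) h0.le⟩
  let c : ℕ → ℕ → ℕ → ℝ := fun l j k => f (s l) * (korovkinWeight m j * korovkinWeight m k) *
    Real.cos (((j : ℤ) - (k : ℤ) : ℤ) * s l) / ((2 * m : ℕ) * W)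
  let d : ℕ → ℕ → ℕ := fun j k => ((j : ℤ) - (k : ℤ)).natAbs
  refine ⟨∑ l ∈ range (2 * m), ∑ j ∈ range m, ∑ k ∈ range m, C (c l j k) * R (d j k), ?_, ?_, ?_⟩
  · refine natDegree_sum_le_of_forall_le _ _ fun l _ => natDegree_sum_le_of_forall_le _ _
      fun j hj => natDegree_sum_le_of_forall_le _ _ fun k hk => ?_
    rw [mem_range] at hj hk
    exact (natDegree_C_mul_le _ _).trans ((hRd _).trans (by simp only [d]; omega))
  · intro i
    have hterm : ∀ l ∈ range (2 * m), ∀ j ∈ range m, ∀ k ∈ range m,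
        |(C (c l j k) * R (d j k)).coeff i| ≤ 1 / (2 * m : ℕ) * 7 ^ m := by
      intro l _ j hj k hk
      rw [coeff_C_mul, abs_mul]
      refine mul_le_mul ?_ ((hRc _ _).trans ?_) (abs_nonneg _) (by positivity)
      · have hj2 : korovkinWeight m j ^ 2 ≤ W :=
          single_le_sum (f := fun j => korovkinWeight m j ^ 2) (fun _ _ => sq_nonneg _) hj
        have hk2 : korovkinWeight m k ^ 2 ≤ W :=
          single_le_sum (f := fun j => korovkinWeight m j ^ 2) (fun _ _ => sq_nonneg _) hk
        have hjk : |korovkinWeight m j * korovkinWeight m k| ≤ W := by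
          rw [abs_le]; constructor <;>
          nlinarith [sq_nonneg (korovkinWeight m j + korovkinWeight m k),
            sq_nonneg (korovkinWeight m j - korovkinWeight m k)]
        simp only [c]
        rw [abs_div, abs_of_pos (mul_pos hN0 hW0), abs_mul, abs_mul, abs_of_nonneg (hf01 _).1,
          div_le_div_iff₀ (mul_pos hN0 hW0) hN0]
        have h3 : f (s l) * |korovkinWeight m j * korovkinWeight m k| *
            |Real.cos (((j : ℤ) - (k : ℤ) : ℤ) * s l)| ≤ 1 * W * 1 := by
          have := (hf01 (s l)).1
          gcongr
          · exact (hf01 _).2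
          · exact Real.abs_cos_le_one _
        nlinarith
      · rw [mem_range] at hj hk
        exact pow_le_pow_right₀ (by norm_num) (by simp only [d]; omega)
    rw [finsetSum_coeff]
    have hbound : |∑ l ∈ range (2 * m), (∑ j ∈ range m, ∑ k ∈ range m,
        C (c l j k) * R (d j k)).coeff i| ≤
        ∑ l ∈ range (2 * m), ∑ j ∈ range m, ∑ k ∈ range m, 1 / ((2 * m : ℕ) : ℝ) * 7 ^ m := by
      refine (abs_sum_le_sum_abs _ _).trans (sum_le_sum fun l hl => ?_)
      rw [finsetSum_coeff]
      refine (abs_sum_le_sum_abs _ _).trans (sum_le_sum fun j hj => ?_)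
      rw [finsetSum_coeff]
      exact (abs_sum_le_sum_abs _ _).trans (sum_le_sum fun k hk => hterm l hl j hj k hk)
    refine hbound.trans ?_
    simp only [sum_const, card_range, nsmul_eq_mul]
    have hm2 : (m : ℝ) ≤ 2 ^ m := by exact_mod_cast Nat.lt_two_pow_self.le
    have e : ((2 * m : ℕ) : ℝ) * (m * (m * (1 / ((2 * m : ℕ) : ℝ) * 7 ^ m))) = m * m * 7 ^ m := by
      field_simp
    rw [e]
    calc (m : ℝ) * m * 7 ^ m ≤ 2 ^ m * 2 ^ m * 7 ^ m := by gcongr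
      _ = 28 ^ m := by rw [← mul_pow, ← mul_pow]; norm_num
  · intro y hy
    obtain ⟨t, rfl⟩ : ∃ t, y = (1 + Real.cos t) / 2 := by
      refine ⟨Real.arccos (2 * y - 1), ?_⟩
      rw [Real.cos_arccos (by linarith [hy.1]) (by linarith [hy.2])]; ring
    have hcosd : ∀ j k, Real.cos ((d j k : ℝ) * t) = Real.cos (((j : ℤ) - (k : ℤ) : ℤ) * t) := by
      intro j k
      have e : ((d j k : ℕ) : ℝ) = |((((j : ℤ) - (k : ℤ)) : ℤ) : ℝ)| := by
        rw [← Int.cast_abs, Int.abs_eq_natAbs]; simp [d]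
      rw [e]
      rcases abs_choice ((((j : ℤ) - (k : ℤ)) : ℤ) : ℝ) with h | h
      · rw [h]
      · rw [h, neg_mul, Real.cos_neg]
    have heval : (∑ l ∈ range (2 * m), ∑ j ∈ range m, ∑ k ∈ range m,
        C (c l j k) * R (d j k)).eval ((1 + Real.cos t) / 2) =
        ∑ l ∈ range (2 * m), f (s l) * ((korovkinKernel m (t - s l) +
          korovkinKernel m (-t - s l)) / 2) / ((2 * m : ℕ) * W) := by
      simp only [eval_finsetSum, eval_mul, eval_C, hRe, hcosd]
      refine sum_congr rfl fun l _ => ?_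
      simp only [korovkinKernel]
      rw [← sum_add_distrib, sum_div, mul_sum, sum_div]
      refine sum_congr rfl fun j _ => ?_
      rw [← sum_add_distrib, sum_div, mul_sum, sum_div]
      refine sum_congr rfl fun k _ => ?_
      have e1 := Real.cos_sub ((((j : ℤ) - (k : ℤ) : ℤ) : ℝ) * t) (((j : ℤ) - (k : ℤ) : ℤ) * s l)
      have e2 := Real.cos_sub (-((((j : ℤ) - (k : ℤ) : ℤ) : ℝ) * t)) (((j : ℤ) - (k : ℤ) : ℤ) * s l)
      rw [Real.cos_neg, Real.sin_neg] at e2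
      rw [mul_sub, mul_sub, mul_neg, e1, e2]
      simp only [c]; ring
    have hone : ∀ t', ∑ l ∈ range (2 * m), korovkinKernel m (t' - s l) = (2 * m : ℕ) * W :=
      fun t' => sum_korovkinKernel m t'
    have hdiff : (∑ l ∈ range (2 * m), ∑ j ∈ range m, ∑ k ∈ range m,
        C (c l j k) * R (d j k)).eval ((1 + Real.cos t) / 2) - f t =
        (∑ l ∈ range (2 * m), (korovkinKernel m (t - s l) * (f (s l) - f t) +
          korovkinKernel m (-t - s l) * (f (s l) - f t))) / (2 * ((2 * m : ℕ) * W)) := by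
      have e3 : f t = (∑ l ∈ range (2 * m), (korovkinKernel m (t - s l) +
          korovkinKernel m (-t - s l)) * f t) / (2 * ((2 * m : ℕ) * W)) := by
        rw [← sum_mul, sum_add_distrib, hone, hone]
        field_simp; ring
      rw [heval]
      refine (congrArg₂ (· - ·) rfl e3).trans ?_
      rw [sum_div, sum_div, ← sum_sub_distrib]
      refine sum_congr rfl fun l _ => ?_
      field_simp
    change |_ - f t| ≤ _
    rw [hdiff, abs_div, abs_of_pos (by positivity : (0 : ℝ) < 2 * ((2 * m : ℕ) * W)),
      div_le_iff₀ (by positivity)]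
    have hs1 := sum_korovkinKernel_mul_abs_le h0 h1 hm t
    have hs2 := sum_korovkinKernel_mul_abs_le h0 h1 hm (-t)
    rw [Real.cos_neg] at hs2
    refine (abs_sum_le_sum_abs _ _).trans ((sum_le_sum (g := fun l =>
      korovkinKernel m (t - s l) * |f (s l) - f t| + korovkinKernel m (-t - s l) * |f (s l) - f t|)
      fun l _ => ?_).trans ?_)
    · refine (abs_add_le _ _).trans (le_of_eq ?_)
      rw [abs_mul, abs_mul, abs_of_nonneg (korovkinKernel_nonneg _ _),
        abs_of_nonneg (korovkinKernel_nonneg _ _)]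
    · rw [sum_add_distrib]
      simp only [s, f]
      linarith

end PolynomialApproximation

section Poisson

open MeasureTheory ProbabilityTheory Finset
open scoped NNReal

/-- Functions on `ℕ` of at most exponential growth. -/
def ExpGrowth (f : ℕ → ℝ) : Prop := ∃ C R : ℝ, 0 ≤ C ∧ 1 ≤ R ∧ ∀ k, |f k| ≤ C * R ^ k

namespace ExpGrowth

variable {f g : ℕ → ℝ}

lemma of_bounded {C : ℝ} (h : ∀ k, |f k| ≤ C) : ExpGrowth f :=
  ⟨C, 1, (abs_nonneg _).trans (h 0), le_rfl, by simpa using h⟩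

lemma const (c : ℝ) : ExpGrowth fun _ => c := of_bounded fun _ => le_rfl

lemma natCast : ExpGrowth fun k => (k : ℝ) :=
  ⟨1, 2, zero_le_one, one_le_two, fun k => by
    rw [Nat.abs_cast, one_mul]; exact_mod_cast Nat.lt_two_pow_self.le⟩

lemma add (hf : ExpGrowth f) (hg : ExpGrowth g) : ExpGrowth fun k => f k + g k := by
  obtain ⟨C, R, hC, hR, h⟩ := hf
  obtain ⟨C', R', hC', hR', h'⟩ := hg
  refine ⟨C + C', R * R', by positivity, by nlinarith, fun k => ?_⟩
  have e1 : 1 ≤ R ^ k := one_le_pow₀ hR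
  have e2 : 1 ≤ R' ^ k := one_le_pow₀ hR'
  have e3 : C * R ^ k ≤ C * R ^ k * R' ^ k := le_mul_of_one_le_right (by positivity) e2
  have e4 : C' * R' ^ k ≤ C' * R' ^ k * R ^ k := le_mul_of_one_le_right (by positivity) e1
  rw [mul_pow]
  linarith [abs_add_le (f k) (g k), h k, h' k]

lemma mul (hf : ExpGrowth f) (hg : ExpGrowth g) : ExpGrowth fun k => f k * g k := by
  obtain ⟨C, R, hC, hR, h⟩ := hf
  obtain ⟨C', R', hC', hR', h'⟩ := hg
  refine ⟨C * C', R * R', by positivity, by nlinarith, fun k => ?_⟩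
  rw [abs_mul, mul_pow]
  calc |f k| * |g k| ≤ (C * R ^ k) * (C' * R' ^ k) :=
        mul_le_mul (h k) (h' k) (abs_nonneg _) (by positivity)
    _ = _ := by ring

lemma sub (hf : ExpGrowth f) (hg : ExpGrowth g) : ExpGrowth fun k => f k - g k := by
  simpa [sub_eq_add_neg] using hf.add ((const (-1)).mul hg)

lemma sq (hf : ExpGrowth f) : ExpGrowth fun k => f k ^ 2 := by
  simpa [pow_two] using hf.mul hf

lemma mono (hg : ExpGrowth g) (h : ∀ k, |f k| ≤ |g k|) : ExpGrowth f := by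
  obtain ⟨C, R, hC, hR, h'⟩ := hg
  exact ⟨C, R, hC, hR, fun k => (h k).trans (h' k)⟩

lemma pred (hf : ExpGrowth f) : ExpGrowth fun k => f (k - 1) := by
  obtain ⟨C, R, hC, hR, h⟩ := hf
  exact ⟨C, R, hC, hR, fun k => (h _).trans (by gcongr; exact Nat.sub_le _ _)⟩

lemma integrable (hf : ExpGrowth f) (r : ℝ≥0) : Integrable f (poissonMeasure r) := by
  obtain ⟨C, R, hC, hR, h⟩ := hf
  rw [integrable_poissonMeasure_iff]
  refine Summable.of_nonneg_of_le (fun n => by positivity) (fun n => ?_)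
    ((Real.summable_pow_div_factorial (r * R)).mul_left (Real.exp (-r) * C))
  calc Real.exp (-r) * r ^ n / n.factorial * ‖f n‖
      ≤ Real.exp (-r) * r ^ n / n.factorial * (C * R ^ n) := by gcongr; exact h n
    _ = _ := by rw [mul_pow]; ring

end ExpGrowth

lemma integral_pow_poissonMeasure (r : ℝ≥0) (R : ℝ) :
    ∫ k, R ^ k ∂poissonMeasure r = Real.exp (r * (R - 1)) := by
  rw [integral_poissonMeasure]
  have h := (NormedSpace.expSeries_div_hasSum_exp ((r : ℝ) * R)).mul_left (Real.exp (-r))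
  rw [← Real.exp_eq_exp_ℝ, ← Real.exp_add] at h
  have e : (-(r : ℝ) + r * R) = r * (R - 1) := by ring
  rw [e] at h
  rw [← h.tsum_eq]
  refine tsum_congr fun n => ?_
  rw [smul_eq_mul, mul_pow]; ring

/-- The Stein–Chen identity for the Poisson distribution. -/
lemma integral_natCast_mul_pred_poissonMeasure (r : ℝ≥0) (f : ℕ → ℝ) :
    ∫ k, (k : ℝ) * f (k - 1) ∂poissonMeasure r = r * ∫ k, f k ∂poissonMeasure r := by
  rw [integral_poissonMeasure, integral_poissonMeasure, ← tsum_mul_left,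
    ← Function.Injective.tsum_eq Nat.succ_injective]
  · refine tsum_congr fun n => ?_
    simp only [Nat.succ_eq_add_one, smul_eq_mul, Nat.factorial_succ, Nat.add_sub_cancel]
    push_cast
    have : ((n : ℝ) + 1) ≠ 0 := by positivity
    field_simp
    ring
  · intro k hk
    rcases Nat.eq_zero_or_eq_succ_pred k with h | h
    · simp [h] at hk
    · exact ⟨_, h.symm⟩

lemma integral_natCast_poissonMeasure (r : ℝ≥0) : ∫ k, (k : ℝ) ∂poissonMeasure r = r := by
  simpa using integral_natCast_mul_pred_poissonMeasure r fun _ => 1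

lemma integral_natCast_mul_poissonMeasure (r : ℝ≥0) (f : ℕ → ℝ) :
    ∫ k, (k : ℝ) * f k ∂poissonMeasure r = r * ∫ k, f (k + 1) ∂poissonMeasure r := by
  rw [← integral_natCast_mul_pred_poissonMeasure r fun k => f (k + 1)]
  refine integral_congr_ae (Filter.Eventually.of_forall fun k => ?_)
  cases k <;> simp

lemma integral_natCast_sq_poissonMeasure (r : ℝ≥0) :
    ∫ k, (k : ℝ) ^ 2 ∂poissonMeasure r = r ^ 2 + r := by
  simp_rw [pow_two]
  rw [integral_natCast_mul_poissonMeasure r fun k => (k : ℝ)]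
  push_cast
  rw [integral_add (ExpGrowth.natCast.integrable r) (integrable_const _),
    integral_natCast_poissonMeasure]
  simp; ring

lemma integral_natCast_cube_poissonMeasure (r : ℝ≥0) :
    ∫ k, (k : ℝ) ^ 3 ∂poissonMeasure r = r ^ 3 + 3 * r ^ 2 + r := by
  have h : ∀ k : ℕ, (k : ℝ) ^ 3 = k * (k : ℝ) ^ 2 := fun k => by ring
  simp_rw [h]
  rw [integral_natCast_mul_poissonMeasure r fun k => (k : ℝ) ^ 2]
  have h' : ∀ k : ℕ, ((k + 1 : ℕ) : ℝ) ^ 2 = (k : ℝ) ^ 2 + (2 * k + 1) := fun k => by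
    push_cast; ring
  simp_rw [h']
  rw [integral_add (ExpGrowth.natCast.sq.integrable r)
      ((((ExpGrowth.const 2).mul ExpGrowth.natCast).add (ExpGrowth.const 1)).integrable r),
    integral_add (((ExpGrowth.const 2).mul ExpGrowth.natCast).integrable r) (integrable_const _),
    integral_const_mul, integral_natCast_poissonMeasure, integral_natCast_sq_poissonMeasure]
  simp; ring

/-- The integral of a cubic polynomial against the Poisson distribution. -/
lemma integral_cubic_poissonMeasure (r : ℝ≥0) (a b c d : ℝ) :
    ∫ k, (a * (k : ℝ) ^ 3 + b * (k : ℝ) ^ 2 + c * k + d) ∂poissonMeasure r =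
      a * (r ^ 3 + 3 * r ^ 2 + r) + b * (r ^ 2 + r) + c * r + d := by
  have g1 := ExpGrowth.natCast
  have g3 : ExpGrowth fun k => (k : ℝ) ^ 3 := by
    simpa [pow_succ] using (g1.mul g1).mul g1
  have ga := (ExpGrowth.const a).mul g3
  have gb := (ExpGrowth.const b).mul g1.sq
  have gc := (ExpGrowth.const c).mul g1
  rw [integral_add (((ga.add gb).add gc).integrable r) (integrable_const _),
    integral_add ((ga.add gb).integrable r) (gc.integrable r),
    integral_add (ga.integrable r) (gb.integrable r), integral_const_mul, integral_const_mul,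
    integral_const_mul, integral_natCast_poissonMeasure, integral_natCast_sq_poissonMeasure,
    integral_natCast_cube_poissonMeasure]
  simp

lemma integral_descFactorial_poissonMeasure (r : ℝ≥0) (j : ℕ) :
    ∫ k, ((k.descFactorial j : ℕ) : ℝ) ∂poissonMeasure r = (r : ℝ) ^ j := by
  induction j with
  | zero => simp
  | succ j ih =>
    have h : ∀ k : ℕ, ((k.descFactorial (j + 1) : ℕ) : ℝ) =
        k * ((((k - 1).descFactorial j : ℕ)) : ℝ) := by
      intro k
      cases k with
      | zero => simp
      | succ k => rw [Nat.succ_descFactorial_succ]; push_cast; simp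
    simp_rw [h]
    rw [integral_natCast_mul_pred_poissonMeasure r fun k => ((k.descFactorial j : ℕ) : ℝ), ih]
    ring

/-- Functions on `ℕ × ℕ` of at most exponential growth. -/
def ExpGrowthProd (F : ℕ × ℕ → ℝ) : Prop :=
  ∃ C R : ℝ, 0 ≤ C ∧ 1 ≤ R ∧ ∀ p, |F p| ≤ C * R ^ (p.1 + p.2)

namespace ExpGrowthProd

lemma mul {F G : ℕ × ℕ → ℝ} (hF : ExpGrowthProd F) (hG : ExpGrowthProd G) :
    ExpGrowthProd fun p => F p * G p := by
  obtain ⟨C, R, hC, hR, h⟩ := hF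
  obtain ⟨C', R', hC', hR', h'⟩ := hG
  refine ⟨C * C', R * R', by positivity, by nlinarith, fun k => ?_⟩
  rw [abs_mul, mul_pow]
  calc |F k| * |G k| ≤ (C * R ^ (k.1 + k.2)) * (C' * R' ^ (k.1 + k.2)) :=
        mul_le_mul (h k) (h' k) (abs_nonneg _) (by positivity)
    _ = _ := by ring

lemma add {F G : ℕ × ℕ → ℝ} (hF : ExpGrowthProd F) (hG : ExpGrowthProd G) :
    ExpGrowthProd fun p => F p + G p := by
  obtain ⟨C, R, hC, hR, h⟩ := hF
  obtain ⟨C', R', hC', hR', h'⟩ := hG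
  refine ⟨C + C', R * R', by positivity, by nlinarith, fun k => ?_⟩
  have e1 : 1 ≤ R ^ (k.1 + k.2) := one_le_pow₀ hR
  have e2 : 1 ≤ R' ^ (k.1 + k.2) := one_le_pow₀ hR'
  have e3 := le_mul_of_one_le_right (mul_nonneg hC (zero_le_one.trans e1)) e2
  have e4 := le_mul_of_one_le_right (mul_nonneg hC' (zero_le_one.trans e2)) e1
  rw [mul_pow]
  linarith [abs_add_le (F k) (G k), h k, h' k]

lemma comp_fst {f : ℕ → ℝ} (hf : ExpGrowth f) : ExpGrowthProd fun p => f p.1 := by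
  obtain ⟨C, R, hC, hR, h⟩ := hf
  exact ⟨C, R, hC, hR, fun p => (h _).trans (by gcongr; exact Nat.le_add_right _ _)⟩

lemma comp_snd {f : ℕ → ℝ} (hf : ExpGrowth f) : ExpGrowthProd fun p => f p.2 := by
  obtain ⟨C, R, hC, hR, h⟩ := hf
  exact ⟨C, R, hC, hR, fun p => (h _).trans (by gcongr; exact Nat.le_add_left _ _)⟩

lemma integrable {F : ℕ × ℕ → ℝ} (hF : ExpGrowthProd F) (r s : ℝ≥0) :
    Integrable F ((poissonMeasure r).prod (poissonMeasure s)) := by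
  obtain ⟨C, R, hC, hR, h⟩ := hF
  have g : ExpGrowth fun k => R ^ k :=
    ⟨1, R, zero_le_one, hR, fun k => by rw [one_mul, abs_of_nonneg (by positivity)]⟩
  refine (((g.integrable r).mul_prod (g.integrable s)).const_mul C).mono
    (measurable_of_countable F).aestronglyMeasurable (Filter.Eventually.of_forall fun p => ?_)
  rw [Real.norm_eq_abs, Real.norm_eq_abs, ← pow_add]
  exact (h p).trans (le_abs_self _)

end ExpGrowthProd

/-- The average of `h` over the binomial splittings of a count. -/
noncomputable def binomialSplit (h : ℕ × ℕ → ℝ) (k : ℕ) : ℝ :=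
  ∑ p ∈ antidiagonal k, (k.choose p.1 : ℝ) / 2 ^ k * h p

lemma sum_choose_div_two_pow (k : ℕ) :
    ∑ p ∈ antidiagonal k, (k.choose p.1 : ℝ) / 2 ^ k = 1 := by
  rw [← sum_div, Finset.Nat.sum_antidiagonal_eq_sum_range_succ_mk]
  have := Nat.sum_range_choose k
  have h : (∑ j ∈ range k.succ, (k.choose j : ℝ)) = 2 ^ k := by exact_mod_cast this
  simp only [h]
  field_simp

lemma ExpGrowthProd.binomialSplit {h : ℕ × ℕ → ℝ} (hh : ExpGrowthProd h) :
    ExpGrowth (binomialSplit h) := by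
  obtain ⟨C, R, hC, hR, hb⟩ := hh
  refine ⟨C, R, hC, hR, fun k => ?_⟩
  calc |_root_.binomialSplit h k| ≤ ∑ p ∈ antidiagonal k, (k.choose p.1 : ℝ) / 2 ^ k * (C * R ^ k) := by
        refine (abs_sum_le_sum_abs _ _).trans (sum_le_sum fun p hp => ?_)
        rw [abs_mul, abs_of_nonneg (by positivity), ← mem_antidiagonal.1 hp]
        gcongr
        exact hb p
    _ = C * R ^ k := by rw [← sum_mul, sum_choose_div_two_pow, one_mul]

/-- Poisson splitting: independent halves of a Poisson count are independent Poisson. -/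
lemma integral_binomialSplit {h : ℕ × ℕ → ℝ} (hh : ExpGrowthProd h) (r : ℝ≥0) :
    ∫ k, binomialSplit h k ∂poissonMeasure (2 * r) =
      ∫ p, h p ∂(poissonMeasure r).prod (poissonMeasure r) := by
  set ν := (poissonMeasure r).prod (poissonMeasure r) with hν
  have hi : Integrable h ν := hh.integrable r r
  have hs : HasSum (fun p => ν.real {p} • h p) (∫ p, h p ∂ν) := by
    have := hi
    rw [← Measure.sum_smul_dirac ν] at this
    have h2 := hasSum_integral_measure this
    rw [Measure.sum_smul_dirac] at h2
    simpa [integral_smul_measure, measureReal_def] using h2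
  have hs2 := (HasAntidiagonal.sigmaAntidiagonalEquivProd (A := ℕ)).hasSum_iff.2 hs
  have hs3 := hs2.sigma (fun k => hasSum_fintype _)
  rw [integral_poissonMeasure, ← hs3.tsum_eq]
  refine tsum_congr fun k => ?_
  simp only [Function.comp_apply, HasAntidiagonal.sigmaAntidiagonalEquivProd_apply]
  rw [Finset.sum_coe_sort (antidiagonal k) (fun p => ν.real {p} • h p), binomialSplit, smul_eq_mul,
    mul_sum]
  refine sum_congr rfl fun p hp => ?_
  have hk := mem_antidiagonal.1 hp
  have e : ν.real {p} = (Real.exp (-r) * r ^ p.1 / p.1.factorial) *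
      (Real.exp (-r) * r ^ p.2 / p.2.factorial) := by
    have : ({p} : Set (ℕ × ℕ)) = {p.1} ×ˢ {p.2} := by simp
    rw [this, hν, measureReal_prod_prod, poissonMeasure_real_singleton,
      poissonMeasure_real_singleton]
  have hc : (k.choose p.1 : ℝ) = k.factorial / (p.1.factorial * p.2.factorial) := by
    rw [← hk, Nat.cast_add_choose]
  rw [e, smul_eq_mul, hc, ← hk, NNReal.coe_mul, NNReal.coe_ofNat, mul_pow,
    show -(2 * (r : ℝ)) = -r + -r by ring, Real.exp_add, pow_add (r : ℝ)]
  have := Nat.factorial_pos (p.1 + p.2)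
  field_simp

/-- Jensen's inequality for `binomialSplit`, in weighted second-moment form. -/
lemma integral_mul_binomialSplit_sub_sq_le {h : ℕ × ℕ → ℝ} (hh : ExpGrowthProd h) (r : ℝ≥0)
    (c : ℝ) : ∫ k, ((k : ℝ) + 1) * (binomialSplit h k - c) ^ 2 ∂poissonMeasure (2 * r) ≤
      ∫ p, ((p.1 : ℝ) + p.2 + 1) * (h p - c) ^ 2 ∂(poissonMeasure r).prod (poissonMeasure r) := by
  have hc : ExpGrowthProd fun p => h p - c := by
    simpa [sub_eq_add_neg] using hh.add (ExpGrowthProd.comp_fst (ExpGrowth.const (-c)))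
  have hF : ExpGrowthProd fun p => ((p.1 : ℝ) + p.2 + 1) * (h p - c) ^ 2 := by
    simp_rw [pow_two]
    exact (((ExpGrowthProd.comp_fst ExpGrowth.natCast).add
      (ExpGrowthProd.comp_snd ExpGrowth.natCast)).add
      (ExpGrowthProd.comp_fst (ExpGrowth.const 1))).mul (hc.mul hc)
  rw [← integral_binomialSplit hF]
  refine integral_mono (((ExpGrowth.natCast.add (ExpGrowth.const 1)).mul
    (hh.binomialSplit.sub (ExpGrowth.const c)).sq).integrable _)
    (hF.binomialSplit.integrable _) fun k => ?_
  have e1 : binomialSplit h k - c =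
      ∑ p ∈ antidiagonal k, (k.choose p.1 : ℝ) / 2 ^ k * (h p - c) := by
    simp only [mul_sub, sum_sub_distrib, ← sum_mul, sum_choose_div_two_pow, one_mul]
    rfl
  have e2 : binomialSplit (fun p => ((p.1 : ℝ) + p.2 + 1) * (h p - c) ^ 2) k =
      ((k : ℝ) + 1) * ∑ p ∈ antidiagonal k, (k.choose p.1 : ℝ) / 2 ^ k * (h p - c) ^ 2 := by
    rw [binomialSplit, mul_sum]
    refine sum_congr rfl fun p hp => ?_
    have : (k : ℝ) = p.1 + p.2 := by exact_mod_cast (mem_antidiagonal.1 hp).symm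
    rw [this]; ring
  simp only [e1, e2]
  gcongr
  simpa only [smul_eq_mul] using (even_two.convexOn_pow (𝕜 := ℝ)).map_sum_le (t := antidiagonal k)
    (w := fun p => (k.choose p.1 : ℝ) / 2 ^ k) (p := fun p => h p - c)
    (fun p _ => by positivity) (sum_choose_div_two_pow k) (fun p _ => Set.mem_univ _)

end Poisson

section PoissonPower

open MeasureTheory ProbabilityTheory Finset Polynomial
open scoped NNReal

lemma one_add_mul_sub_sq_le_rpow {β u : ℝ} (h0 : 0 < β) (h1 : β < 1) (hu : 0 ≤ u) :
    1 + β * (u - 1) - (u - 1) ^ 2 ≤ u ^ β := by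
  have hB := rpow_one_add_le_one_add_mul_self (s := u - 1) (p := 1 - β) (by linarith)
    (by linarith) (by linarith)
  rw [add_sub_cancel] at hB
  have hv : 0 < 1 + (1 - β) * (u - 1) := by nlinarith
  have hmul : u ^ β * u ^ (1 - β) = u := by
    rw [← Real.rpow_add' hu (by norm_num), add_sub_cancel, Real.rpow_one]
  have hle : u ≤ u ^ β * (1 + (1 - β) * (u - 1)) := by
    calc u = u ^ β * u ^ (1 - β) := hmul.symm
      _ ≤ _ := mul_le_mul_of_nonneg_left hB (Real.rpow_nonneg hu _)
  refine le_of_mul_le_mul_right (le_trans ?_ hle) hv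
  have hb : 0 ≤ 1 - β * (1 - β) + (1 - β) * (u - 1) := by nlinarith
  nlinarith [mul_nonneg (sq_nonneg (u - 1)) hb]

lemma rpow_tangent_le {β s x : ℝ} (h0 : 0 < β) (h1 : β < 1) (hs : 0 < s) (hx : 0 ≤ x) :
    s ^ β + β * s ^ (β - 1) * (x - s) - s ^ (β - 2) * (x - s) ^ 2 ≤ x ^ β := by
  have h := one_add_mul_sub_sq_le_rpow h0 h1 (div_nonneg hx hs.le)
  rw [Real.div_rpow hx hs.le] at h
  have hsβ := Real.rpow_pos_of_pos hs β
  have h' := mul_le_mul_of_nonneg_left h hsβ.le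
  rw [mul_div_cancel₀ _ hsβ.ne'] at h'
  refine le_trans (le_of_eq ?_) h'
  rw [Real.rpow_sub_one hs.ne', Real.rpow_sub hs, Real.rpow_two]
  field_simp

lemma rpow_le_tangent {β s x : ℝ} (h0 : 0 < β) (h1 : β < 1) (hs : 0 < s) (hx : 0 ≤ x) :
    x ^ β ≤ s ^ β + β * s ^ (β - 1) * (x - s) := by
  have hxs : -1 ≤ x / s - 1 := by linarith [div_nonneg hx hs.le]
  have h := rpow_one_add_le_one_add_mul_self hxs h0.le h1.le
  rw [add_sub_cancel, Real.div_rpow hx hs.le] at h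
  have hsβ := Real.rpow_pos_of_pos hs β
  have h' := mul_le_mul_of_nonneg_left h hsβ.le
  rw [mul_div_cancel₀ _ hsβ.ne'] at h'
  refine h'.trans (le_of_eq ?_)
  rw [Real.rpow_sub_one hs.ne']
  field_simp

lemma rpow_sub_rpow_sq_le {β s x : ℝ} (h0 : 0 < β) (h1 : β < 1) (hs : 0 < s) (hx : 0 ≤ x) :
    (x ^ β - s ^ β) ^ 2 ≤ s ^ (2 * β - 2) * (x - s) ^ 2 := by
  have hu : 0 ≤ x / s := div_nonneg hx hs.le
  have key : |(x / s) ^ β - 1| ≤ |x / s - 1| := by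
    rcases le_total (x / s) 1 with h | h
    · have e1 := Real.rpow_le_one hu h h0.le
      have e2 : x / s ≤ (x / s) ^ β := by
        rcases hu.eq_or_lt with h3 | h3
        · rw [← h3, Real.zero_rpow h0.ne']
        · simpa using Real.rpow_le_rpow_of_exponent_ge h3 h h1.le
      rw [abs_of_nonpos (by linarith), abs_of_nonpos (by linarith)]; linarith
    · have e1 := Real.one_le_rpow h h0.le
      have e2 : (x / s) ^ β ≤ x / s := by
        simpa using Real.rpow_le_rpow_of_exponent_le h h1.le
      rw [abs_of_nonneg (by linarith), abs_of_nonneg (by linarith)]; linarith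
  have hsβ := Real.rpow_pos_of_pos hs β
  have hsq := mul_le_mul_of_nonneg_left (sq_le_sq.2 key) (sq_nonneg (s ^ β))
  rw [Real.div_rpow hx hs.le] at hsq
  have e1 : (s ^ β) ^ 2 * (x ^ β / s ^ β - 1) ^ 2 = (x ^ β - s ^ β) ^ 2 := by
    rw [← mul_pow]; congr 1; field_simp
  have e2 : (s ^ β) ^ 2 * (x / s - 1) ^ 2 = s ^ (2 * β - 2) * (x - s) ^ 2 := by
    rw [Real.rpow_sub hs, mul_comm 2 β, Real.rpow_mul hs.le, Real.rpow_two, Real.rpow_two]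
    field_simp
  rwa [e1, e2] at hsq

lemma ExpGrowth.rpow {β : ℝ} (h0 : 0 < β) (h1 : β < 1) : ExpGrowth fun k => (k : ℝ) ^ β := by
  refine (ExpGrowth.natCast.add (ExpGrowth.const 1)).mono fun k => ?_
  have hk : (0 : ℝ) ≤ k := Nat.cast_nonneg k
  rw [abs_of_nonneg (Real.rpow_nonneg hk _), abs_of_nonneg (by positivity)]
  have := rpow_le_tangent h0 h1 one_pos hk
  simp only [Real.one_rpow] at this
  nlinarith

lemma abs_integral_rpow_sub_le {β : ℝ} (h0 : 0 < β) (h1 : β < 1) {s : ℝ≥0} (hs : 0 < s) :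
    |∫ k, (k : ℝ) ^ β ∂poissonMeasure s - (s : ℝ) ^ β| ≤ (s : ℝ) ^ (β - 1) := by
  have hs' : (0 : ℝ) < s := hs
  have gi := (ExpGrowth.rpow h0 h1).integrable s
  have g1 := ExpGrowth.natCast
  set S := (s : ℝ)
  have gq : ∀ b c d : ℝ, Integrable (fun k : ℕ => 0 * (k : ℝ) ^ 3 + b * (k : ℝ) ^ 2 + c * k + d)
      (poissonMeasure s) := fun b c d => by
    simpa using ((((ExpGrowth.const b).mul g1.sq).add ((ExpGrowth.const c).mul g1)).add
      (ExpGrowth.const d)).integrable s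
  have hu : ∫ k, (k : ℝ) ^ β ∂poissonMeasure s ≤ S ^ β := by
    calc ∫ k, (k : ℝ) ^ β ∂poissonMeasure s
        ≤ ∫ k : ℕ, (0 * (k : ℝ) ^ 3 + 0 * (k : ℝ) ^ 2 + (β * S ^ (β - 1)) * k +
          (S ^ β - β * S ^ (β - 1) * S)) ∂poissonMeasure s := by
          refine integral_mono gi (gq _ _ _) fun k => ?_
          have := rpow_le_tangent h0 h1 hs' (Nat.cast_nonneg k)
          dsimp only; linarith
      _ = S ^ β := by rw [integral_cubic_poissonMeasure]; ring
  have hl : S ^ β - S ^ (β - 1) ≤ ∫ k, (k : ℝ) ^ β ∂poissonMeasure s := by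
    calc S ^ β - S ^ (β - 1) = ∫ k : ℕ, (0 * (k : ℝ) ^ 3 + (-S ^ (β - 2)) * (k : ℝ) ^ 2 +
          (β * S ^ (β - 1) + 2 * S ^ (β - 2) * S) * k +
          (S ^ β - β * S ^ (β - 1) * S - S ^ (β - 2) * S ^ 2)) ∂poissonMeasure s := by
          rw [integral_cubic_poissonMeasure]
          have : S ^ (β - 1) = S ^ (β - 2) * S := by
            rw [← Real.rpow_add_one hs'.ne']; congr 1; ring
          rw [this]; ring
      _ ≤ _ := by
          refine integral_mono (gq _ _ _) gi fun k => ?_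
          have := rpow_tangent_le h0 h1 hs' (Nat.cast_nonneg k)
          dsimp only; linarith
  have := Real.rpow_nonneg hs'.le (β - 1)
  rw [abs_le]; constructor <;> linarith

lemma integral_mul_rpow_sub_sq_le {β : ℝ} (h0 : 0 < β) (h1 : β < 1) (s : ℝ≥0) :
    ∫ k, ((k : ℝ) + 1 + s) * ((k : ℝ) ^ β - (s : ℝ) ^ β) ^ 2 ∂poissonMeasure s ≤
      20 + 4 * (s : ℝ) ^ (2 * β) := by
  have g1 := ExpGrowth.natCast
  have gi := (((g1.add (ExpGrowth.const 1)).add (ExpGrowth.const (s : ℝ))).mul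
    ((ExpGrowth.rpow h0 h1).sub (ExpGrowth.const ((s : ℝ) ^ β))).sq).integrable s
  have gq : ∀ a b c d : ℝ, Integrable (fun k : ℕ => a * (k : ℝ) ^ 3 + b * (k : ℝ) ^ 2 + c * k + d)
      (poissonMeasure s) := fun a b c d => by
    simpa [pow_succ] using (((((ExpGrowth.const a).mul ((g1.mul g1).mul g1)).add
      ((ExpGrowth.const b).mul g1.sq)).add ((ExpGrowth.const c).mul g1)).add
      (ExpGrowth.const d)).integrable s
  set S := (s : ℝ) with hS
  have hS0 : 0 ≤ S := s.coe_nonneg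
  rcases lt_or_ge S 1 with h | h
  · have hle : ∫ k, ((k : ℝ) + 1 + S) * ((k : ℝ) ^ β - S ^ β) ^ 2 ∂poissonMeasure s ≤
        ∫ k : ℕ, (1 * (k : ℝ) ^ 3 + 4 * (k : ℝ) ^ 2 + 5 * k + 2) ∂poissonMeasure s := by
      refine integral_mono gi (gq _ _ _ _) fun k => ?_
      have hk : (0 : ℝ) ≤ k := Nat.cast_nonneg k
      have hb := rpow_le_tangent h0 h1 one_pos hk
      simp only [Real.one_rpow] at hb
      have hb0 := Real.rpow_nonneg hk β
      have hs0 := Real.rpow_nonneg hS0 β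
      have hs1 := Real.rpow_le_one hS0 h.le h0.le
      have hsq : ((k : ℝ) ^ β - S ^ β) ^ 2 ≤ (k + 1) ^ 2 := by
        rw [sq_le_sq, abs_of_nonneg (by positivity : (0 : ℝ) ≤ k + 1), abs_le]
        constructor <;> nlinarith
      calc ((k : ℝ) + 1 + S) * ((k : ℝ) ^ β - S ^ β) ^ 2 ≤ (k + 1 + 1) * (k + 1) ^ 2 := by
            gcongr
        _ = _ := by ring
    refine hle.trans ?_
    rw [integral_cubic_poissonMeasure]
    have := Real.rpow_nonneg hS0 (2 * β)
    have h2 : S ^ 2 ≤ 1 := by nlinarith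
    have h3 : S ^ 3 ≤ 1 := pow_le_one₀ hS0 h.le
    simp only [← hS]
    linarith
  · have hpos : 0 < S := by linarith
    set t := S ^ (2 * β - 2) with ht
    have hle : ∫ k, ((k : ℝ) + 1 + S) * ((k : ℝ) ^ β - S ^ β) ^ 2 ∂poissonMeasure s ≤
        ∫ k : ℕ, (t * (k : ℝ) ^ 3 + (t * (1 - S)) * (k : ℝ) ^ 2 + (t * (- 2 * S - S ^ 2)) * k +
          t * ((1 + S) * S ^ 2)) ∂poissonMeasure s := by
      refine integral_mono gi (gq _ _ _ _) fun k => ?_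
      have hk : (0 : ℝ) ≤ k := Nat.cast_nonneg k
      calc ((k : ℝ) + 1 + S) * ((k : ℝ) ^ β - S ^ β) ^ 2 ≤ (k + 1 + S) * (t * (k - S) ^ 2) := by
            gcongr; exact rpow_sub_rpow_sq_le h0 h1 hpos hk
        _ = _ := by ring
    refine hle.trans ?_
    rw [integral_cubic_poissonMeasure]
    simp only [← hS]
    have e : S ^ (2 * β) = t * S ^ 2 := by
      rw [ht, ← Real.rpow_two, ← Real.rpow_add hpos]; congr 1; ring
    have ht0 : 0 ≤ t := Real.rpow_nonneg hS0 _
    have : t * S ≤ t * S ^ 2 := by gcongr; nlinarith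
    rw [e]; nlinarith

end PoissonPower

section SmallMean

open MeasureTheory ProbabilityTheory Finset Polynomial
open scoped NNReal

lemma sum_choose_mul_pow_le {δ : ℝ} (hδ : 0 ≤ δ) (N x : ℕ) :
    ∑ j ∈ range N, (x.choose j : ℝ) * δ ^ j ≤ (1 + δ) ^ x := by
  have h : (1 + δ) ^ x = ∑ j ∈ range (N + (x + 1)), (x.choose j : ℝ) * δ ^ j := by
    rw [add_comm, add_pow]
    refine (sum_congr rfl fun j _ => ?_).trans
      (sum_subset (range_mono (Nat.le_add_left _ _)) fun j _ hj => ?_)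
    · simp [mul_comm]
    · rw [Nat.choose_eq_zero_of_lt (by have := Finset.mem_range.not.1 hj; omega)]; simp
  rw [h]
  exact sum_le_sum_of_subset_of_nonneg (range_mono (Nat.le_add_right _ _))
    fun j _ _ => by positivity

/-- An estimator of `(2 * s) ^ β` from one `Poisson s` observation, accurate for `s ≤ L`. -/
lemma exists_smallMean_estimator {β L : ℝ} (h0 : 0 < β) (h1 : β ≤ 1 / 2) (hL : 128 ≤ L) :
    ∃ A : ℕ → ℝ, (∀ x, |A x| ≤ (2 * L) ^ β * Real.exp (L / 32) * (129 / 128) ^ x) ∧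
      ∀ s : ℝ≥0, (s : ℝ) ≤ L →
        |∫ x, A x ∂poissonMeasure s - (2 * (s : ℝ)) ^ β| ≤ 2048 * L ^ (-β) := by
  have hL0 : 0 < L := by linarith
  set m := ⌊L / 128⌋₊ with hm
  have hm1 : 1 ≤ m := Nat.le_floor (by rw [Nat.cast_one, le_div_iff₀ (by norm_num)]; linarith)
  have hm1' : (1 : ℝ) ≤ m := by exact_mod_cast hm1
  have hmle : (m : ℝ) ≤ L / 128 := Nat.floor_le (by positivity)
  have hmge : L / 256 ≤ m := by have := Nat.lt_floor_add_one (L / 128); linarith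
  obtain ⟨q, hqd, hqc, hq⟩ := exists_polynomial_approx_rpow h0 h1 hm1
  refine ⟨fun x => (2 * L) ^ β *
    ∑ j ∈ range (m + 1), q.coeff j * ((x.descFactorial j : ℝ) / L ^ j), fun x => ?_,
    fun s hs => ?_⟩
  · have h28 : (28 : ℝ) ^ m ≤ Real.exp (L / 32) := by
      have e1 : (28 : ℝ) ≤ Real.exp 4 := by
        have := Real.exp_one_gt_d9
        have e : Real.exp 4 = Real.exp 1 ^ 4 := by rw [← Real.exp_nat_mul]; norm_num
        rw [e]
        calc (28 : ℝ) ≤ 2.7 ^ 4 := by norm_num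
          _ ≤ _ := by gcongr; linarith
      calc (28 : ℝ) ^ m ≤ Real.exp 4 ^ m := by gcongr
        _ = Real.exp (m * 4) := by rw [Real.exp_nat_mul]
        _ ≤ _ := Real.exp_le_exp.2 (by linarith)
    rw [abs_mul, abs_of_nonneg (by positivity : 0 ≤ (2 * L) ^ β), mul_assoc]
    gcongr
    calc |∑ j ∈ range (m + 1), q.coeff j * ((x.descFactorial j : ℝ) / L ^ j)|
        ≤ ∑ j ∈ range (m + 1), |q.coeff j * ((x.descFactorial j : ℝ) / L ^ j)| :=
          abs_sum_le_sum_abs _ _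
      _ ≤ ∑ j ∈ range (m + 1), Real.exp (L / 32) * ((x.choose j : ℝ) * (1 / 128) ^ j) := by
          refine sum_le_sum fun j hj => ?_
          rw [abs_mul, abs_of_nonneg (by positivity : 0 ≤ (x.descFactorial j : ℝ) / L ^ j)]
          refine mul_le_mul ((hqc j).trans h28) ?_ (by positivity) (Real.exp_nonneg _)
          rw [Nat.descFactorial_eq_factorial_mul_choose, div_le_iff₀ (by positivity)]
          have hjm : j ≤ m := by simpa [Nat.lt_succ_iff] using hj
          have e : (j.factorial : ℝ) ≤ (1 / 128 * L) ^ j := by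
            calc (j.factorial : ℝ) ≤ (j : ℝ) ^ j := by exact_mod_cast Nat.factorial_le_pow j
              _ ≤ (1 / 128 * L) ^ j := by
                have : (j : ℝ) ≤ m := by exact_mod_cast hjm
                gcongr; linarith
          push_cast
          rw [mul_pow] at e
          calc (j.factorial : ℝ) * x.choose j ≤ ((1 / 128) ^ j * L ^ j) * x.choose j := by gcongr
            _ = _ := by ring
      _ ≤ Real.exp (L / 32) * (129 / 128) ^ x := by
          rw [← mul_sum]
          gcongr
          exact (sum_choose_mul_pow_le (by norm_num) _ _).trans_eq (by norm_num)
  · have hdesc : ∀ j : ℕ, Integrable (fun x : ℕ => q.coeff j * ((x.descFactorial j : ℝ) / L ^ j))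
        (poissonMeasure s) := fun j => by
      refine Integrable.const_mul (Integrable.div_const (ExpGrowth.integrable ?_ s) _) _
      refine ⟨j.factorial, 2, by positivity, one_le_two, fun x => ?_⟩
      rw [Nat.abs_cast, Nat.descFactorial_eq_factorial_mul_choose]
      exact_mod_cast Nat.mul_le_mul_left _ (Nat.choose_le_two_pow _ _)
    have e1 : ∫ x, (2 * L) ^ β *
        ∑ j ∈ range (m + 1), q.coeff j * ((x.descFactorial j : ℝ) / L ^ j) ∂poissonMeasure s
        = (2 * L) ^ β * q.eval ((s : ℝ) / L) := by
      rw [integral_const_mul, integral_finsetSum _ fun j _ => hdesc j,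
        eval_eq_sum_range' (Nat.lt_succ_of_le hqd)]
      congr 1
      refine sum_congr rfl fun j _ => ?_
      rw [integral_const_mul, integral_div, integral_descFactorial_poissonMeasure, div_pow]
    have e2 : (2 * (s : ℝ)) ^ β = (2 * L) ^ β * ((s : ℝ) / L) ^ β := by
      rw [← Real.mul_rpow (by positivity) (by positivity)]
      congr 1; field_simp
    rw [e1, e2, ← mul_sub, abs_mul, abs_of_nonneg (by positivity : 0 ≤ (2 * L) ^ β)]
    have hmb : (m : ℝ) ^ (-(2 * β)) ≤ 256 * L ^ (-(2 * β)) := by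
      calc (m : ℝ) ^ (-(2 * β)) ≤ (L / 256) ^ (-(2 * β)) :=
            Real.rpow_le_rpow_of_nonpos (by positivity) hmge (by linarith)
        _ = L ^ (-(2 * β)) * 256 ^ (2 * β) := by
            rw [Real.div_rpow hL0.le (by norm_num), Real.rpow_neg (by norm_num : (0 : ℝ) ≤ 256)]
            field_simp
        _ ≤ L ^ (-(2 * β)) * 256 ^ (1 : ℝ) := by
            gcongr
            · norm_num
            · linarith
        _ = _ := by rw [Real.rpow_one, mul_comm]
    have h2 : (2 : ℝ) ^ β ≤ 2 := by
      calc (2 : ℝ) ^ β ≤ 2 ^ (1 : ℝ) := by gcongr <;> linarith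
        _ = 2 := by simp
    calc (2 * L) ^ β * |q.eval ((s : ℝ) / L) - ((s : ℝ) / L) ^ β|
        ≤ (2 * L) ^ β * (4 * (256 * L ^ (-(2 * β)))) := by
          gcongr
          refine (hq _ ⟨by positivity, (div_le_one hL0).2 hs⟩).trans ?_
          gcongr
      _ = 2 ^ β * 1024 * (L ^ β * L ^ (-(2 * β))) := by
          rw [Real.mul_rpow (by norm_num) hL0.le]; ring
      _ = 2 ^ β * 1024 * L ^ (-β) := by rw [← Real.rpow_add hL0]; congr 2; ring
      _ ≤ 2 * 1024 * L ^ (-β) := by gcongr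
      _ = _ := by norm_num

end SmallMean

section Switching

open MeasureTheory ProbabilityTheory Finset
open scoped NNReal

/-- The indicator of `y ≤ T`. -/
noncomputable def cutoff (T : ℝ) (y : ℕ) : ℝ := if (y : ℝ) ≤ T then 1 else 0

lemma cutoff_nonneg (T : ℝ) (y : ℕ) : 0 ≤ cutoff T y := by
  unfold cutoff; split_ifs <;> norm_num

lemma cutoff_le_one (T : ℝ) (y : ℕ) : cutoff T y ≤ 1 := by
  unfold cutoff; split_ifs <;> norm_num

lemma expGrowth_cutoff (T : ℝ) : ExpGrowth (cutoff T) :=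
  ExpGrowth.of_bounded (C := 1) fun y => by
    rw [abs_of_nonneg (cutoff_nonneg T y)]; exact cutoff_le_one T y

lemma integral_cutoff_nonneg (T : ℝ) (s : ℝ≥0) : 0 ≤ ∫ y, cutoff T y ∂poissonMeasure s :=
  integral_nonneg (cutoff_nonneg T)

lemma integral_cutoff_le_one (T : ℝ) (s : ℝ≥0) : ∫ y, cutoff T y ∂poissonMeasure s ≤ 1 := by
  calc ∫ y, cutoff T y ∂poissonMeasure s ≤ ∫ _, (1 : ℝ) ∂poissonMeasure s :=
        integral_mono ((expGrowth_cutoff T).integrable s) (integrable_const _) (cutoff_le_one T)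
    _ = 1 := by simp

lemma integral_cutoff_le_exp (T : ℝ) (s : ℝ≥0) :
    ∫ y, cutoff T y ∂poissonMeasure s ≤ Real.exp (T - s / 2) := by
  have hg : ExpGrowth fun y => Real.exp T * (1 / 2 : ℝ) ^ y :=
    (ExpGrowth.const _).mul (ExpGrowth.of_bounded (C := 1) fun y => by
      rw [abs_of_nonneg (by positivity)]; exact pow_le_one₀ (by norm_num) (by norm_num))
  calc ∫ y, cutoff T y ∂poissonMeasure s
      ≤ ∫ y, Real.exp T * (1 / 2 : ℝ) ^ y ∂poissonMeasure s := by
        refine integral_mono ((expGrowth_cutoff T).integrable s) (hg.integrable s) fun y => ?_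
        dsimp only
        unfold cutoff
        split_ifs with h
        · have h2 : (2 : ℝ) ^ y ≤ Real.exp T := by
            calc (2 : ℝ) ^ y ≤ Real.exp 1 ^ y := by
                  gcongr; linarith [Real.exp_one_gt_d9]
              _ = Real.exp y := by rw [← Real.exp_nat_mul, mul_one]
              _ ≤ _ := Real.exp_le_exp.2 h
          rw [one_div, inv_pow, ← div_eq_mul_inv, le_div_iff₀ (by positivity)]
          linarith
        · positivity
    _ = Real.exp (T - s / 2) := by
        rw [integral_const_mul, integral_pow_poissonMeasure, ← Real.exp_add]
        congr 1; ring

lemma one_sub_integral_cutoff_le {T : ℝ} (hT : 0 < T) (s : ℝ≥0) :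
    1 - ∫ y, cutoff T y ∂poissonMeasure s ≤ s / T := by
  have hw := (expGrowth_cutoff T).integrable s
  calc 1 - ∫ y, cutoff T y ∂poissonMeasure s
      = ∫ y, (1 - cutoff T y) ∂poissonMeasure s := by
        rw [integral_sub (integrable_const _) hw]; simp
    _ ≤ ∫ y : ℕ, (y : ℝ) / T ∂poissonMeasure s := by
        refine integral_mono ((integrable_const _).sub hw)
          ((ExpGrowth.natCast.integrable s).div_const _) fun y => ?_
        dsimp only
        unfold cutoff
        split_ifs with h
        · rw [sub_self]; positivity
        · rw [sub_zero, le_div_iff₀ hT]; linarith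
    _ = s / T := by rw [integral_div, integral_natCast_poissonMeasure]

/-- Use `A` when the second observation is small, and the plug-in estimator otherwise. -/
noncomputable def switchEstimator (β T : ℝ) (A : ℕ → ℝ) (p : ℕ × ℕ) : ℝ :=
  A p.1 * cutoff T p.2 + (2 * (p.1 : ℝ)) ^ β * (1 - cutoff T p.2)

lemma expGrowth_two_mul_rpow {β : ℝ} (h0 : 0 < β) (h1 : β < 1) :
    ExpGrowth fun k => (2 * (k : ℝ)) ^ β := by
  have : (fun k : ℕ => (2 * (k : ℝ)) ^ β) = fun k : ℕ => (2 : ℝ) ^ β * (k : ℝ) ^ β :=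
    funext fun k => Real.mul_rpow (by norm_num) (Nat.cast_nonneg k)
  rw [this]
  exact (ExpGrowth.const _).mul (ExpGrowth.rpow h0 h1)

lemma expGrowthProd_switchEstimator {β T : ℝ} {A : ℕ → ℝ} (h0 : 0 < β) (h1 : β < 1)
    (hA : ExpGrowth A) : ExpGrowthProd (switchEstimator β T A) :=
  ((ExpGrowthProd.comp_fst hA).mul (ExpGrowthProd.comp_snd (expGrowth_cutoff T))).add
    ((ExpGrowthProd.comp_fst (expGrowth_two_mul_rpow h0 h1)).mul
      (ExpGrowthProd.comp_snd ((ExpGrowth.const 1).sub (expGrowth_cutoff T))))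

lemma integral_switchEstimator {β T : ℝ} {A : ℕ → ℝ} (h0 : 0 < β) (h1 : β < 1)
    (hA : ExpGrowth A) (s : ℝ≥0) :
    ∫ p, switchEstimator β T A p ∂(poissonMeasure s).prod (poissonMeasure s) =
      (∫ x, A x ∂poissonMeasure s) * ∫ y, cutoff T y ∂poissonMeasure s +
      (∫ x : ℕ, (2 * (x : ℝ)) ^ β ∂poissonMeasure s) *
        (1 - ∫ y, cutoff T y ∂poissonMeasure s) := by
  have hw := (expGrowth_cutoff T).integrable s
  unfold switchEstimator
  rw [integral_add, integral_prod_mul, integral_prod_mul (fun x : ℕ => (2 * (x : ℝ)) ^ β)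
    (fun y => 1 - cutoff T y), integral_sub (integrable_const _) hw]
  · simp
  · exact (hA.integrable s).mul_prod hw
  · exact ((expGrowth_two_mul_rpow h0 h1).integrable s).mul_prod ((integrable_const 1).sub hw)

lemma abs_integral_two_mul_rpow_sub_le {β : ℝ} (h0 : 0 < β) (h1 : β < 1) {s : ℝ≥0}
    (hs : 0 < s) :
    |∫ x : ℕ, (2 * (x : ℝ)) ^ β ∂poissonMeasure s - (2 * (s : ℝ)) ^ β| ≤
      2 * (s : ℝ) ^ (β - 1) := by
  simp_rw [Real.mul_rpow (by norm_num : (0 : ℝ) ≤ 2) (Nat.cast_nonneg _)]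
  rw [Real.mul_rpow (by norm_num : (0 : ℝ) ≤ 2) s.coe_nonneg, integral_const_mul, ← mul_sub,
    abs_mul, abs_of_nonneg (by positivity : (0 : ℝ) ≤ 2 ^ β)]
  have h2 : (2 : ℝ) ^ β ≤ 2 := by
    calc (2 : ℝ) ^ β ≤ 2 ^ (1 : ℝ) := by gcongr; linarith
      _ = 2 := by simp
  exact mul_le_mul h2 (abs_integral_rpow_sub_le h0 h1 hs) (abs_nonneg _) (by norm_num)

lemma le_four_mul_exp_div_four (L : ℝ) : L ≤ 4 * Real.exp (L / 4) := by
  linarith [Real.add_one_le_exp (L / 4)]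

lemma exp_neg_div_four_le {L : ℝ} (hL : 0 < L) : Real.exp (-(L / 4)) ≤ 4 * L⁻¹ := by
  rw [Real.exp_neg, ← div_eq_mul_inv, inv_eq_one_div,
    div_le_div_iff₀ (Real.exp_pos _) hL]
  linarith [le_four_mul_exp_div_four L]

lemma abs_integral_switchEstimator_sub_le {β L : ℝ} {A : ℕ → ℝ} (h0 : 0 < β) (h1 : β ≤ 1 / 2)
    (hL : 128 ≤ L)
    (hA : ∀ x, |A x| ≤ (2 * L) ^ β * Real.exp (L / 32) * (129 / 128) ^ x)
    (hAs : ∀ s : ℝ≥0, (s : ℝ) ≤ L →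
        |∫ x, A x ∂poissonMeasure s - (2 * (s : ℝ)) ^ β| ≤ 2048 * L ^ (-β)) (s : ℝ≥0) :
    |∫ p, switchEstimator β (L / 16) A p ∂(poissonMeasure s).prod (poissonMeasure s) -
      (2 * (s : ℝ)) ^ β| ≤ 2080 * L ^ (-β) := by
  have hL0 : 0 < L := by linarith
  have hL1 : 1 ≤ L := by linarith
  have hAg : ExpGrowth A := ⟨_, _, by positivity, by norm_num, hA⟩
  have hφ0 := integral_cutoff_nonneg (L / 16) s
  have hφ1 := integral_cutoff_le_one (L / 16) s
  have hφe := integral_cutoff_le_exp (L / 16) s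
  have hφs := one_sub_integral_cutoff_le (by positivity : 0 < L / 16) s
  rw [integral_switchEstimator h0 (by linarith) hAg]
  have hB := @abs_integral_two_mul_rpow_sub_le β h0 (by linarith) s
  have hEA : |∫ x, A x ∂poissonMeasure s| ≤
      (2 * L) ^ β * Real.exp (L / 32) * Real.exp (s / 128) := by
    calc |∫ x, A x ∂poissonMeasure s| ≤ ∫ x, |A x| ∂poissonMeasure s :=
          abs_integral_le_integral_abs
      _ ≤ ∫ x, (2 * L) ^ β * Real.exp (L / 32) * (129 / 128) ^ x ∂poissonMeasure s := by
          refine integral_mono (hAg.integrable s).abs (ExpGrowth.integrable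
            ⟨(2 * L) ^ β * Real.exp (L / 32), 129 / 128, by positivity, by norm_num,
              fun k => ?_⟩ s) hA
          rw [abs_of_nonneg (by positivity)]
      _ = _ := by
          rw [integral_const_mul, integral_pow_poissonMeasure]
          congr 2; ring
  set c : ℝ := (2 * (s : ℝ)) ^ β with hc
  set EA := ∫ x, A x ∂poissonMeasure s
  set EB := ∫ x : ℕ, (2 * (x : ℝ)) ^ β ∂poissonMeasure s
  set φ := ∫ y, cutoff (L / 16) y ∂poissonMeasure s
  have hc0 : 0 ≤ c := by positivity
  have hsplit : |EA * φ + EB * (1 - φ) - c| ≤ |EA - c| * φ + |EB - c| * (1 - φ) := by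
    calc |EA * φ + EB * (1 - φ) - c| = |(EA - c) * φ + (EB - c) * (1 - φ)| := by
          congr 1; ring
      _ ≤ |(EA - c) * φ| + |(EB - c) * (1 - φ)| := abs_add_le _ _
      _ = _ := by
          rw [abs_mul, abs_mul, abs_of_nonneg hφ0, abs_of_nonneg (by linarith : 0 ≤ 1 - φ)]
  refine hsplit.trans ?_
  have hLβ : L ^ (β - 1) ≤ L ^ (-β) := Real.rpow_le_rpow_of_exponent_le hL1 (by linarith)
  have hLβ0 : 0 < L ^ (-β) := by positivity
  have hinv : L⁻¹ ≤ L ^ (-β) := by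
    rw [← Real.rpow_neg_one]; exact Real.rpow_le_rpow_of_exponent_le hL1 (by linarith)
  have hexp := exp_neg_div_four_le hL0
  rcases le_or_gt (s : ℝ) L with hs | hs
  · have e1 : |EA - c| * φ ≤ 2048 * L ^ (-β) :=
      (mul_le_of_le_one_right (abs_nonneg _) hφ1).trans (hAs s hs)
    have e2 : |EB - c| * (1 - φ) ≤ 32 * L ^ (-β) := by
      rcases eq_or_lt_of_le (zero_le (a := s)) with h | h
      · have : 1 - φ ≤ 0 := by rw [← h] at hφs; simpa using hφs
        nlinarith [abs_nonneg (EB - c)]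
      · have hs0 : 0 < (s : ℝ) := by exact_mod_cast h
        calc |EB - c| * (1 - φ) ≤ (2 * (s : ℝ) ^ (β - 1)) * (s / (L / 16)) :=
              mul_le_mul (hB h) hφs (by linarith) (by positivity)
          _ = 32 * (s : ℝ) ^ β / L := by
              rw [Real.rpow_sub_one hs0.ne']; field_simp; norm_num
          _ ≤ 32 * L ^ β / L := by gcongr
          _ = 32 * L ^ (β - 1) := by rw [Real.rpow_sub_one hL0.ne']; ring
          _ ≤ _ := by gcongr
    linarith
  · have hs0 : 0 < (s : ℝ) := by linarith
    have e1 : |EB - c| * (1 - φ) ≤ 2 * L ^ (-β) := by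
      calc |EB - c| * (1 - φ) ≤ 2 * (s : ℝ) ^ (β - 1) :=
            (mul_le_of_le_one_right (abs_nonneg _) (by linarith)).trans
              (hB (by exact_mod_cast hs0))
        _ ≤ 2 * L ^ (β - 1) := by
            gcongr 2 * ?_
            exact Real.rpow_le_rpow_of_nonpos hL0 hs.le (by linarith)
        _ ≤ _ := by gcongr
    have e2 : |EA| * φ ≤ 8 * L ^ (-β) := by
      calc |EA| * φ ≤ ((2 * L) ^ β * Real.exp (L / 32) * Real.exp (s / 128)) *
            Real.exp (L / 16 - s / 2) := mul_le_mul hEA hφe hφ0 (by positivity)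
        _ = (2 * L) ^ β * Real.exp (L / 32 + s / 128 + (L / 16 - s / 2)) := by
            rw [Real.exp_add, Real.exp_add]; ring
        _ ≤ (2 * L ^ β) * Real.exp (-(L / 4)) := by
            gcongr ?_ * Real.exp ?_
            · rw [Real.mul_rpow (by norm_num) hL0.le]
              gcongr
              calc (2 : ℝ) ^ β ≤ 2 ^ (1 : ℝ) := by gcongr <;> linarith
                _ = 2 := by simp
            · linarith
        _ ≤ (2 * L ^ β) * (4 * L⁻¹) := by gcongr
        _ = 8 * L ^ (β - 1) := by rw [Real.rpow_sub_one hL0.ne']; ring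
        _ ≤ _ := by gcongr
    have e3 : c * φ ≤ 64 * L ^ (-β) := by
      have hcs : c ≤ 16 * Real.exp (s / 8) := by
        calc c ≤ (2 * (s : ℝ)) ^ (1 : ℝ) :=
              Real.rpow_le_rpow_of_exponent_le (by linarith) (by linarith)
          _ ≤ _ := by rw [Real.rpow_one]; linarith [Real.add_one_le_exp ((s : ℝ) / 8)]
      calc c * φ ≤ (16 * Real.exp (s / 8)) * Real.exp (L / 16 - s / 2) :=
            mul_le_mul hcs hφe hφ0 (by positivity)
        _ = 16 * Real.exp (s / 8 + (L / 16 - s / 2)) := by rw [Real.exp_add]; ring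
        _ ≤ 16 * Real.exp (-(L / 4)) := by gcongr; linarith
        _ ≤ 16 * (4 * L⁻¹) := by gcongr
        _ ≤ _ := by linarith
    have e4 : |EA - c| * φ ≤ |EA| * φ + c * φ := by
      rw [← add_mul]
      gcongr
      exact (abs_sub _ _).trans_eq (by rw [abs_of_nonneg hc0])
    linarith

end Switching

section SecondMoment

open MeasureTheory ProbabilityTheory Finset
open scoped NNReal

lemma add_one_le_mul_pow (x : ℕ) : (x : ℝ) + 1 ≤ 128 * (129 / 128) ^ x := by
  have := one_add_mul_le_pow (a := (1 / 128 : ℝ)) (by norm_num) x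
  norm_num at this ⊢
  linarith

/-- Pointwise bound separating the two regimes of the switched estimator. -/
lemma mul_switchEstimator_sub_sq_le {β T a D : ℝ} {A : ℕ → ℝ} (h1 : β ≤ 1 / 2)
    (hT : 0 ≤ T) (hA : ∀ x, |A x| ≤ a * (129 / 128) ^ x) (hD : D = (129 / 128) ^ 3) (s : ℝ≥0)
    (p : ℕ × ℕ) :
    ((p.1 : ℝ) + p.2 + 1) * (switchEstimator β T A p - (2 * (s : ℝ)) ^ β) ^ 2 ≤
      (T + 1) * (256 * a ^ 2 * D ^ p.1 + 2 * (2 * (s : ℝ)) ^ (2 * β) * (p.1 + 1)) *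
          cutoff T p.2 +
        (2 * ((p.1 : ℝ) + 1) * ((p.1 : ℝ) ^ β - (s : ℝ) ^ β) ^ 2 +
          2 * ((p.1 : ℝ) ^ β - (s : ℝ) ^ β) ^ 2 * p.2) := by
  obtain ⟨x, y⟩ := p
  have hc : (2 * (s : ℝ)) ^ (2 * β) = ((2 * (s : ℝ)) ^ β) ^ 2 := by
    rw [← Real.rpow_natCast, ← Real.rpow_mul (by positivity)]; congr 1; push_cast; ring
  simp only [switchEstimator, cutoff]
  split_ifs with h
  · have hA2 : (A x) ^ 2 ≤ a ^ 2 * ((129 / 128) ^ x) ^ 2 := by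
      rw [← mul_pow, ← sq_abs]; gcongr; exact hA x
    set c := (2 * (s : ℝ)) ^ β
    rw [hc]
    have e1 : (x : ℝ) + y + 1 ≤ (T + 1) * (x + 1) := by
      have : (0 : ℝ) ≤ x := Nat.cast_nonneg x
      nlinarith
    have e2 : (A x - c) ^ 2 ≤ 2 * (A x) ^ 2 + 2 * c ^ 2 := by nlinarith [sq_nonneg (A x + c)]
    have e3 : ((x : ℝ) + 1) * (a ^ 2 * ((129 / 128) ^ x) ^ 2) ≤ 128 * a ^ 2 * D ^ x := by
      calc ((x : ℝ) + 1) * (a ^ 2 * ((129 / 128) ^ x) ^ 2)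
          ≤ (128 * (129 / 128) ^ x) * (a ^ 2 * ((129 / 128) ^ x) ^ 2) := by
            gcongr; exact add_one_le_mul_pow x
        _ = 128 * a ^ 2 * D ^ x := by
            rw [hD, pow_right_comm _ 3 x]; generalize (129 / 128 : ℝ) ^ x = d; ring
    have e4 : (0 : ℝ) ≤ 2 * ((x : ℝ) + 1) * ((x : ℝ) ^ β - (s : ℝ) ^ β) ^ 2 +
          2 * ((x : ℝ) ^ β - (s : ℝ) ^ β) ^ 2 * y := by positivity
    calc ((x : ℝ) + y + 1) * (A x * 1 + (2 * (x : ℝ)) ^ β * (1 - 1) - c) ^ 2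
        = ((x : ℝ) + y + 1) * (A x - c) ^ 2 := by ring
      _ ≤ ((T + 1) * (x + 1)) * (2 * (a ^ 2 * ((129 / 128) ^ x) ^ 2) + 2 * c ^ 2) := by
          gcongr; linarith
      _ = (T + 1) * (2 * (((x : ℝ) + 1) * (a ^ 2 * ((129 / 128) ^ x) ^ 2)) +
            2 * c ^ 2 * (x + 1)) := by ring
      _ ≤ (T + 1) * (2 * (128 * a ^ 2 * D ^ x) + 2 * c ^ 2 * (x + 1)) := by gcongr
      _ = (T + 1) * (256 * a ^ 2 * D ^ x + 2 * c ^ 2 * (x + 1)) * 1 := by ring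
      _ ≤ _ := by linarith
  · have h2 : ((2 : ℝ) ^ β) ^ 2 ≤ 2 := by
      rw [← Real.rpow_natCast, ← Real.rpow_mul (by norm_num)]
      calc (2 : ℝ) ^ (β * (2 : ℕ)) ≤ 2 ^ (1 : ℝ) := by
            gcongr
            · norm_num
            · push_cast; linarith
        _ = 2 := by simp
    rw [Real.mul_rpow (by norm_num) (Nat.cast_nonneg x),
      Real.mul_rpow (by norm_num) s.coe_nonneg]
    calc ((x : ℝ) + y + 1) * (A x * 0 + 2 ^ β * (x : ℝ) ^ β * (1 - 0) - 2 ^ β * (s : ℝ) ^ β) ^ 2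
        = ((2 : ℝ) ^ β) ^ 2 * (((x : ℝ) + y + 1) * ((x : ℝ) ^ β - (s : ℝ) ^ β) ^ 2) := by ring
      _ ≤ 2 * (((x : ℝ) + y + 1) * ((x : ℝ) ^ β - (s : ℝ) ^ β) ^ 2) := by gcongr
      _ = _ := by ring

lemma two_mul_add_one_mul_le_exp {s : ℝ} (hs : 0 ≤ s) :
    2 * (2 * s + 1) * (s + 1) ≤ 32 * Real.exp (s / 2) := by
  have := Real.quadratic_le_exp_of_nonneg (x := s / 2) (by positivity)
  nlinarith

lemma integral_mul_switchEstimator_sub_sq_le {β L : ℝ} {A : ℕ → ℝ} (h0 : 0 < β)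
    (h1 : β < 1 / 2) (hL : 128 ≤ L)
    (hA : ∀ x, |A x| ≤ (2 * L) ^ β * Real.exp (L / 32) * (129 / 128) ^ x) (s : ℝ≥0) :
    ∫ p, ((p.1 : ℝ) + p.2 + 1) * (switchEstimator β (L / 16) A p - (2 * (s : ℝ)) ^ β) ^ 2
      ∂(poissonMeasure s).prod (poissonMeasure s) ≤
      34856 * (Real.exp L * L ^ (-(2 * β))) + 8 * (s : ℝ) ^ (2 * β) := by
  have hL0 : 0 < L := by linarith
  have hL1 : 1 ≤ L := by linarith
  have hAg : ExpGrowth A := ⟨_, _, by positivity, by norm_num, hA⟩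
  obtain ⟨T, hT⟩ : ∃ T, T = L / 16 := ⟨_, rfl⟩
  obtain ⟨a, ha⟩ : ∃ a, a = (2 * L) ^ β * Real.exp (L / 32) := ⟨_, rfl⟩
  obtain ⟨D, hD⟩ : ∃ D : ℝ, D = (129 / 128) ^ 3 := ⟨_, rfl⟩
  obtain ⟨c2, hc2⟩ : ∃ c2, c2 = (2 * (s : ℝ)) ^ (2 * β) := ⟨_, rfl⟩
  have hT0 : 0 ≤ T := by rw [hT]; positivity
  have hD1 : 1 ≤ D := by rw [hD]; norm_num
  have hc20 : 0 ≤ c2 := by rw [hc2]; positivity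
  rw [← ha] at hA
  rw [← hT]
  have hpow : ExpGrowth fun x => D ^ x :=
    ⟨1, D, zero_le_one, hD1, fun k => by rw [one_mul, abs_of_nonneg (by positivity)]⟩
  have hlin : ExpGrowth fun x => (x : ℝ) + 1 := ExpGrowth.natCast.add (ExpGrowth.const 1)
  have hf1 : ExpGrowth fun x => (T + 1) * (256 * a ^ 2 * D ^ x + 2 * c2 * ((x : ℝ) + 1)) :=
    (ExpGrowth.const _).mul (((ExpGrowth.const _).mul hpow).add ((ExpGrowth.const _).mul hlin))
  have hd : ExpGrowth fun x => ((x : ℝ) ^ β - (s : ℝ) ^ β) ^ 2 :=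
    ((ExpGrowth.rpow h0 (by linarith)).sub (ExpGrowth.const _)).sq
  have hf2 : ExpGrowth fun x => 2 * ((x : ℝ) + 1) * ((x : ℝ) ^ β - (s : ℝ) ^ β) ^ 2 :=
    ((ExpGrowth.const 2).mul hlin).mul hd
  have hf3 : ExpGrowth fun x => 2 * ((x : ℝ) ^ β - (s : ℝ) ^ β) ^ 2 := (ExpGrowth.const 2).mul hd
  have hw := (expGrowth_cutoff T).integrable s
  have hφ0 := integral_cutoff_nonneg T s
  have hφe := integral_cutoff_le_exp T s
  have hh : ExpGrowthProd (switchEstimator β T A) :=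
    expGrowthProd_switchEstimator h0 (by linarith) hAg
  have hhc : ExpGrowthProd fun p => switchEstimator β T A p - (2 * (s : ℝ)) ^ β := by
    simpa [sub_eq_add_neg] using
      hh.add (ExpGrowthProd.comp_fst (ExpGrowth.const (-(2 * (s : ℝ)) ^ β)))
  have hlhs : ExpGrowthProd fun p =>
      ((p.1 : ℝ) + p.2 + 1) * (switchEstimator β T A p - (2 * (s : ℝ)) ^ β) ^ 2 := by
    simp only [pow_two]
    exact (((ExpGrowthProd.comp_fst ExpGrowth.natCast).add
      (ExpGrowthProd.comp_snd ExpGrowth.natCast)).add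
      (ExpGrowthProd.comp_fst (ExpGrowth.const 1))).mul (hhc.mul hhc)
  have i1 := (hf1.integrable s).mul_prod hw
  have i2 : Integrable (fun p : ℕ × ℕ => 2 * ((p.1 : ℝ) + 1) * ((p.1 : ℝ) ^ β - (s : ℝ) ^ β) ^ 2)
      ((poissonMeasure s).prod (poissonMeasure s)) := (ExpGrowthProd.comp_fst hf2).integrable s s
  have i3 := (hf3.integrable s).mul_prod (ExpGrowth.natCast.integrable s)
  have hmain : ∫ p, ((p.1 : ℝ) + p.2 + 1) * (switchEstimator β T A p - (2 * (s : ℝ)) ^ β) ^ 2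
      ∂(poissonMeasure s).prod (poissonMeasure s) ≤
      (∫ x : ℕ, (T + 1) * (256 * a ^ 2 * D ^ x + 2 * c2 * ((x : ℝ) + 1)) ∂poissonMeasure s) *
        (∫ y, cutoff T y ∂poissonMeasure s) +
      2 * ∫ x : ℕ, ((x : ℝ) + 1 + s) * ((x : ℝ) ^ β - (s : ℝ) ^ β) ^ 2 ∂poissonMeasure s := by
    refine (integral_mono (hlhs.integrable s s) (i1.add (i2.add i3)) fun p => ?_).trans_eq ?_
    · simpa [hc2] using mul_switchEstimator_sub_sq_le h1.le hT0 hA hD s p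
    · rw [integral_add' i1 (i2.add i3), integral_add' i2 i3, integral_prod_mul
          (fun x : ℕ => (T + 1) * (256 * a ^ 2 * D ^ x + 2 * c2 * ((x : ℝ) + 1))) (cutoff T),
        integral_prod_mul (fun x : ℕ => 2 * ((x : ℝ) ^ β - (s : ℝ) ^ β) ^ 2) (fun y : ℕ => (y : ℝ)),
        integral_fun_fst (fun x : ℕ => 2 * ((x : ℝ) + 1) * ((x : ℝ) ^ β - (s : ℝ) ^ β) ^ 2),
        integral_natCast_poissonMeasure]
      congr 1
      simp only [probReal_univ, one_smul]
      rw [← integral_mul_const, ← integral_add (hf2.integrable s) ((hf3.integrable s).mul_const _), ← integral_const_mul]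
      exact integral_congr_ae (.of_forall fun x => by ring)
  refine hmain.trans ?_
  have hsecond := integral_mul_rpow_sub_sq_le h0 (by linarith) s
  have hLβ : L⁻¹ ≤ L ^ (-(2 * β)) := by
    rw [← Real.rpow_neg_one]; exact Real.rpow_le_rpow_of_exponent_le hL1 (by linarith)
  have hone : 1 ≤ Real.exp L * L ^ (-(2 * β)) := by
    calc 1 = L * L⁻¹ := (mul_inv_cancel₀ hL0.ne').symm
      _ ≤ Real.exp L * L ^ (-(2 * β)) := by
        gcongr; linarith [Real.add_one_le_exp L]
  have hfirst : (∫ x : ℕ, (T + 1) * (256 * a ^ 2 * D ^ x + 2 * c2 * ((x : ℝ) + 1))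
        ∂poissonMeasure s) * (∫ y, cutoff T y ∂poissonMeasure s) ≤
      34816 * (Real.exp L * L ^ (-(2 * β))) := by
    rw [integral_const_mul, integral_add ((hpow.integrable s).const_mul _)
      ((hlin.integrable s).const_mul _), integral_const_mul, integral_const_mul,
      integral_pow_poissonMeasure, integral_add (ExpGrowth.natCast.integrable s)
      (integrable_const _), integral_natCast_poissonMeasure]
    simp only [integral_const, probReal_univ, one_smul]
    have hs0 := s.coe_nonneg
    have hc2le : c2 ≤ 2 * s + 1 := by
      rw [hc2]
      rcases le_total (2 * (s : ℝ)) 1 with h | h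
      · have := Real.rpow_le_one (by positivity) h (by linarith : 0 ≤ 2 * β)
        linarith
      · have := Real.rpow_le_rpow_of_exponent_le h (by linarith : 2 * β ≤ 1)
        rw [Real.rpow_one] at this; linarith
    have ha2 : a ^ 2 ≤ 2 * L * Real.exp (L / 16) := by
      rw [ha, mul_pow, ← Real.rpow_natCast, ← Real.rpow_mul (by positivity), ← Real.exp_nat_mul]
      gcongr
      · calc (2 * L) ^ (β * (2 : ℕ)) ≤ (2 * L) ^ (1 : ℝ) :=
              Real.rpow_le_rpow_of_exponent_le (by linarith) (by push_cast; linarith)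
          _ = 2 * L := Real.rpow_one _
      · push_cast; linarith
    have g1 : Real.exp (s * (D - 1)) ≤ Real.exp (s / 2) :=
      Real.exp_le_exp.2 (by rw [hD]; norm_num; linarith)
    have g2 : 2 * c2 * (s + 1) ≤ 32 * Real.exp (s / 2) :=
      (by gcongr : 2 * c2 * (s + 1) ≤ 2 * (2 * s + 1) * ((s : ℝ) + 1)).trans
        (two_mul_add_one_mul_le_exp hs0)
    have hTL : T + 1 ≤ L := by rw [hT]; linarith
    have hexp1 : 1 ≤ Real.exp (L / 16) := Real.one_le_exp (by positivity)
    calc (T + 1) * (256 * a ^ 2 * Real.exp (s * (D - 1)) + 2 * c2 * (s + 1)) *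
          (∫ y, cutoff T y ∂poissonMeasure s)
        ≤ (L * (256 * (2 * L * Real.exp (L / 16)) * Real.exp (s / 2) +
            32 * Real.exp (s / 2))) * Real.exp (T - s / 2) := by gcongr
      _ = (L * (512 * L * Real.exp (L / 16) + 32)) *
            (Real.exp (s / 2) * Real.exp (T - s / 2)) := by ring
      _ = (L * (512 * L * Real.exp (L / 16) + 32 * 1)) * Real.exp (L / 16) := by
          rw [← Real.exp_add, hT]; ring_nf
      _ ≤ (L * (512 * L * Real.exp (L / 16) + 32 * (L * Real.exp (L / 16)))) *
            Real.exp (L / 16) := by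
          gcongr; nlinarith
      _ = 544 * L ^ 3 * (Real.exp (L / 16) * Real.exp (L / 16)) * L⁻¹ := by
          field_simp; ring
      _ ≤ 544 * (4 * Real.exp (L / 4)) ^ 3 * (Real.exp (L / 16) * Real.exp (L / 16)) *
            L⁻¹ := by
          gcongr; exact le_four_mul_exp_div_four L
      _ = 34816 * (Real.exp (3 * (L / 4) + (L / 16 + L / 16)) * L⁻¹) := by
          rw [Real.exp_add, Real.exp_add, mul_pow, ← Real.exp_nat_mul]; push_cast; ring
      _ ≤ 34816 * (Real.exp L * L ^ (-(2 * β))) := by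
          gcongr; linarith
  linarith

end SecondMoment

section SingleCoordinate

open MeasureTheory ProbabilityTheory Finset
open scoped NNReal

lemma exists_rpow_le_mul_log_rpow {β : ℝ} (h0 : 0 < β) (h1 : β < 1 / 2) :
    ∃ K : ℝ, 0 < K ∧ ∀ n : ℕ, 2 ≤ n →
      (n : ℝ) ^ (2 * β) ≤ K * (n * Real.log n ^ (-(2 * β))) := by
  obtain ⟨ε, hε⟩ : ∃ ε, ε = (1 - 2 * β) / (2 * β) := ⟨_, rfl⟩
  have hε0 : 0 < ε := by rw [hε]; exact div_pos (by linarith) (by linarith)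
  refine ⟨(ε ^ (2 * β))⁻¹, by positivity, fun n hn => ?_⟩
  have hn1 : (1 : ℝ) < n := by exact_mod_cast hn
  have hn0 : (0 : ℝ) < n := by linarith
  have hL : 0 < Real.log n := Real.log_pos hn1
  have h : Real.log n ^ (2 * β) ≤ (n : ℝ) ^ (1 - 2 * β) / ε ^ (2 * β) := by
    calc Real.log n ^ (2 * β) ≤ ((n : ℝ) ^ ε / ε) ^ (2 * β) := by
          gcongr; exact Real.log_le_rpow_div hn0.le hε0
      _ = _ := by
          rw [Real.div_rpow (by positivity) hε0.le, ← Real.rpow_mul hn0.le]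
          congr 2; rw [hε]; field_simp
  rw [Real.rpow_sub hn0, Real.rpow_one] at h
  rw [Real.rpow_neg hL.le]
  have e1 : 0 < Real.log n ^ (2 * β) := by positivity
  have e2 : 0 < (n : ℝ) ^ (2 * β) := by positivity
  have e3 : 0 < ε ^ (2 * β) := by positivity
  rw [div_div, le_div_iff₀ (by positivity)] at h
  rw [← div_eq_mul_inv, ← div_eq_inv_mul, div_div, le_div_iff₀ (by positivity)]
  linarith

lemma zero_rpow_estimator_bounds {β : ℝ} (h0 : 0 < β) (h1 : β < 1 / 2) {n : ℕ} (hn : 2 ≤ n)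
    (hL : Real.log n < 128) {r : ℝ≥0} (hr : (r : ℝ) ≤ n) :
    (r : ℝ) ^ β ≤ 128 * Real.exp 128 * Real.log n ^ (-β) ∧
      ((r : ℝ) + 1) * ((r : ℝ) ^ β) ^ 2 ≤
        256 * Real.exp 128 * (n * Real.log n ^ (-(2 * β))) := by
  have hn1 : (1 : ℝ) < n := by exact_mod_cast hn
  have hn0 : (0 : ℝ) < n := by linarith
  have hL0 : 0 < Real.log n := Real.log_pos hn1
  have hnN : (n : ℝ) ≤ Real.exp 128 := (Real.log_le_iff_le_exp hn0).1 hL.le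
  have hlow : ∀ γ : ℝ, 0 ≤ γ → γ ≤ 1 → 1 / 128 ≤ Real.log n ^ (-γ) := fun γ hγ0 hγ1 => by
    calc (1 / 128 : ℝ) = 128 ^ (-1 : ℝ) := by rw [Real.rpow_neg_one]; norm_num
      _ ≤ 128 ^ (-γ) := Real.rpow_le_rpow_of_exponent_le (by norm_num) (by linarith)
      _ ≤ _ := Real.rpow_le_rpow_of_nonpos hL0 hL.le (by linarith)
  have hpow : ∀ γ : ℝ, 0 ≤ γ → γ ≤ 1 → (r : ℝ) ^ γ ≤ Real.exp 128 := fun γ hγ0 hγ1 => by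
    calc (r : ℝ) ^ γ ≤ (n : ℝ) ^ γ := by gcongr
      _ ≤ (n : ℝ) ^ (1 : ℝ) := Real.rpow_le_rpow_of_exponent_le hn1.le hγ1
      _ ≤ _ := by rwa [Real.rpow_one]
  constructor
  · calc (r : ℝ) ^ β ≤ Real.exp 128 := hpow β h0.le (by linarith)
      _ = 128 * Real.exp 128 * (1 / 128) := by ring
      _ ≤ _ := by gcongr; exact hlow β h0.le (by linarith)
  · rw [← Real.rpow_natCast, ← Real.rpow_mul r.coe_nonneg]
    calc ((r : ℝ) + 1) * (r : ℝ) ^ (β * (2 : ℕ)) ≤ (n + n) * Real.exp 128 := by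
          gcongr
          exact hpow _ (by positivity) (by push_cast; linarith)
      _ = 256 * Real.exp 128 * (n * (1 / 128)) := by ring
      _ ≤ _ := by gcongr; exact hlow _ (by linarith) (by linarith)

/-- Estimation of `r ^ β` from one `Poisson r` observation, uniformly over `r ≤ n`. -/
lemma exists_rpow_estimator {β : ℝ} (h0 : 0 < β) (h1 : β < 1 / 2) :
    ∃ C : ℝ, 0 < C ∧ ∀ n : ℕ, 2 ≤ n → ∃ g : ℕ → ℝ, ExpGrowth g ∧
      ∀ r : ℝ≥0, (r : ℝ) ≤ n →
        |∫ k, g k ∂poissonMeasure r - (r : ℝ) ^ β| ≤ C * Real.log n ^ (-β) ∧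
        ∫ k, ((k : ℝ) + 1) * (g k - (r : ℝ) ^ β) ^ 2 ∂poissonMeasure r ≤
          C * (n * Real.log n ^ (-(2 * β))) := by
  obtain ⟨K, hK, hKn⟩ := exists_rpow_le_mul_log_rpow h0 h1
  refine ⟨256 * Real.exp 128 + 34856 + 8 * K, by positivity, fun n hn => ?_⟩
  have hn1 : (1 : ℝ) < n := by exact_mod_cast hn
  have hn0 : (0 : ℝ) < n := by linarith
  have hL0 : 0 < Real.log n := Real.log_pos hn1
  have hE := Real.exp_pos 128
  have hLβ : 0 < Real.log n ^ (-β) := by positivity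
  have hLβ2 : 0 < n * Real.log n ^ (-(2 * β)) := by positivity
  rcases lt_or_ge (Real.log n) 128 with hL | hL
  · refine ⟨fun _ => 0, ExpGrowth.const 0, fun r hr => ?_⟩
    obtain ⟨b1, b2⟩ := zero_rpow_estimator_bounds h0 h1 hn hL hr
    constructor
    · rw [integral_zero, zero_sub, abs_neg, abs_of_nonneg (by positivity)]
      refine b1.trans ?_
      gcongr
      linarith
    · simp only [zero_sub, neg_sq]
      rw [integral_mul_const, integral_add (ExpGrowth.natCast.integrable r) (integrable_const _),
        integral_natCast_poissonMeasure]
      simp only [integral_const, probReal_univ, one_smul]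
      refine b2.trans ?_
      gcongr
      linarith
  · obtain ⟨A, hA, hAs⟩ := exists_smallMean_estimator h0 h1.le hL
    have hAg : ExpGrowth A := ⟨_, _, by positivity, by norm_num, hA⟩
    have hh : ExpGrowthProd (switchEstimator β (Real.log n / 16) A) :=
      expGrowthProd_switchEstimator h0 (by linarith) hAg
    refine ⟨binomialSplit (switchEstimator β (Real.log n / 16) A), hh.binomialSplit,
      fun r hr => ?_⟩
    obtain ⟨s, rfl⟩ : ∃ s : ℝ≥0, r = 2 * s := ⟨r / 2, by rw [mul_div_cancel₀]; norm_num⟩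
    have hcoe : ((2 * s : ℝ≥0) : ℝ) = 2 * s := by push_cast; ring
    rw [hcoe] at hr ⊢
    constructor
    · rw [integral_binomialSplit hh]
      refine (abs_integral_switchEstimator_sub_le h0 h1.le hL hA hAs s).trans ?_
      gcongr
      linarith
    · refine (integral_mul_binomialSplit_sub_sq_le hh s _).trans ?_
      refine (integral_mul_switchEstimator_sub_sq_le h0 h1 hL hA s).trans ?_
      rw [Real.exp_log hn0]
      have hs : (s : ℝ) ^ (2 * β) ≤ K * (n * Real.log n ^ (-(2 * β))) :=
        (Real.rpow_le_rpow s.coe_nonneg (by linarith [s.coe_nonneg]) (by linarith)).trans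
          (hKn n hn)
      nlinarith [mul_pos hE hLβ2]

end SingleCoordinate

section Assembly

open MeasureTheory ProbabilityTheory Finset
open scoped NNReal

lemma ExpGrowth.memLp_two {f : ℕ → ℝ} (hf : ExpGrowth f) (r : ℝ≥0) :
    MemLp f 2 (poissonMeasure r) :=
  (memLp_two_iff_integrable_sq (measurable_of_countable f).aestronglyMeasurable).2
    (hf.sq.integrable r)

lemma integral_natCast_sub_sq_poissonMeasure (r : ℝ≥0) :
    ∫ k : ℕ, ((k : ℝ) - r) ^ 2 ∂poissonMeasure r = r := by
  have h := integral_cubic_poissonMeasure r 0 1 (-2 * r) (r ^ 2)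
  calc ∫ k : ℕ, ((k : ℝ) - r) ^ 2 ∂poissonMeasure r
      = ∫ k : ℕ, (0 * (k : ℝ) ^ 3 + 1 * (k : ℝ) ^ 2 + -2 * r * k + (r : ℝ) ^ 2)
          ∂poissonMeasure r := by congr 1; ext k; ring
    _ = r := by rw [h]; ring

lemma variance_natCast_mul_pred_le {g : ℕ → ℝ} (hg : ExpGrowth g) (r : ℝ≥0) (c : ℝ) :
    Var[fun k : ℕ => (k : ℝ) * g (k - 1); poissonMeasure r] ≤
      2 * (r * ∫ k, ((k : ℝ) + 1) * (g k - c) ^ 2 ∂poissonMeasure r) + 2 * c ^ 2 * r := by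
  have hφ : ExpGrowth fun k => (k : ℝ) * g (k - 1) := ExpGrowth.natCast.mul hg.pred
  have hf : ExpGrowth fun k => ((k : ℝ) + 1) * (g k - c) ^ 2 :=
    (ExpGrowth.natCast.add (ExpGrowth.const 1)).mul ((hg.sub (ExpGrowth.const c)).sq)
  have hF : ExpGrowth fun k => (k : ℝ) * ((((k - 1 : ℕ) : ℝ) + 1) * (g (k - 1) - c) ^ 2) :=
    ExpGrowth.natCast.mul hf.pred
  have hd : ExpGrowth fun k => ((k : ℝ) - r) ^ 2 :=
    (ExpGrowth.natCast.sub (ExpGrowth.const _)).sq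
  have hX : ExpGrowth fun k => (k : ℝ) * g (k - 1) - r * c := hφ.sub (ExpGrowth.const _)
  calc Var[fun k : ℕ => (k : ℝ) * g (k - 1); poissonMeasure r]
      = Var[fun k : ℕ => (k : ℝ) * g (k - 1) - r * c; poissonMeasure r] :=
        (variance_sub_const (measurable_of_countable _).aestronglyMeasurable _).symm
    _ ≤ ∫ k : ℕ, ((k : ℝ) * g (k - 1) - r * c) ^ 2 ∂poissonMeasure r :=
        variance_le_expectation_sq (measurable_of_countable _).aestronglyMeasurable
    _ ≤ ∫ k : ℕ, (2 * ((k : ℝ) * ((((k - 1 : ℕ) : ℝ) + 1) * (g (k - 1) - c) ^ 2)) +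
          2 * c ^ 2 * ((k : ℝ) - r) ^ 2) ∂poissonMeasure r := by
        refine integral_mono (hX.sq.integrable r) (((hF.integrable r).const_mul _).add
          ((hd.integrable r).const_mul _)) fun k => ?_
        have e : (k : ℝ) * ((((k - 1 : ℕ) : ℝ) + 1) * (g (k - 1) - c) ^ 2) =
            ((k : ℝ) * (g (k - 1) - c)) ^ 2 := by
          rcases k with _ | k
          · simp
          · push_cast [Nat.add_sub_cancel]; ring
        dsimp only
        rw [e]
        nlinarith [sq_nonneg ((k : ℝ) * (g (k - 1) - c) - c * ((k : ℝ) - r))]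
    _ = _ := by
        rw [integral_add ((hF.integrable r).const_mul _) ((hd.integrable r).const_mul _),
          integral_const_mul, integral_const_mul, integral_natCast_sub_sq_poissonMeasure,
          integral_natCast_mul_pred_poissonMeasure r fun k => ((k : ℝ) + 1) * (g k - c) ^ 2]

lemma poissonRisk_eq_lintegral {S : ℕ} {lam : ℝ} {P : Fin S → ℝ} {r : Fin S → ℝ≥0}
    (hr : ∀ i, (r i : ℝ) = lam * P i) (t : ℝ) (est : (Fin S → ℕ) → ℝ) :
    poissonRisk S lam P t est =
      ∫⁻ z, ENNReal.ofReal ((est z - t) ^ 2) ∂Measure.pi fun i => poissonMeasure (r i) := by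
  rw [lintegral_countable', poissonRisk]
  refine tsum_congr fun z => ?_
  rw [Measure.pi_singleton, mul_comm, ENNReal.ofReal_mul (by positivity)]
  congr 1
  rw [_root_.poissonPMF, ENNReal.ofReal_prod_of_nonneg fun i _ => by rw [← hr]; positivity]
  refine prod_congr rfl fun i _ => ?_
  rw [poissonMeasure_singleton, ← hr]

lemma poissonRisk_sum_eq {S : ℕ} {lam : ℝ} {P : Fin S → ℝ} {r : Fin S → ℝ≥0}
    (hr : ∀ i, (r i : ℝ) = lam * P i) {f : ℕ → ℝ} (hf : ExpGrowth f) (τ : Fin S → ℝ) :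
    poissonRisk S lam P (∑ i, τ i) (fun z => ∑ i, f (z i)) =
      ENNReal.ofReal (∑ i, Var[f; poissonMeasure (r i)] +
        (∑ i, (∫ k, f k ∂poissonMeasure (r i) - τ i)) ^ 2) := by
  set ν : Measure (Fin S → ℕ) := Measure.pi fun i => poissonMeasure (r i) with hν
  have hm : ∀ i, MemLp (fun z : Fin S → ℕ => f (z i)) 2 ν := fun i =>
    (hf.memLp_two (r i)).comp_measurePreserving
      (measurePreserving_eval (fun i => poissonMeasure (r i)) i)
  have hsum : MemLp (fun z : Fin S → ℕ => ∑ i, f (z i)) 2 ν := memLp_finsetSum _ fun i _ => hm i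
  have hX : MemLp (fun z : Fin S → ℕ => ∑ i, f (z i) - ∑ i, τ i) 2 ν :=
    hsum.sub (memLp_const _)
  rw [poissonRisk_eq_lintegral hr, ← ofReal_integral_eq_lintegral_ofReal
    hX.integrable_sq (.of_forall fun z => sq_nonneg _)]
  congr 1
  have hvar := variance_eq_sub hX
  rw [variance_sub_const hsum.1] at hvar
  have hvs := variance_sum_pi (X := fun _ : Fin S => f) (μ := fun i => poissonMeasure (r i))
    fun i => hf.memLp_two (r i)
  have e1 : (∑ i, fun z : Fin S → ℕ => f (z i)) = fun z => ∑ i, f (z i) := by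
    ext z; simp
  rw [e1] at hvs
  have hmean : ∫ z, (∑ i, f (z i) - ∑ i, τ i) ∂ν =
      ∑ i, (∫ k, f k ∂poissonMeasure (r i) - τ i) := by
    rw [integral_sub (hsum.integrable (by norm_num)) (integrable_const _),
      integral_finsetSum _ fun i _ => (hm i).integrable (by norm_num), sum_sub_distrib]
    simp only [integral_const, probReal_univ, one_smul]
    congr 1
    refine sum_congr rfl fun i _ => ?_
    exact integral_comp_eval (μ := fun i => poissonMeasure (r i))
      (measurable_of_countable f).aestronglyMeasurable
  rw [← hvs, hvar, ← hmean]
  simp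

lemma variance_coordinate_le {α C K : ℝ} {n : ℕ} (hn : 2 ≤ n) {g : ℕ → ℝ} (hg : ExpGrowth g)
    {r : ℝ≥0} {p : ℝ} (hr : (r : ℝ) = n * p)
    (hK : (r : ℝ) ^ (2 * (α - 1)) ≤ K * (n * Real.log n ^ (-(2 * (α - 1)))))
    (hC : ∫ k, ((k : ℝ) + 1) * (g k - (r : ℝ) ^ (α - 1)) ^ 2 ∂poissonMeasure r ≤
      C * (n * Real.log n ^ (-(2 * (α - 1))))) :
    Var[fun k : ℕ => (n : ℝ) ^ (-α) * ((k : ℝ) * g (k - 1)); poissonMeasure r] ≤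
      p * ((2 * C + 2 * K) * ((n : ℝ) * Real.log n) ^ (-(2 * (α - 1)))) := by
  have hn1 : (1 : ℝ) < n := by exact_mod_cast hn
  have hn0 : (0 : ℝ) < n := by linarith
  have hL : 0 < Real.log n := Real.log_pos hn1
  rw [variance_const_mul]
  have hv := variance_natCast_mul_pred_le hg r ((r : ℝ) ^ (α - 1))
  have hc : ((r : ℝ) ^ (α - 1)) ^ 2 = (r : ℝ) ^ (2 * (α - 1)) := by
    rw [← Real.rpow_natCast, ← Real.rpow_mul r.coe_nonneg]; congr 1; push_cast; ring
  rw [hc] at hv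
  have hM : ((n : ℝ) ^ (-α)) ^ 2 * (n * n) = (n : ℝ) ^ (-(2 * (α - 1))) := by
    rw [← Real.rpow_natCast, ← Real.rpow_mul hn0.le, ← pow_two, ← Real.rpow_natCast (n : ℝ) 2,
      ← Real.rpow_add hn0]
    congr 1; push_cast; ring
  calc ((n : ℝ) ^ (-α)) ^ 2 * Var[fun k : ℕ => (k : ℝ) * g (k - 1); poissonMeasure r]
      ≤ ((n : ℝ) ^ (-α)) ^ 2 * (2 * (r * (C * (n * Real.log n ^ (-(2 * (α - 1)))))) +
          2 * (K * (n * Real.log n ^ (-(2 * (α - 1))))) * r) := by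
        gcongr
        refine hv.trans ?_
        gcongr
    _ = p * ((2 * C + 2 * K) * ((((n : ℝ) ^ (-α)) ^ 2 * (n * n)) *
          Real.log n ^ (-(2 * (α - 1))))) := by rw [hr]; ring
    _ = _ := by rw [hM, ← Real.mul_rpow hn0.le hL.le]

lemma abs_bias_coordinate_le {α C : ℝ} (hα : 1 < α) {n : ℕ} (hn : 2 ≤ n) {g : ℕ → ℝ}
    {r : ℝ≥0} {p : ℝ} (hp : 0 ≤ p) (hr : (r : ℝ) = n * p)
    (hC : |∫ k, g k ∂poissonMeasure r - (r : ℝ) ^ (α - 1)| ≤ C * Real.log n ^ (-(α - 1))) :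
    |∫ k : ℕ, (n : ℝ) ^ (-α) * ((k : ℝ) * g (k - 1)) ∂poissonMeasure r - p ^ α| ≤
      p * (C * ((n : ℝ) * Real.log n) ^ (-(α - 1))) := by
  have hn1 : (1 : ℝ) < n := by exact_mod_cast hn
  have hn0 : (0 : ℝ) < n := by linarith
  have hL : 0 < Real.log n := Real.log_pos hn1
  have hpα : p ^ α = (n : ℝ) ^ (-α) * (r * (r : ℝ) ^ (α - 1)) := by
    have : (r : ℝ) * (r : ℝ) ^ (α - 1) = (r : ℝ) ^ α := by
      rw [← Real.rpow_one_add' r.coe_nonneg (by linarith)]; congr 1; ring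
    rw [this, hr, Real.mul_rpow hn0.le hp, ← mul_assoc, ← Real.rpow_add hn0]
    simp
  have hM : (n : ℝ) ^ (-α) * n = (n : ℝ) ^ (-(α - 1)) := by
    rw [← Real.rpow_add_one hn0.ne']; congr 1; ring
  rw [integral_const_mul, integral_natCast_mul_pred_poissonMeasure, hpα, ← mul_sub, ← mul_sub,
    abs_mul, abs_mul, abs_of_nonneg (by positivity : 0 ≤ (n : ℝ) ^ (-α)),
    abs_of_nonneg r.coe_nonneg]
  calc (n : ℝ) ^ (-α) * (r * |∫ k, g k ∂poissonMeasure r - (r : ℝ) ^ (α - 1)|)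
      ≤ (n : ℝ) ^ (-α) * (r * (C * Real.log n ^ (-(α - 1)))) := by gcongr
    _ = p * (C * (((n : ℝ) ^ (-α) * n) * Real.log n ^ (-(α - 1)))) := by rw [hr]; ring
    _ = _ := by rw [hM, ← Real.mul_rpow hn0.le hL.le]

end Assembly

theorem Falpha_estimator_upper_bound (α : ℝ) (hα1 : 1 < α) (hα2 : α < 3 / 2) :
    ∃ C : ℝ, 0 < C ∧
      ∃ Fhat : ∀ n S : ℕ, (Fin S → ℕ) → ℝ,
        ∀ n S : ℕ, 2 ≤ n → 1 ≤ S → ∀ P ∈ simplex S,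
          poissonRisk S (n : ℝ) P (Falpha S α P) (Fhat n S)
            ≤ ENNReal.ofReal (C * ((n : ℝ) * Real.log n) ^ (-(2 * (α - 1)))) := by
  have h0 : 0 < α - 1 := by linarith
  have h1 : α - 1 < 1 / 2 := by linarith
  obtain ⟨K, hK, hKn⟩ := exists_rpow_le_mul_log_rpow h0 h1
  obtain ⟨C, hC, hest⟩ := exists_rpow_estimator h0 h1
  choose g hgrowth hg using hest
  refine ⟨2 * C + 2 * K + C ^ 2, by positivity, fun n S z => if hn : 2 ≤ n then
    ∑ i, (n : ℝ) ^ (-α) * ((z i : ℝ) * g n hn (z i - 1)) else 0, fun n S hn _ P hP => ?_⟩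
  obtain ⟨hP0, hP1⟩ := hP
  have hn1 : (1 : ℝ) < n := by exact_mod_cast hn
  have hn0 : (0 : ℝ) < n := by linarith
  have hL : 0 < Real.log n := Real.log_pos hn1
  have hPle : ∀ i, P i ≤ 1 := fun i =>
    hP1 ▸ Finset.single_le_sum (fun j _ => hP0 j) (Finset.mem_univ i)
  set r : Fin S → NNReal := fun i => ⟨n * P i, mul_nonneg hn0.le (hP0 i)⟩ with hrdef
  have hr : ∀ i, (r i : ℝ) = n * P i := fun i => rfl
  have hrn : ∀ i, (r i : ℝ) ≤ n := fun i => by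
    rw [hr]; exact mul_le_of_le_one_right hn0.le (hPle i)
  simp only [dif_pos hn]
  have hf : ExpGrowth fun k => (n : ℝ) ^ (-α) * ((k : ℝ) * g n hn (k - 1)) :=
    (ExpGrowth.const _).mul (ExpGrowth.natCast.mul (hgrowth n hn).pred)
  rw [Falpha, poissonRisk_sum_eq hr hf]
  refine ENNReal.ofReal_le_ofReal ?_
  rw [add_mul]
  refine add_le_add ?_ ?_
  · refine (Finset.sum_le_sum fun i _ => variance_coordinate_le hn (hgrowth n hn) (hr i)
      ((Real.rpow_le_rpow (r i).coe_nonneg (hrn i) (by linarith)).trans (hKn n hn))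
      (hg n hn (r i) (hrn i)).2).trans_eq ?_
    rw [← Finset.sum_mul, hP1, one_mul]
  · have hsq : ((n : ℝ) * Real.log n) ^ (-(2 * (α - 1))) =
        (((n : ℝ) * Real.log n) ^ (-(α - 1))) ^ 2 := by
      rw [← Real.rpow_natCast, ← Real.rpow_mul (by positivity)]; congr 1; push_cast; ring
    rw [hsq, ← mul_pow, ← sq_abs]
    gcongr
    refine (Finset.abs_sum_le_sum_abs _ _).trans ((Finset.sum_le_sum fun i _ =>
      abs_bias_coordinate_le hα1 hn (hP0 i) (hr i) (hg n hn (r i) (hrn i)).1).trans_eq ?_)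
    rw [← Finset.sum_mul, hP1, one_mul]
end

section
/- For every α ∈ (1, 3/2) there exist constants c₀ > 0, c > 0 and an integer N such that for every integer n ≥ N, setting S = ⌈c₀·n·ln n⌉, the minimax risk for estimating F_α(P) over P ∈ M_S under the multinomial sampling model with n samples satisfies inf_{F̂} sup_{P ∈ M_S} E_P[(F̂(X) − F_α(P))²] ≥ c·(n·ln n)^{−2(α−1)}. -/
open scoped BigOperators ENNReal

/-- Joint pmf of `n` i.i.d. samples from `P`. -/
noncomputable def multPMF (S n : ℕ) (P : Fin S → ℝ) (x : Fin n → Fin S) : ℝ :=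
  ∏ j, P (x j)

/-- Expected squared error of an estimator under the multinomial (i.i.d.) model. -/
noncomputable def multRisk (S n : ℕ) (P : Fin S → ℝ) (t : ℝ)
    (est : (Fin n → Fin S) → ℝ) : ℝ≥0∞ :=
  ∑' x : Fin n → Fin S, ENNReal.ofReal (multPMF S n P x * (est x - t) ^ 2)

/-- Minimax risk for estimating `F P` under the multinomial model with `n` samples. -/
noncomputable def multMinimax (S n : ℕ) (F : (Fin S → ℝ) → ℝ) : ℝ≥0∞ :=
  ⨅ est : (Fin n → Fin S) → ℝ, ⨆ P ∈ simplex S, multRisk S n P (F P) est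

open Finset in
theorem sum_nodalWeight_mul_pow_eq_zero {ι : Type*} [Fintype ι] [DecidableEq ι] {v : ι → ℝ}
    (hv : Function.Injective v) {j : ℕ} (hj : j + 1 < Fintype.card ι) :
    ∑ i, Lagrange.nodalWeight univ v i * v i ^ j = 0 := by
  have h := Lagrange.coeff_eq_sum (s := univ) (v := v) hv.injOn
    (P := (Polynomial.X ^ j : Polynomial ℝ)) (by
      rw [Polynomial.degree_X_pow, card_univ]; exact_mod_cast (by omega : j < Fintype.card ι))
  rw [Polynomial.coeff_X_pow, if_neg (by rw [card_univ]; omega)] at h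
  rw [h]
  refine sum_congr rfl fun i _ => ?_
  rw [Lagrange.nodalWeight, prod_inv_distrib, Polynomial.eval_pow, Polynomial.eval_X]
  ring

open Finset in
theorem sum_nodalWeight_mul_inv_add {ι : Type*} [Fintype ι] [DecidableEq ι] [Nonempty ι]
    {v : ι → ℝ} (hv : Function.Injective v) (hv0 : ∀ i, 0 ≤ v i) {t : ℝ} (ht : 0 < t) :
    ∑ i, Lagrange.nodalWeight univ v i * (t + v i)⁻¹
      = -(-1) ^ Fintype.card ι * (∏ i, (t + v i))⁻¹ := by
  have hx : ∀ i ∈ (univ : Finset ι), -t ≠ v i := fun i _ h => by linarith [hv0 i]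
  have h := Lagrange.eval_interpolate_not_at_node (s := univ) (v := v) 1 hx
  rw [Lagrange.interpolate_one hv.injOn univ_nonempty, Polynomial.eval_one,
    Lagrange.eval_nodal] at h
  have hp : ∏ i, (-t - v i) = (-1) ^ Fintype.card ι * ∏ i, (t + v i) := by
    rw [← card_univ, ← prod_const, ← prod_mul_distrib]
    exact prod_congr rfl fun i _ => by ring
  have hs : ∑ i, Lagrange.nodalWeight univ v i * (-t - v i)⁻¹ * (1 : ι → ℝ) i
      = - ∑ i, Lagrange.nodalWeight univ v i * (t + v i)⁻¹ := by
    rw [← sum_neg_distrib]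
    refine sum_congr rfl fun i _ => ?_
    rw [show -t - v i = -(t + v i) by ring, inv_neg]; simp
  rw [hp, hs] at h
  have hpos : 0 < ∏ i, (t + v i) := prod_pos fun i _ => by linarith [hv0 i]
  have hsq : ((-1 : ℝ) ^ Fintype.card ι) * (-1) ^ Fintype.card ι = 1 := by
    rw [← mul_pow]; simp
  rw [← div_eq_mul_inv, eq_div_iff hpos.ne']
  linear_combination ((-1) ^ Fintype.card ι) * h
    - (∏ i, (t + v i)) * (∑ i, Lagrange.nodalWeight univ v i * (t + v i)⁻¹) * hsq

open Finset MeasureTheory in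
/-- The divided difference of `x ^ p`, `1 < p < 2`, over nonnegative nodes, one of them zero, is
bounded below up to sign. -/
theorem le_abs_sum_nodalWeight_mul_rpow {ι : Type*} [Fintype ι] [DecidableEq ι]
    {v : ι → ℝ} (hv : Function.Injective v) (hv0 : ∀ i, 0 ≤ v i) {i₀ : ι} (hi₀ : v i₀ = 0)
    (hcard : 3 ≤ Fintype.card ι) {p : ℝ} (hp : p ∈ Set.Ioo (1 : ℝ) 2) :
    (∫ t in Set.Ioi 0, Real.rpowIntegrand₀₁ (p - 1) t 1)⁻¹ *
        (4⁻¹ * (∏ i ∈ univ.erase i₀, (1 + v i))⁻¹)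
      ≤ |∑ i, Lagrange.nodalWeight univ v i * v i ^ p| := by
  have : Nonempty ι := ⟨i₀⟩
  set C := (∫ t in Set.Ioi 0, Real.rpowIntegrand₀₁ (p - 1) t 1)⁻¹ with hC
  have hCpos : 0 < C :=
    inv_pos.2 (Real.integral_rpowIntegrand₀₁_one_pos ⟨by linarith [hp.1], by linarith [hp.2]⟩)
  set w := Lagrange.nodalWeight univ v
  have hm0 : ∑ i, w i = 0 := by
    simpa using sum_nodalWeight_mul_pow_eq_zero hv (j := 0) (by omega)
  have hm1 : ∑ i, w i * v i = 0 := by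
    simpa using sum_nodalWeight_mul_pow_eq_zero hv (j := 1) (by omega)
  have hterm : ∀ i ∈ (univ : Finset ι),
      IntegrableOn (fun t => w i * Real.rpowIntegrand₁₂ p t (v i)) (Set.Ioi 0) :=
    fun i _ => (Real.integrableOn_rpowIntegrand₁₂ hp (hv0 i)).const_mul _
  have hpt : ∀ t ∈ Set.Ioi (0 : ℝ), ∑ i, w i * Real.rpowIntegrand₁₂ p t (v i)
      = -(-1) ^ Fintype.card ι * (t ^ p * (∏ i, (t + v i))⁻¹) := by
    intro t ht
    have ht : 0 < t := ht
    have e : ∀ i, w i * Real.rpowIntegrand₁₂ p t (v i)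
        = t ^ (p - 1) * t⁻¹ * (w i * v i) - t ^ (p - 1) * w i
          + t ^ p * (w i * (t + v i)⁻¹) := by
      intro i
      have : t ^ p = t ^ (p - 1) * t := by
        rw [← Real.rpow_add_one ht.ne']; simp
      rw [Real.rpowIntegrand₁₂, this]; ring
    simp_rw [e]
    rw [sum_add_distrib, sum_sub_distrib, ← mul_sum, ← mul_sum, ← mul_sum, hm0, hm1,
      sum_nodalWeight_mul_inv_add hv hv0 ht]
    ring
  have hsum : ∑ i, w i * v i ^ p
      = C * (-(-1) ^ Fintype.card ι * ∫ t in Set.Ioi 0, t ^ p * (∏ i, (t + v i))⁻¹) := by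
    calc ∑ i, w i * v i ^ p
        = C * ∑ i, ∫ t in Set.Ioi 0, w i * Real.rpowIntegrand₁₂ p t (v i) := by
          rw [mul_sum]
          refine sum_congr rfl fun i _ => ?_
          rw [Real.rpow_eq_const_mul_integral_rpowIntegrand₁₂ hp (hv0 i), integral_const_mul]
          ring
      _ = C * ∫ t in Set.Ioi 0, ∑ i, w i * Real.rpowIntegrand₁₂ p t (v i) := by
          rw [integral_finsetSum _ hterm]
      _ = _ := by
          rw [setIntegral_congr_fun measurableSet_Ioi hpt, integral_const_mul]
  have hI : IntegrableOn (fun t : ℝ => t ^ p * (∏ i, (t + v i))⁻¹) (Set.Ioi 0) := by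
    have h1 : IntegrableOn (fun t => ∑ i, w i * Real.rpowIntegrand₁₂ p t (v i)) (Set.Ioi 0) :=
      integrable_finsetSum _ hterm
    have h2 := (h1.congr_fun hpt measurableSet_Ioi).const_mul (-(-1) ^ Fintype.card ι)
    refine h2.congr (ae_of_all _ fun t => ?_)
    have hsq : ((-1 : ℝ) ^ Fintype.card ι) * (-1) ^ Fintype.card ι = 1 := by
      rw [← mul_pow]; simp
    simp only
    linear_combination (t ^ p * (∏ i, (t + v i))⁻¹) * hsq
  set Q := ∏ i ∈ univ.erase i₀, (1 + v i) with hQ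
  have hQpos : 0 < Q := prod_pos fun i _ => by linarith [hv0 i]
  have hlow : 4⁻¹ * Q⁻¹ ≤ ∫ t in Set.Ioi 0, t ^ p * (∏ i, (t + v i))⁻¹ := by
    have hnn : ∀ t ∈ Set.Ioi (0 : ℝ), 0 ≤ t ^ p * (∏ i, (t + v i))⁻¹ := fun t ht => by
      have ht : 0 < t := ht
      exact mul_nonneg (by positivity) (inv_nonneg.2 (prod_nonneg fun i _ => by linarith [hv0 i]))
    have hsub : Set.Ioc (1/2 : ℝ) 1 ⊆ Set.Ioi 0 := fun t ht => by
      have := ht.1; simp only [Set.mem_Ioi]; linarith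
    refine le_trans ?_ (setIntegral_mono_set hI
      ((ae_restrict_iff' measurableSet_Ioi).2 (ae_of_all _ hnn)) hsub.eventuallyLE)
    have hc : ∫ t in Set.Ioc (1/2 : ℝ) 1, 2⁻¹ * Q⁻¹ = 4⁻¹ * Q⁻¹ := by
      rw [setIntegral_const, Real.volume_real_Ioc_of_le (by norm_num), smul_eq_mul]; ring
    rw [← hc]
    refine setIntegral_mono_on (integrableOn_const (by simp)) (hI.mono_set hsub)
      measurableSet_Ioc fun t ht => ?_
    have ht0 : 0 < t := hsub ht
    rw [← mul_prod_erase univ _ (mem_univ i₀), hi₀, add_zero, mul_inv, ← mul_assoc]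
    have e1 : t ^ p * t⁻¹ = t ^ (p - 1) := by
      rw [Real.rpow_sub_one ht0.ne', div_eq_mul_inv]
    rw [e1]
    have e2 : 2⁻¹ ≤ t ^ (p - 1) := by
      have : t ^ (1 : ℝ) ≤ t ^ (p - 1) :=
        Real.rpow_le_rpow_of_exponent_ge ht0 ht.2 (by linarith [hp.2])
      rw [Real.rpow_one] at this
      have := ht.1; norm_num at this ⊢; linarith
    have e3 : ∏ i ∈ univ.erase i₀, (t + v i) ≤ Q :=
      prod_le_prod (fun i _ => by linarith [hv0 i]) fun i _ => by linarith [ht.2]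
    have e4 : 0 < ∏ i ∈ univ.erase i₀, (t + v i) := prod_pos fun i _ => by linarith [hv0 i]
    gcongr
  rw [hsum, abs_mul, abs_of_pos hCpos, abs_mul, abs_neg, abs_pow, abs_neg, abs_one, one_pow,
    one_mul]
  gcongr
  exact hlow.trans (le_abs_self _)

open Finset in
/-- For `1 ≤ k ≤ D`, the product of `|k² - j²|` over `j ≤ D`, `j ≠ k`. -/
theorem prod_abs_sq_sub_sq {k D : ℕ} (hk : 1 ≤ k) (hD : k ≤ D) :
    2 * ∏ j ∈ range (D + 1), (if j = k then 1 else |(k : ℝ) ^ 2 - (j : ℝ) ^ 2|)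
      = ((D - k).factorial * (D + k).factorial : ℕ) := by
  induction D, hD using Nat.le_induction with
  | base =>
    rw [prod_range_succ, if_pos rfl, mul_one, Nat.sub_self, Nat.factorial_zero, one_mul]
    have h1 : ∀ m ≤ k, (∏ j ∈ range m, (if j = k then 1 else |(k : ℝ) ^ 2 - (j : ℝ) ^ 2|))
        * ((k - m).factorial * (k - 1).factorial : ℕ)
        = (k.factorial * (k + m - 1).factorial : ℕ) := by
      intro m
      induction m with
      | zero => intro _; simp
      | succ m ih =>
        intro hm
        have ih := ih (by omega)
        rw [prod_range_succ, if_neg (by omega)]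
        obtain ⟨r, hr⟩ : ∃ r, k = m + 1 + r := ⟨k - (m + 1), by omega⟩
        have e1 : k - m = r + 1 := by omega
        have e2 : k - (m + 1) = r := by omega
        have e3 : k + m - 1 + 1 = k + (m + 1) - 1 := by omega
        have e4 : k + m - 1 + 1 = k + m := by omega
        rw [e1, Nat.factorial_succ] at ih
        rw [e2, ← e3, Nat.factorial_succ, e4]
        have hkr : (k : ℝ) - m = r + 1 := by rw [hr]; push_cast; ring
        have habs : |(k : ℝ) ^ 2 - (m : ℝ) ^ 2| = (r + 1) * (k + m) := by
          rw [show (k : ℝ) ^ 2 - (m : ℝ) ^ 2 = (r + 1) * (k + m) by rw [← hkr]; ring]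
          exact abs_of_nonneg (by positivity)
        rw [habs]
        push_cast at ih ⊢
        linear_combination ((k : ℝ) + m) * ih
    have h2 := h1 k le_rfl
    rw [Nat.sub_self, Nat.factorial_zero, one_mul] at h2
    obtain ⟨r, rfl⟩ : ∃ r, k = r + 1 := ⟨k - 1, by omega⟩
    have e5 : r + 1 + (r + 1) = (r + 1 + (r + 1) - 1) + 1 := by omega
    rw [e5, Nat.factorial_succ]
    rw [Nat.factorial_succ, Nat.add_sub_cancel] at h2
    rw [← e5]
    have hpos : ((r.factorial : ℕ) : ℝ) ≠ 0 := by positivity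
    push_cast at h2 ⊢
    apply mul_right_cancel₀ hpos
    linear_combination 2 * h2
  | succ D hD ih =>
    rw [prod_range_succ, if_neg (by omega), ← mul_assoc, ih]
    obtain ⟨r, rfl⟩ : ∃ r, D = k + r := ⟨D - k, by omega⟩
    rw [show k + r + 1 - k = r + 1 by omega, show k + r - k = r by omega,
      show k + r + 1 + k = (k + r + k) + 1 by omega, Nat.factorial_succ, Nat.factorial_succ]
    have habs : |(k : ℝ) ^ 2 - ((k + r + 1 : ℕ) : ℝ) ^ 2| = (r + 1) * (k + r + k + 1) := by
      rw [abs_sub_comm, show ((k + r + 1 : ℕ) : ℝ) ^ 2 - (k : ℝ) ^ 2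
        = (r + 1) * (k + r + k + 1) by push_cast; ring]
      exact abs_of_nonneg (by positivity)
    rw [habs]
    push_cast
    ring

theorem factorial_sq_le_factorial_mul_factorial {k D : ℕ} (hD : k ≤ D) :
    D.factorial * D.factorial ≤ (D - k).factorial * (D + k).factorial := by
  have h1 := Nat.choose_mul_factorial_mul_factorial (show D + k ≤ 2 * D by omega)
  have h2 := Nat.choose_mul_factorial_mul_factorial (show D ≤ 2 * D by omega)
  have h3 := Nat.choose_le_centralBinom (D + k) D
  rw [Nat.centralBinom] at h3
  rw [show 2 * D - (D + k) = D - k by omega] at h1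
  rw [show 2 * D - D = D by omega] at h2
  have hpos : 0 < (2 * D).choose D := Nat.choose_pos (by omega)
  refine Nat.le_of_mul_le_mul_left ?_ hpos
  calc (2 * D).choose D * (D.factorial * D.factorial)
      = (2 * D).choose (D + k) * (D + k).factorial * (D - k).factorial := by
        rw [h1, ← h2]; ring
    _ ≤ (2 * D).choose D * ((D - k).factorial * (D + k).factorial) := by
        rw [mul_assoc, mul_comm (D + k).factorial]; gcongr

open Finset in
theorem factorial_sq_le_prod_abs_sub_sq {D : ℕ} (hD : 2 ≤ D) {a : ℝ} (ha : a = 2 ∨ a = 3) :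
    ((D.factorial : ℝ)) ^ 2 ≤ 6 * ∏ j ∈ range (D + 1), |a - (j : ℝ) ^ 2| := by
  have key : ((D : ℝ) + 1) * (D + 2) * (D.factorial : ℝ) ^ 2
      ≤ 6 * (D * (D - 1)) * ∏ j ∈ range (D + 1), |a - (j : ℝ) ^ 2| := by
    induction D, hD using Nat.le_induction with
    | base =>
      rcases ha with rfl | rfl <;> norm_num [prod_range_succ, Nat.factorial]
    | succ D hD ih =>
      have hD' : (2 : ℝ) ≤ D := by exact_mod_cast hD
      rw [prod_range_succ, Nat.factorial_succ]
      set P := ∏ j ∈ range (D + 1), |a - (j : ℝ) ^ 2|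
      have hP : 0 ≤ P := prod_nonneg fun j _ => abs_nonneg _
      have habs : ((D : ℝ) - 1) * (D + 3) ≤ |a - ((D + 1 : ℕ) : ℝ) ^ 2| := by
        rw [abs_sub_comm]
        refine le_trans ?_ (le_abs_self _)
        push_cast
        rcases ha with rfl | rfl <;> nlinarith
      push_cast
      have h1 : (D : ℝ) * (D + 1) * (P * ((D - 1) * (D + 3)))
          ≤ D * (D + 1) * (P * |a - ((D + 1 : ℕ) : ℝ) ^ 2|) := by gcongr
      push_cast at h1
      have h2 := mul_le_mul_of_nonneg_left ih (show (0 : ℝ) ≤ (D + 1) * (D + 3) by positivity)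
      nlinarith
  have hD' : (2 : ℝ) ≤ D := by exact_mod_cast hD
  have hc : (0 : ℝ) < D * (D - 1) := by nlinarith
  have h3 : (D : ℝ) * (D - 1) * (D.factorial : ℝ) ^ 2
      ≤ (D + 1) * (D + 2) * (D.factorial : ℝ) ^ 2 := by gcongr <;> linarith
  refine le_of_mul_le_mul_left ?_ hc
  linarith

/-- The nodes `2`, `3` and the squares `0², 1², …, D²`. -/
def squareNode (D : ℕ) : Bool ⊕ Fin (D + 1) → ℝ :=
  Sum.elim (fun b => if b then 3 else 2) fun j => (j : ℝ) ^ 2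

theorem squareNode_nonneg (D : ℕ) (i : Bool ⊕ Fin (D + 1)) : 0 ≤ squareNode D i := by
  rcases i with b | j
  · cases b <;> simp [squareNode]
  · simp only [squareNode, Sum.elim_inr]; positivity

theorem squareNode_le {D : ℕ} (hD : 2 ≤ D) (i : Bool ⊕ Fin (D + 1)) :
    squareNode D i ≤ (D : ℝ) ^ 2 := by
  have hD' : (2 : ℝ) ≤ D := by exact_mod_cast hD
  rcases i with b | j
  · cases b <;> simp only [squareNode, Sum.elim_inl] <;> norm_num <;> nlinarith
  · have : ((j : ℕ) : ℝ) ≤ D := by exact_mod_cast Nat.lt_succ_iff.1 j.2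
    simp only [squareNode, Sum.elim_inr]
    gcongr

theorem natCast_sq_ne_two_three (j : ℕ) : (j : ℝ) ^ 2 ≠ 2 ∧ (j : ℝ) ^ 2 ≠ 3 := by
  have h : j ^ 2 ≠ 2 ∧ j ^ 2 ≠ 3 := by
    rcases Nat.lt_or_ge j 2 with hj | hj
    · interval_cases j <;> simp
    · constructor <;> nlinarith
  exact ⟨by exact_mod_cast h.1, by exact_mod_cast h.2⟩

theorem squareNode_injective (D : ℕ) : Function.Injective (squareNode D) := by
  rintro (a | i) (b | j) h
  · cases a <;> cases b <;> simp [squareNode] at h ⊢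
  · have := natCast_sq_ne_two_three j
    cases a <;> simp only [squareNode, Sum.elim_inl, Sum.elim_inr] at h
    · exact absurd h.symm (by simpa using this.1)
    · exact absurd h.symm (by simpa using this.2)
  · have := natCast_sq_ne_two_three i
    cases b <;> simp only [squareNode, Sum.elim_inl, Sum.elim_inr] at h
    · exact absurd h (by simpa using this.1)
    · exact absurd h (by simpa using this.2)
  · simp only [squareNode, Sum.elim_inr] at h
    have h' : (i : ℕ) = j := by
      have := (sq_eq_sq₀ (Nat.cast_nonneg _) (Nat.cast_nonneg _)).1 h
      exact_mod_cast this
    rw [Fin.ext h']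

open Finset in
theorem inv_abs_nodalWeight {ι : Type*} [Fintype ι] [DecidableEq ι] (v : ι → ℝ) (i : ι) :
    |Lagrange.nodalWeight univ v i| = (∏ j, if j = i then 1 else |v i - v j|)⁻¹ := by
  rw [Lagrange.nodalWeight, prod_inv_distrib, abs_inv, abs_prod,
    ← mul_prod_erase univ _ (mem_univ i),
    if_pos rfl, one_mul]
  congr 1
  exact prod_congr rfl fun j hj => by rw [if_neg (ne_of_mem_erase hj)]

theorem prod_range_sq_eq_factorial_sq (D : ℕ) :
    ∏ j ∈ Finset.range D, ((j + 1 : ℕ) : ℝ) ^ 2 = (D.factorial : ℝ) ^ 2 := by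
  rw [Finset.prod_pow, ← Finset.prod_range_add_one_eq_factorial]
  push_cast
  rfl

open Finset in
theorem abs_nodalWeight_squareNode_zero (D : ℕ) :
    |Lagrange.nodalWeight univ (squareNode D) (Sum.inr 0)| = (6 * (D.factorial : ℝ) ^ 2)⁻¹ := by
  rw [inv_abs_nodalWeight]
  congr 1
  rw [Fintype.prod_sum_type, Fintype.prod_bool, Fin.prod_univ_succ]
  simp only [squareNode, Sum.elim_inl, Sum.elim_inr, reduceCtorEq, if_false, if_true,
    Fin.val_zero, Nat.cast_zero, Sum.inr.injEq, Fin.succ_ne_zero, Fin.val_succ]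
  rw [← prod_range_sq_eq_factorial_sq,
    ← Fin.prod_univ_eq_prod_range (fun j => ((j + 1 : ℕ) : ℝ) ^ 2)]
  have : ∀ j : Fin D, |(0 : ℝ) ^ 2 - ((j + 1 : ℕ) : ℝ) ^ 2| = ((j + 1 : ℕ) : ℝ) ^ 2 := fun j => by
    rw [zero_pow two_ne_zero, zero_sub, abs_neg, abs_of_nonneg (by positivity)]
  simp_rw [this]
  norm_num

open Finset in
theorem abs_nodalWeight_squareNode_inl_le {D : ℕ} (hD : 2 ≤ D) (b : Bool) :
    6 * (D.factorial : ℝ) ^ 2 * |Lagrange.nodalWeight univ (squareNode D) (Sum.inl b)| ≤ 36 := by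
  rw [inv_abs_nodalWeight, Fintype.prod_sum_type, Fintype.prod_bool]
  have hf : (0 : ℝ) < (D.factorial : ℝ) ^ 2 := by positivity
  have key : ∀ a : ℝ, a = 2 ∨ a = 3 →
      6 * (D.factorial : ℝ) ^ 2 * (∏ j : Fin (D + 1), |a - ((j : ℕ) : ℝ) ^ 2|)⁻¹ ≤ 36 := by
    intro a ha
    have h := factorial_sq_le_prod_abs_sub_sq hD ha
    rw [← Fin.prod_univ_eq_prod_range (fun j => |a - (j : ℝ) ^ 2|)] at h
    rw [← div_eq_mul_inv, div_le_iff₀ (by linarith)]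
    linarith
  cases b
  · have := key 2 (Or.inl rfl)
    simp only [squareNode, Sum.elim_inl, Sum.elim_inr, reduceCtorEq, if_false, if_true,
      Sum.inl.injEq]
    norm_num at this ⊢
    exact this
  · have := key 3 (Or.inr rfl)
    simp only [squareNode, Sum.elim_inl, Sum.elim_inr, reduceCtorEq, if_false, if_true,
      Sum.inl.injEq]
    norm_num at this ⊢
    exact this

theorem pow_four_le_abs_sub_mul_abs_sub {k : ℕ} (hk : 1 ≤ k) :
    (k : ℝ) ^ 4 ≤ 8 * (|(k : ℝ) ^ 2 - 3| * |(k : ℝ) ^ 2 - 2|) := by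
  rw [← abs_mul]
  rcases Nat.lt_or_ge k 3 with h | h
  · interval_cases k <;> norm_num [abs_of_nonneg, abs_of_neg]
  · have h' : (3 : ℝ) ≤ k := by exact_mod_cast h
    have h9 : (9 : ℝ) ≤ (k : ℝ) ^ 2 := by nlinarith
    refine le_trans ?_ (mul_le_mul_of_nonneg_left (le_abs_self _) (by norm_num))
    nlinarith

open Finset in
theorem abs_nodalWeight_squareNode_inr_le {D : ℕ} (k : Fin D) :
    6 * (D.factorial : ℝ) ^ 2 * |Lagrange.nodalWeight univ (squareNode D) (Sum.inr k.succ)|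
      ≤ 96 * (((k : ℕ) + 1 : ℕ) ^ 4 : ℝ)⁻¹ := by
  rw [inv_abs_nodalWeight, Fintype.prod_sum_type, Fintype.prod_bool]
  have hf : (0 : ℝ) < (D.factorial : ℝ) ^ 2 := by positivity
  set K : ℕ := (k : ℕ) + 1 with hK
  have hK1 : 1 ≤ K := by omega
  have hKD : K ≤ D := k.2
  have h1 := prod_abs_sq_sub_sq hK1 hKD
  have h2 : ((D.factorial : ℝ)) ^ 2 ≤ ((D - K).factorial * (D + K).factorial : ℕ) := by
    rw [sq]; exact_mod_cast factorial_sq_le_factorial_mul_factorial hKD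
  rw [← h1, ← Fin.prod_univ_eq_prod_range
    (fun j => if j = K then 1 else |(K : ℝ) ^ 2 - (j : ℝ) ^ 2|)] at h2
  have h3 : ∀ j : Fin (D + 1), ((Sum.inr j : Bool ⊕ Fin (D + 1)) = Sum.inr k.succ)
      ↔ (j : ℕ) = K := fun j => by
    rw [Sum.inr.injEq, Fin.ext_iff, Fin.val_succ]
  simp only [h3]
  simp only [squareNode, Sum.elim_inl, Sum.elim_inr, reduceCtorEq, if_false, if_true, Fin.val_succ,
    ← hK, Bool.false_eq_true]
  set P := ∏ j : Fin (D + 1), (if (j : ℕ) = K then 1 else |(K : ℝ) ^ 2 - ((j : ℕ) : ℝ) ^ 2|)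
  have h4 := pow_four_le_abs_sub_mul_abs_sub hK1
  set A := |(K : ℝ) ^ 2 - 3| * |(K : ℝ) ^ 2 - 2|
  have hK4 : (0 : ℝ) < (K : ℝ) ^ 4 := by positivity
  have hA : 0 < A := by linarith
  have hP : 0 < P := by linarith
  rw [← div_eq_mul_inv, ← div_eq_mul_inv, div_le_div_iff₀ (by positivity) hK4]
  have := mul_le_mul h2 h4 hK4.le (by positivity)
  nlinarith

theorem sum_inv_sq_le_two (D : ℕ) : ∑ k : Fin D, (((k : ℕ) + 1 : ℕ) ^ 2 : ℝ)⁻¹ ≤ 2 := by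
  rw [Fin.sum_univ_eq_sum_range (fun k => (((k + 1 : ℕ) : ℝ) ^ 2)⁻¹)]
  have h := sum_Ioo_inv_sq_le (α := ℝ) 0 (D + 1)
  rw [show Finset.Ioo 0 (D + 1) = Finset.Ico 1 (D + 1) by
      ext; simp [Nat.one_le_iff_ne_zero, Nat.pos_iff_ne_zero],
    Finset.sum_Ico_eq_sum_range] at h
  simpa [add_comm] using h

open Finset in
theorem prod_one_add_squareNode_le (D : ℕ) :
    ∏ i ∈ univ.erase (Sum.inr 0), (1 + squareNode D i)
      ≤ 12 * Real.exp 2 * (D.factorial : ℝ) ^ 2 := by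
  have h0 : ∏ i ∈ univ.erase (Sum.inr 0), (1 + squareNode D i) = ∏ i, (1 + squareNode D i) := by
    rw [← mul_prod_erase univ (fun i => 1 + squareNode D i) (mem_univ (Sum.inr 0))]
    simp [squareNode]
  rw [h0, Fintype.prod_sum_type, Fintype.prod_bool, Fin.prod_univ_succ]
  simp only [squareNode, Sum.elim_inl, Sum.elim_inr, if_true, Fin.val_zero, Fin.val_succ]
  have h1 : ∏ k : Fin D, (1 + (((k : ℕ) + 1 : ℕ) : ℝ) ^ 2)
      ≤ ∏ k : Fin D, (Real.exp ((((k : ℕ) + 1 : ℕ) ^ 2 : ℝ)⁻¹) * (((k : ℕ) + 1 : ℕ) : ℝ) ^ 2) := by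
    refine prod_le_prod (fun k _ => by positivity) fun k _ => ?_
    have hpos : (0 : ℝ) < (((k : ℕ) + 1 : ℕ) : ℝ) ^ 2 := by positivity
    have := mul_le_mul_of_nonneg_right (Real.add_one_le_exp ((((k : ℕ) + 1 : ℕ) ^ 2 : ℝ)⁻¹)) hpos.le
    rw [add_mul, inv_mul_cancel₀ hpos.ne', one_mul] at this
    exact this
  rw [prod_mul_distrib, ← Real.exp_sum,
    Fin.prod_univ_eq_prod_range (fun j => ((j + 1 : ℕ) : ℝ) ^ 2),
    prod_range_sq_eq_factorial_sq] at h1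
  have h2 := Real.exp_le_exp.2 (sum_inv_sq_le_two D)
  have h3 : Real.exp (∑ k : Fin D, (((k : ℕ) + 1 : ℕ) ^ 2 : ℝ)⁻¹) * (D.factorial : ℝ) ^ 2
      ≤ Real.exp 2 * (D.factorial : ℝ) ^ 2 := by gcongr
  norm_num at h1 h3 ⊢
  linarith

open Finset in
/-- A signed measure on the nodes annihilating polynomials of degree at most `D`, with bounded mass
and first absolute moment, that does not annihilate `x ^ p`, uniformly in `D`. -/
theorem exists_signed_weights {p : ℝ} (hp : p ∈ Set.Ioo (1 : ℝ) 2) :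
    ∃ c : ℝ, 0 < c ∧ ∀ D : ℕ, 2 ≤ D → ∃ τ : Bool ⊕ Fin (D + 1) → ℝ,
      (∀ j ≤ D, ∑ i, τ i * squareNode D i ^ j = 0) ∧ ∑ i, |τ i| ≤ 1 ∧
      ∑ i, |τ i| * squareNode D i ≤ 1 ∧ c ≤ ∑ i, τ i * squareNode D i ^ p := by
  set C := (∫ t in Set.Ioi 0, Real.rpowIntegrand₀₁ (p - 1) t 1)⁻¹ with hC
  have hCpos : 0 < C :=
    inv_pos.2 (Real.integral_rpowIntegrand₀₁_one_pos ⟨by linarith [hp.1], by linarith [hp.2]⟩)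
  refine ⟨C / (3200 * Real.exp 2), by positivity, fun D hD => ?_⟩
  set w := Lagrange.nodalWeight univ (squareNode D) with hw
  set q := 6 * (D.factorial : ℝ) ^ 2 with hq
  have hqpos : 0 < q := by positivity
  have hcard : Fintype.card (Bool ⊕ Fin (D + 1)) = D + 3 := by simp; omega
  have hgap := le_abs_sum_nodalWeight_mul_rpow (squareNode_injective D) (squareNode_nonneg D)
    (i₀ := Sum.inr 0) (by simp [squareNode]) (by omega) hp
  rw [← hC, ← hw] at hgap
  have hmom : ∀ j ≤ D, ∑ i, w i * squareNode D i ^ j = 0 := fun j hj =>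
    sum_nodalWeight_mul_pow_eq_zero (squareNode_injective D) (by omega)
  have hinl : ∀ b, q * |w (Sum.inl b)| ≤ 36 := abs_nodalWeight_squareNode_inl_le hD
  have hinr : ∀ k : Fin D, q * |w (Sum.inr k.succ)| ≤ 96 * (((k : ℕ) + 1 : ℕ) ^ 4 : ℝ)⁻¹ :=
    abs_nodalWeight_squareNode_inr_le
  have hzero : q * |w (Sum.inr 0)| = 1 := by
    rw [hw, abs_nodalWeight_squareNode_zero, ← hq, mul_inv_cancel₀ hqpos.ne']
  have hsq := sum_inv_sq_le_two D
  have hinr' : ∀ k : Fin D, q * |w (Sum.inr k.succ)| * squareNode D (Sum.inr k.succ)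
      ≤ 96 * (((k : ℕ) + 1 : ℕ) ^ 2 : ℝ)⁻¹ := fun k => by
    have hpos : (0 : ℝ) < (((k : ℕ) + 1 : ℕ) : ℝ) := by positivity
    refine (mul_le_mul_of_nonneg_right (hinr k) (squareNode_nonneg D _)).trans (le_of_eq ?_)
    simp only [squareNode, Sum.elim_inr, Fin.val_succ]
    field_simp
  have hmass : ∑ i, q * |w i| ≤ 400 := by
    rw [Fintype.sum_sum_type, Fintype.sum_bool, Fin.sum_univ_succ, hzero]
    have : ∑ k : Fin D, q * |w (Sum.inr k.succ)| ≤ 96 * 2 := by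
      refine le_trans (sum_le_sum (g := fun k : Fin D => 96 * (((k : ℕ) + 1 : ℕ) ^ 2 : ℝ)⁻¹)
        fun k _ => (hinr k).trans ?_) ?_
      · have h1 : (1 : ℝ) ≤ (((k : ℕ) + 1 : ℕ) : ℝ) := by exact_mod_cast Nat.le_add_left 1 _
        gcongr
        norm_num
      · rw [← mul_sum]
        exact mul_le_mul_of_nonneg_left hsq (by norm_num)
    linarith [hinl true, hinl false]
  have hfirst : ∑ i, q * |w i| * squareNode D i ≤ 400 := by
    rw [Fintype.sum_sum_type, Fintype.sum_bool, Fin.sum_univ_succ]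
    have : ∑ k : Fin D, q * |w (Sum.inr k.succ)| * squareNode D (Sum.inr k.succ) ≤ 96 * 2 := by
      refine le_trans (sum_le_sum fun k _ => hinr' k) ?_
      rw [← mul_sum]
      exact mul_le_mul_of_nonneg_left hsq (by norm_num)
    have e0 : squareNode D (Sum.inr 0) = 0 := by simp [squareNode]
    have e1 : squareNode D (Sum.inl true) = 3 := by simp [squareNode]
    have e2 : squareNode D (Sum.inl false) = 2 := by simp [squareNode]
    rw [e0, e1, e2]
    linarith [hinl true, hinl false]
  obtain ⟨σ, hσ, hσs⟩ : ∃ σ : ℝ, |σ| = 1 ∧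
      σ * (∑ i, w i * squareNode D i ^ p) = |∑ i, w i * squareNode D i ^ p| := by
    rcases abs_cases (∑ i, w i * squareNode D i ^ p) with h | h
    · exact ⟨1, by simp, by rw [h.1, one_mul]⟩
    · exact ⟨-1, by simp, by rw [h.1, neg_one_mul]⟩
  have habs : ∀ i, |σ * (q / 400) * w i| = q * |w i| / 400 := fun i => by
    rw [abs_mul, abs_mul, hσ, abs_of_pos (by positivity)]; ring
  refine ⟨fun i => σ * (q / 400) * w i, fun j hj => ?_, ?_, ?_, ?_⟩
  · simp_rw [mul_assoc]
    rw [← mul_sum, ← mul_sum, hmom j hj]; simp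
  · simp_rw [habs]
    rw [← sum_div]; linarith
  · simp_rw [habs, div_mul_eq_mul_div]
    rw [← sum_div]; linarith
  · have e : ∑ i, σ * (q / 400) * w i * squareNode D i ^ p
        = q / 400 * |∑ i, w i * squareNode D i ^ p| := by
      rw [← hσs, mul_sum, mul_sum]
      exact sum_congr rfl fun i _ => by ring
    rw [e]
    refine le_trans ?_ (mul_le_mul_of_nonneg_left hgap (by positivity))
    have hP := prod_one_add_squareNode_le D
    have hPpos : 0 < ∏ i ∈ univ.erase (Sum.inr 0), (1 + squareNode D i) :=
      prod_pos fun i _ => by linarith [squareNode_nonneg D i]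
    have hinv := inv_anti₀ hPpos hP
    have hf : (0 : ℝ) < (D.factorial : ℝ) ^ 2 := by positivity
    calc C / (3200 * Real.exp 2)
        = q / 400 * (C * (4⁻¹ * (12 * Real.exp 2 * (D.factorial : ℝ) ^ 2)⁻¹)) := by
          rw [hq]; field_simp; norm_num
      _ ≤ _ := by gcongr

open Finset in
/-- Two probability weights on the nodes with equal moments up to order `D`, means at most one, and
`p`-th moments separated uniformly in `D`. -/
theorem exists_moment_matching {p : ℝ} (hp : p ∈ Set.Ioo (1 : ℝ) 2) :
    ∃ c : ℝ, 0 < c ∧ ∀ D : ℕ, 2 ≤ D → ∃ μ₀ μ₁ : Bool ⊕ Fin (D + 1) → ℝ,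
      ((∀ i, 0 ≤ μ₀ i) ∧ ∑ i, μ₀ i = 1 ∧ ∑ i, μ₀ i * squareNode D i ≤ 1) ∧
      ((∀ i, 0 ≤ μ₁ i) ∧ ∑ i, μ₁ i = 1 ∧ ∑ i, μ₁ i * squareNode D i ≤ 1) ∧
      (∀ j ≤ D, ∑ i, (μ₁ i - μ₀ i) * squareNode D i ^ j = 0) ∧
      c ≤ ∑ i, (μ₁ i - μ₀ i) * squareNode D i ^ p := by
  obtain ⟨c, hc, h⟩ := exists_signed_weights hp
  refine ⟨c, hc, fun D hD => ?_⟩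
  obtain ⟨τ, hmom, hmass, hfirst, hgap⟩ := h D hD
  let pad (f : Bool ⊕ Fin (D + 1) → ℝ) (i : Bool ⊕ Fin (D + 1)) : ℝ :=
    f i + if i = Sum.inr 0 then 1 - ∑ j, f j else 0
  have hpad : ∀ f : Bool ⊕ Fin (D + 1) → ℝ, (∀ i, 0 ≤ f i) → (∀ i, f i ≤ |τ i|) →
      (∀ i, 0 ≤ pad f i) ∧ ∑ i, pad f i = 1 ∧ ∑ i, pad f i * squareNode D i ≤ 1 := by
    intro f hf0 hfτ
    refine ⟨fun i => ?_, ?_, ?_⟩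
    · have : ∑ j, f j ≤ 1 := (sum_le_sum fun j _ => hfτ j).trans hmass
      have := hf0 i
      simp only [pad]
      split_ifs <;> linarith
    · simp [pad, sum_add_distrib]
    · refine le_trans (sum_le_sum fun i _ => ?_) hfirst
      have h0 := squareNode_nonneg D i
      simp only [pad]
      split_ifs with hi
      · rw [hi]; simp [squareNode]
      · rw [add_zero]; exact mul_le_mul_of_nonneg_right (hfτ i) h0
  have hdiff : ∀ i, max (τ i) 0 - max (-τ i) 0 = τ i := fun i => by
    rcases le_total (τ i) 0 with h | h
    · rw [max_eq_right h, max_eq_left (by linarith)]; ring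
    · rw [max_eq_left h, max_eq_right (by linarith)]; ring
  have hsum : ∑ j, max (τ j) 0 = ∑ j, max (-τ j) 0 := by
    rw [← sub_eq_zero, ← sum_sub_distrib]
    simp_rw [hdiff]
    simpa using hmom 0 (Nat.zero_le _)
  have hpd : ∀ i, pad (fun i => max (τ i) 0) i - pad (fun i => max (-τ i) 0) i = τ i := fun i => by
    simp only [pad, hsum]
    rw [add_sub_add_right_eq_sub, hdiff]
  refine ⟨pad fun i => max (-τ i) 0, pad fun i => max (τ i) 0,
    hpad _ (fun i => le_max_right _ _) fun i => max_le (neg_le_abs _) (abs_nonneg _),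
    hpad _ (fun i => le_max_right _ _) fun i => max_le (le_abs_self _) (abs_nonneg _), ?_, ?_⟩
  · simp_rw [hpd]; exact hmom
  · simp_rw [hpd]; exact hgap

/-- `w` is a probability vector on the finite type `ι`. -/
def IsProbVec {ι : Type*} [Fintype ι] (w : ι → ℝ) : Prop :=
  (∀ a, 0 ≤ w a) ∧ ∑ a, w a = 1

/-- Expectation of `h` under the product of the weights `w i`. -/
noncomputable def prodExp {J ι : Type*} [Fintype J] [DecidableEq J] [Fintype ι] (w : J → ι → ℝ)
    (h : (J → ι) → ℝ) : ℝ :=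
  ∑ k, (∏ i, w i (k i)) * h k

section prodExp

open Finset

variable {J ι : Type*} [Fintype J] [DecidableEq J] [Fintype ι]

theorem prodExp_prod (w φ : J → ι → ℝ) :
    prodExp w (fun k => ∏ i, φ i (k i)) = ∏ i, ∑ a, w i a * φ i a := by
  rw [prodExp, Fintype.prod_sum]
  exact sum_congr rfl fun k _ => prod_mul_distrib.symm

theorem prodExp_const {w : J → ι → ℝ} (hw : ∀ i, IsProbVec (w i)) (c : ℝ) :
    prodExp w (fun _ => c) = c := by
  have h : ∑ k : J → ι, ∏ i, w i (k i) = 1 := by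
    rw [← Fintype.prod_sum]
    exact prod_eq_one fun i _ => (hw i).2
  rw [prodExp, ← sum_mul, h, one_mul]

theorem prodExp_mono {w : J → ι → ℝ} (hw : ∀ i, IsProbVec (w i)) {f g : (J → ι) → ℝ}
    (h : ∀ k, f k ≤ g k) : prodExp w f ≤ prodExp w g :=
  sum_le_sum fun k _ => mul_le_mul_of_nonneg_left (h k) (prod_nonneg fun i _ => (hw i).1 _)

theorem prodExp_add (w : J → ι → ℝ) (f g : (J → ι) → ℝ) :
    prodExp w (fun k => f k + g k) = prodExp w f + prodExp w g := by
  simp only [prodExp, mul_add, sum_add_distrib]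

theorem prodExp_sub (w : J → ι → ℝ) (f g : (J → ι) → ℝ) :
    prodExp w (fun k => f k - g k) = prodExp w f - prodExp w g := by
  simp only [prodExp, mul_sub, sum_sub_distrib]

theorem prodExp_const_mul (w : J → ι → ℝ) (c : ℝ) (f : (J → ι) → ℝ) :
    prodExp w (fun k => c * f k) = c * prodExp w f := by
  simp only [prodExp, mul_sum]
  exact sum_congr rfl fun k _ => by ring

theorem prodExp_sum {κ : Type*} (s : Finset κ) (w : J → ι → ℝ) (f : κ → (J → ι) → ℝ) :
    prodExp w (fun k => ∑ i ∈ s, f i k) = ∑ i ∈ s, prodExp w (f i) := by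
  simp only [prodExp, mul_sum]
  exact sum_comm

theorem abs_prodExp_le {w : J → ι → ℝ} (hw : ∀ i, IsProbVec (w i)) {f g : (J → ι) → ℝ}
    (h : ∀ k, |f k| ≤ g k) : |prodExp w f| ≤ prodExp w g := by
  refine (abs_sum_le_sum_abs _ _).trans (sum_le_sum fun k _ => ?_)
  have h0 : 0 ≤ ∏ i, w i (k i) := prod_nonneg fun i _ => (hw i).1 _
  rw [abs_mul, abs_of_nonneg h0]
  exact mul_le_mul_of_nonneg_left (h k) h0

/-- Replacing the `i`-th weight amounts to resampling the `i`-th coordinate. -/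
theorem prodExp_update {W : J → ι → ℝ} {i : J} (hi : ∑ a, W i a = 1) (w : ι → ℝ)
    (h : (J → ι) → ℝ) :
    prodExp (Function.update W i w) h
      = prodExp W (fun k => ∑ a, w a * h (Function.update k i a)) := by
  have hinv : Function.Involutive
      (fun x : (J → ι) × ι => (Function.update x.1 i x.2, x.1 i)) := fun x => by simp
  have hswap : ∀ G : (J → ι) → ι → ℝ,
      ∑ k, ∑ a, G (Function.update k i a) (k i) = ∑ k, ∑ a, G k a := fun G => by
    have h := Equiv.sum_comp hinv.toPerm (fun x : (J → ι) × ι => G x.1 x.2)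
    rw [Fintype.sum_prod_type, Fintype.sum_prod_type] at h
    exact h
  have hW : ∀ (V : J → ι → ℝ) (k : J → ι),
      ∏ j, V j (k j) = V i (k i) * ∏ j ∈ univ.erase i, V j (k j) := fun V k =>
    (mul_prod_erase univ (fun j => V j (k j)) (mem_univ i)).symm
  have hW' : ∀ k : J → ι, ∏ j ∈ univ.erase i, Function.update W i w j (k j)
      = ∏ j ∈ univ.erase i, W j (k j) := fun k =>
    prod_congr rfl fun j hj => by rw [Function.update_of_ne (ne_of_mem_erase hj)]
  have hk : ∀ (k : J → ι) (a : ι), ∏ j ∈ univ.erase i, W j (Function.update k i a j)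
      = ∏ j ∈ univ.erase i, W j (k j) := fun k a =>
    prod_congr rfl fun j hj => by rw [Function.update_of_ne (ne_of_mem_erase hj)]
  have h1 : prodExp (Function.update W i w) h
      = ∑ k, ∑ a, (W i a * (w (k i) * ∏ j ∈ univ.erase i, W j (k j))) * h k := by
    refine sum_congr rfl fun k _ => ?_
    rw [← sum_mul, ← sum_mul, hi, one_mul, hW, Function.update_self, hW']
  rw [h1, ← hswap, prodExp]
  refine sum_congr rfl fun k _ => ?_
  rw [mul_sum]
  refine sum_congr rfl fun a _ => ?_
  rw [hk, Function.update_self, hW]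
  ring

/-- Second moment of a centred sum of independent coordinates. -/
theorem prodExp_sq_sum_le {w : ι → ℝ} (hw : IsProbVec w) (f : ι → ℝ) :
    prodExp (fun _ : J => w) (fun k => (∑ i, f (k i) - Fintype.card J * ∑ a, w a * f a) ^ 2)
      ≤ Fintype.card J * ∑ a, w a * f a ^ 2 := by
  set m := ∑ a, w a * f a with hm
  have hc : ∑ a, w a * (f a - m) = 0 := by
    simp_rw [mul_sub]
    rw [sum_sub_distrib, ← sum_mul, hw.2, one_mul, hm, sub_self]
  have hvar : ∑ a, w a * (f a - m) ^ 2 ≤ ∑ a, w a * f a ^ 2 := by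
    have : ∑ a, w a * (f a - m) ^ 2 = ∑ a, w a * f a ^ 2 - m ^ 2 := by
      have e : ∀ a, w a * (f a - m) ^ 2 = w a * f a ^ 2 - 2 * m * (w a * f a) + m ^ 2 * w a :=
        fun a => by ring
      simp_rw [e]
      rw [sum_add_distrib, sum_sub_distrib, ← mul_sum, ← mul_sum, hw.2, ← hm]; ring
    nlinarith [sq_nonneg m]
  have hup : ∀ i : J, Function.update (fun _ : J => w) i w = fun _ => w := fun i =>
    Function.update_eq_self i _
  have hpair : ∀ i j : J, prodExp (fun _ : J => w) (fun k => (f (k i) - m) * (f (k j) - m))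
      = if i = j then ∑ a, w a * (f a - m) ^ 2 else 0 := by
    intro i j
    have h := prodExp_update (W := fun _ : J => w) (i := i) hw.2 w
      (fun k => (f (k i) - m) * (f (k j) - m))
    rw [hup] at h
    rw [h]
    split_ifs with hij
    · subst hij
      simp only [Function.update_self]
      rw [prodExp_const fun _ => hw]
      exact sum_congr rfl fun a _ => by ring
    · simp only [Function.update_self, Function.update_of_ne (Ne.symm hij)]
      have e : ∀ k : J → ι, ∑ a, w a * ((f a - m) * (f (k j) - m)) = 0 := fun k => by
        simp_rw [← mul_assoc]
        rw [← sum_mul, hc, zero_mul]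
      simp_rw [e]
      exact prodExp_const (fun _ => hw) 0
  have hsq : ∀ k : J → ι, (∑ i, f (k i) - Fintype.card J * m) ^ 2
      = ∑ i, ∑ j, (f (k i) - m) * (f (k j) - m) := fun k => by
    rw [← sum_mul_sum, sum_sub_distrib, sum_const, card_univ, nsmul_eq_mul]; ring
  simp_rw [hsq]
  rw [prodExp_sum]
  simp_rw [prodExp_sum, hpair]
  simp only [sum_ite_eq, mem_univ, if_true, sum_const, card_univ, nsmul_eq_mul]
  gcongr

/-- Chebyshev's inequality for a sum of independent coordinates. -/
theorem prodExp_indicator_le {w : ι → ℝ} (hw : IsProbVec w) (f : ι → ℝ) {ε : ℝ} (hε : 0 < ε) :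
    prodExp (fun _ : J => w)
        (fun k => if |∑ i, f (k i) - Fintype.card J * ∑ a, w a * f a| ≤ ε then 0 else 1)
      ≤ Fintype.card J * (∑ a, w a * f a ^ 2) / ε ^ 2 := by
  rw [le_div_iff₀ (by positivity), mul_comm, ← prodExp_const_mul]
  refine (prodExp_mono (fun _ => hw) fun k => ?_).trans (prodExp_sq_sum_le hw f)
  split_ifs with h
  · rw [mul_zero]; positivity
  · rw [mul_one, ← sq_abs (_ - _)]
    push Not at h
    gcongr

/-- Replacing the weights one coordinate at a time. -/
theorem abs_prodExp_sub_prodExp_le {w₀ w₁ : ι → ℝ} (hw₀ : IsProbVec w₀) (hw₁ : IsProbVec w₁)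
    {h g : (J → ι) → ℝ} {ε : ℝ}
    (hg : ∀ i k, |∑ a, (w₁ a - w₀ a) * h (Function.update k i a)| ≤ g k)
    (hε : ∀ W : J → ι → ℝ, (∀ i, W i = w₀ ∨ W i = w₁) → prodExp W g ≤ ε) :
    |prodExp (fun _ => w₁) h - prodExp (fun _ => w₀) h| ≤ Fintype.card J * ε := by
  have key : ∀ s : Finset J, |prodExp (fun i => if i ∈ s then w₁ else w₀) h
      - prodExp (fun _ => w₀) h| ≤ s.card * ε := by
    intro s
    induction s using Finset.induction_on with
    | empty => simp
    | insert i s hi ih =>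
      set W : J → ι → ℝ := fun j => if j ∈ s then w₁ else w₀ with hW
      have hWi : W i = w₀ := by simp [hW, hi]
      have hWp : ∀ j, IsProbVec (W j) := fun j => by
        simp only [hW]; split_ifs <;> assumption
      have e1 : (fun j => if j ∈ insert i s then w₁ else w₀) = Function.update W i w₁ := by
        ext j : 1
        by_cases hj : j = i
        · subst hj; simp
        · simp [hW, hj]
      have e0 : W = Function.update W i w₀ := by rw [← hWi, Function.update_eq_self]
      have hstep : |prodExp (Function.update W i w₁) h - prodExp W h| ≤ ε := by
        nth_rewrite 2 [e0]
        rw [prodExp_update (hWp i).2, prodExp_update (hWp i).2, ← prodExp_sub]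
        refine (abs_prodExp_le hWp fun k => ?_).trans
          (hε W fun j => by simp only [hW]; split_ifs <;> simp)
        rw [← sum_sub_distrib]
        simp_rw [← sub_mul]
        exact hg i k
      rw [e1, card_insert_of_notMem hi]
      calc _ ≤ |prodExp (Function.update W i w₁) h - prodExp W h|
            + |prodExp W h - prodExp (fun _ => w₀) h| := abs_sub_le _ _ _
        _ ≤ ε + s.card * ε := add_le_add hstep ih
        _ = _ := by push_cast; ring
  simpa using key univ

end prodExp

open Finset in
/-- Mixtures over a parameter `v` of the probability of an event under `n` independent samples from
the affine family `a + v b` are close when the mixing weights share moments up to order `L`. -/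
theorem abs_sum_mul_prob_le {ι κ : Type*} [Fintype ι] [Fintype κ] {n L : ℕ}
    {a b : κ → ℝ} (ha : ∀ i, 0 ≤ a i) (hasum : ∑ i, a i = 1) (hb : ∑ i, |b i| ≤ 2)
    {τ v : ι → ℝ} {M t : ℝ} (hτ : ∑ k, |τ k| ≤ 2) (hv0 : ∀ k, 0 ≤ v k) (hvM : ∀ k, v k ≤ M)
    (hM : 0 ≤ M) (ht : 1 ≤ t) (hmom : ∀ j ≤ L, ∑ k, τ k * v k ^ j = 0)
    (A : Finset (Fin n → κ)) :
    |∑ k, τ k * ∑ x ∈ A, ∏ j, (a (x j) + v k * b (x j))|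
      ≤ 2 * (t ^ (L + 1))⁻¹ * Real.exp (2 * n * M * t) := by
  have ht0 : 0 < t := by linarith
  have hexp : ∑ k, τ k * ∑ x ∈ A, ∏ j, (a (x j) + v k * b (x j))
      = ∑ T : Finset (Fin n), (∑ k, τ k * v k ^ T.card) *
          ∑ x ∈ A, (∏ j ∈ T, b (x j)) * ∏ j ∈ Tᶜ, a (x j) := by
    have e : ∀ k (x : Fin n → κ), ∏ j, (a (x j) + v k * b (x j))
        = ∑ T : Finset (Fin n), v k ^ T.card * ((∏ j ∈ T, b (x j)) * ∏ j ∈ Tᶜ, a (x j)) := by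
      intro k x
      simp_rw [add_comm (a _)]
      rw [Fintype.prod_add]
      refine sum_congr rfl fun T _ => ?_
      rw [prod_mul_distrib, prod_const]; ring
    simp_rw [e]
    simp_rw [sum_comm (s := A), ← mul_sum]
    simp_rw [mul_sum (s := univ), sum_mul]
    rw [sum_comm]
    exact sum_congr rfl fun T _ => sum_congr rfl fun k _ => by ring
  have hmT : ∀ T : Finset (Fin n), |∑ k, τ k * v k ^ T.card|
      ≤ 2 * (t ^ (L + 1))⁻¹ * (M * t) ^ T.card := by
    intro T
    rcases Nat.lt_or_ge L T.card with h | h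
    · have h1 : |∑ k, τ k * v k ^ T.card| ≤ 2 * M ^ T.card := by
        calc |∑ k, τ k * v k ^ T.card| ≤ ∑ k, |τ k * v k ^ T.card| := abs_sum_le_sum_abs _ _
          _ ≤ ∑ k, |τ k| * M ^ T.card := by
            refine sum_le_sum fun k _ => ?_
            rw [abs_mul, abs_of_nonneg (pow_nonneg (hv0 k) _)]
            exact mul_le_mul_of_nonneg_left (pow_le_pow_left₀ (hv0 k) (hvM k) _) (abs_nonneg _)
          _ = (∑ k, |τ k|) * M ^ T.card := (sum_mul _ _ _).symm
          _ ≤ 2 * M ^ T.card := mul_le_mul_of_nonneg_right hτ (pow_nonneg hM _)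
      refine h1.trans ?_
      have h2 : t ^ (L + 1) ≤ t ^ T.card := pow_le_pow_right₀ ht h
      have h3 : 1 ≤ (t ^ (L + 1))⁻¹ * t ^ T.card := by
        rw [inv_mul_eq_div, le_div_iff₀ (by positivity), one_mul]; exact h2
      rw [mul_pow]
      nlinarith [pow_nonneg hM T.card, mul_le_mul_of_nonneg_left h3 (pow_nonneg hM T.card)]
    · rw [hmom _ h, abs_zero]; positivity
  have hxT : ∀ T : Finset (Fin n),
      |∑ x ∈ A, (∏ j ∈ T, b (x j)) * ∏ j ∈ Tᶜ, a (x j)| ≤ 2 ^ T.card := by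
    intro T
    have e : ∀ x : Fin n → κ, |(∏ j ∈ T, b (x j)) * ∏ j ∈ Tᶜ, a (x j)|
        = ∏ j, (if j ∈ T then |b (x j)| else a (x j)) := fun x => by
      rw [abs_mul, abs_prod, abs_of_nonneg (prod_nonneg fun j _ => ha _),
        ← prod_mul_prod_compl T (fun j => if j ∈ T then |b (x j)| else a (x j))]
      congr 1
      · exact prod_congr rfl fun j hj => by rw [if_pos hj]
      · exact prod_congr rfl fun j hj => by rw [if_neg (mem_compl.1 hj)]
    refine (abs_sum_le_sum_abs _ _).trans ?_
    simp_rw [e]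
    calc ∑ x ∈ A, ∏ j, (if j ∈ T then |b (x j)| else a (x j))
        ≤ ∑ x : Fin n → κ, ∏ j, (if j ∈ T then |b (x j)| else a (x j)) :=
          sum_le_sum_of_subset_of_nonneg (subset_univ _) fun x _ _ =>
            prod_nonneg fun j _ => by split_ifs; exacts [abs_nonneg _, ha _]
      _ = ∏ j : Fin n, ∑ i, (if j ∈ T then |b i| else a i) :=
          (Fintype.prod_sum fun (j : Fin n) i => if j ∈ T then |b i| else a i).symm
      _ ≤ ∏ j : Fin n, (if j ∈ T then 2 else 1) := by
          refine prod_le_prod (fun j _ => sum_nonneg fun i _ => ?_) fun j _ => ?_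
          · split_ifs; exacts [abs_nonneg _, ha _]
          · split_ifs; exacts [hb, hasum.le]
      _ = 2 ^ T.card := by
          rw [prod_ite_mem, univ_inter, prod_const]
  rw [hexp]
  refine (abs_sum_le_sum_abs _ _).trans ?_
  calc ∑ T : Finset (Fin n), |(∑ k, τ k * v k ^ T.card) *
          ∑ x ∈ A, (∏ j ∈ T, b (x j)) * ∏ j ∈ Tᶜ, a (x j)|
      ≤ ∑ T : Finset (Fin n), (2 * (t ^ (L + 1))⁻¹ * (M * t) ^ T.card) * 2 ^ T.card := by
        refine sum_le_sum fun T _ => ?_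
        rw [abs_mul]
        exact mul_le_mul (hmT T) (hxT T) (abs_nonneg _) (by positivity)
    _ = 2 * (t ^ (L + 1))⁻¹ * (2 * M * t + 1) ^ n := by
        have := sum_pow_mul_eq_add_pow (2 * M * t) 1 (univ : Finset (Fin n))
        rw [card_univ, Fintype.card_fin, powerset_univ] at this
        rw [← this, mul_sum]
        refine sum_congr rfl fun T _ => ?_
        rw [one_pow, mul_one, mul_assoc, ← mul_pow]
        ring
    _ ≤ 2 * (t ^ (L + 1))⁻¹ * Real.exp (2 * n * M * t) := by
        have h1 : (2 * M * t + 1) ^ n ≤ Real.exp (2 * M * t) ^ n :=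
          pow_le_pow_left₀ (by positivity) (Real.add_one_le_exp _) n
        rw [← Real.exp_nat_mul] at h1
        have h2 : (n : ℝ) * (2 * M * t) = 2 * n * M * t := by ring
        rw [h2] at h1
        gcongr

/-- The vector whose last `N` coordinates are `v (k i)`, completed by its first coordinate to have
total mass one. -/
noncomputable def completedVec {ι : Type*} {N : ℕ} (v : ι → ℝ) (k : Fin N → ι) :
    Fin (N + 1) → ℝ :=
  Fin.cons (1 - ∑ i, v (k i)) fun i => v (k i)

theorem completedVec_mem_simplex {ι : Type*} {N : ℕ} {v : ι → ℝ} (hv : ∀ a, 0 ≤ v a)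
    {k : Fin N → ι} (hk : ∑ i, v (k i) ≤ 1) : completedVec v k ∈ simplex (N + 1) := by
  refine ⟨fun i => ?_, ?_⟩
  · induction i using Fin.cases with
    | zero => simpa [completedVec] using hk
    | succ i => simpa [completedVec] using hv _
  · simp [completedVec, Fin.sum_univ_succ]

theorem multPMF_nonneg {S n : ℕ} {P : Fin S → ℝ} (hP : P ∈ simplex S) (x : Fin n → Fin S) :
    0 ≤ multPMF S n P x :=
  Finset.prod_nonneg fun _ _ => hP.1 _

theorem sum_multPMF {S n : ℕ} {P : Fin S → ℝ} (hP : P ∈ simplex S) :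
    ∑ x, multPMF S n P x = 1 := by
  simp only [multPMF]
  rw [← Fintype.prod_sum (fun (_ : Fin n) i => P i)]
  exact Finset.prod_eq_one fun _ _ => hP.2

theorem sum_multPMF_le_one {S n : ℕ} {P : Fin S → ℝ} (hP : P ∈ simplex S)
    (A : Finset (Fin n → Fin S)) : ∑ x ∈ A, multPMF S n P x ≤ 1 := by
  rw [← sum_multPMF hP]
  exact Finset.sum_le_sum_of_subset_of_nonneg (Finset.subset_univ _)
    fun x _ _ => multPMF_nonneg hP x

/-- Markov's inequality for the squared error. -/
theorem sum_multPMF_mul_sq_le {S n : ℕ} {P : Fin S → ℝ} (hP : P ∈ simplex S) {t R d : ℝ}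
    (hR : 0 ≤ R) {est : (Fin n → Fin S) → ℝ} (hrisk : multRisk S n P t est ≤ ENNReal.ofReal R)
    {A : Finset (Fin n → Fin S)} (hd : 0 ≤ d) (hA : ∀ x ∈ A, d ≤ |est x - t|) :
    (∑ x ∈ A, multPMF S n P x) * d ^ 2 ≤ R := by
  have h0 : ∀ x, 0 ≤ multPMF S n P x * (est x - t) ^ 2 := fun x =>
    mul_nonneg (multPMF_nonneg hP x) (sq_nonneg _)
  rw [multRisk, tsum_fintype, ← ENNReal.ofReal_sum_of_nonneg fun x _ => h0 x,
    ENNReal.ofReal_le_ofReal_iff hR] at hrisk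
  refine le_trans ?_ hrisk
  rw [Finset.sum_mul]
  refine (Finset.sum_le_sum fun x hx => ?_).trans
    (Finset.sum_le_sum_of_subset_of_nonneg (Finset.subset_univ A) fun x _ _ => h0 x)
  rw [← sq_abs (est x - t)]
  exact mul_le_mul_of_nonneg_left (pow_le_pow_left₀ hd (hA x hx) 2) (multPMF_nonneg hP x)

/-- Probability of the event `A` under `n` samples from `completedVec v k`, or zero if that vector
is not a probability vector. -/
noncomputable def completedProb {ι : Type*} {N n : ℕ} (v : ι → ℝ)
    (A : Finset (Fin n → Fin (N + 1))) (k : Fin N → ι) : ℝ :=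
  open Classical in
  if ∑ i, v (k i) ≤ 1 then ∑ x ∈ A, multPMF (N + 1) n (completedVec v k) x else 0

theorem completedProb_mem_Icc {ι : Type*} {N n : ℕ} {v : ι → ℝ} (hv : ∀ a, 0 ≤ v a)
    (A : Finset (Fin n → Fin (N + 1))) (k : Fin N → ι) :
    completedProb v A k ∈ Set.Icc (0 : ℝ) 1 := by
  rw [completedProb]
  split_ifs with h
  · have hP := completedVec_mem_simplex hv h
    exact ⟨Finset.sum_nonneg fun x _ => multPMF_nonneg hP x, sum_multPMF_le_one hP A⟩
  · simp

/-- On `[0, 1]`, the power `x ^ α` with `1 ≤ α ≤ 2` is `2`-Lipschitz. -/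
theorem abs_rpow_sub_rpow_le_s4 {α x y : ℝ} (hα : 1 ≤ α) (hα2 : α ≤ 2) (hx : x ∈ Set.Icc (0 : ℝ) 1)
    (hy : y ∈ Set.Icc (0 : ℝ) 1) : |x ^ α - y ^ α| ≤ 2 * |x - y| := by
  have := Convex.norm_image_sub_le_of_norm_hasDerivWithin_le (f := fun x : ℝ => x ^ α)
    (f' := fun x => α * x ^ (α - 1)) (s := Set.Icc (0 : ℝ) 1) (C := 2)
    (fun z _ => (Real.hasDerivAt_rpow_const (Or.inr hα)).hasDerivWithinAt) (fun z hz => ?_)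
    (convex_Icc _ _) hy hx
  · simpa using this
  · have h1 : z ^ (α - 1) ≤ 1 := Real.rpow_le_one hz.1 hz.2 (by linarith)
    have h0 : 0 ≤ z ^ (α - 1) := Real.rpow_nonneg hz.1 _
    rw [Real.norm_eq_abs, abs_of_nonneg (by positivity)]
    nlinarith

/-- The power sum of `completedVec v k` in terms of typical values of the sums it involves. -/
theorem abs_Falpha_completedVec_sub_le {ι : Type*} {v : ι → ℝ} {α : ℝ} (hα : 1 ≤ α)
    (hα2 : α ≤ 2) (hv : ∀ a, 0 ≤ v a) {N : ℕ} {m q Δ : ℝ} (hm : m ≤ 1 / 8) (hm0 : 0 ≤ m)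
    (hΔ : Δ ≤ 1) {k : Fin N → ι}
    (h1 : |∑ i, v (k i) - m| ≤ Δ / 16) (h2 : |∑ i, v (k i) ^ α - q| ≤ Δ / 8) :
    ∑ i, v (k i) ≤ 1 ∧
      |Falpha (N + 1) α (completedVec v k) - ((1 - m) ^ α + q)| ≤ Δ / 4 := by
  have hs0 : 0 ≤ ∑ i, v (k i) := Finset.sum_nonneg fun i _ => hv _
  have hs1 : ∑ i, v (k i) ≤ 1 := by linarith [le_abs_self (∑ i, v (k i) - m)]
  refine ⟨hs1, ?_⟩
  have h3 := abs_rpow_sub_rpow_le_s4 (x := 1 - ∑ i, v (k i)) (y := 1 - m) hα hα2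
    ⟨by linarith, by linarith⟩ ⟨by linarith, by linarith⟩
  have e : 1 - ∑ i, v (k i) - (1 - m) = -(∑ i, v (k i) - m) := by ring
  rw [e, abs_neg] at h3
  have hF : Falpha (N + 1) α (completedVec v k)
      = (1 - ∑ i, v (k i)) ^ α + ∑ i, v (k i) ^ α := by
    simp [Falpha, completedVec, Fin.sum_univ_succ]
  rw [hF, add_sub_add_comm]
  linarith [abs_add_le ((1 - ∑ i, v (k i)) ^ α - (1 - m) ^ α) (∑ i, v (k i) ^ α - q)]

section

open Finset

variable {ι : Type*} [Fintype ι] {v : ι → ℝ} {M : ℝ}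

theorem IsProbVec.sum_abs_sub_le {w₀ w₁ : ι → ℝ} (h₀ : IsProbVec w₀) (h₁ : IsProbVec w₁) :
    ∑ a, |w₁ a - w₀ a| ≤ 2 := by
  calc ∑ a, |w₁ a - w₀ a| ≤ ∑ a, (w₁ a + w₀ a) := sum_le_sum fun a _ => by
        rw [abs_le]; constructor <;> linarith [h₀.1 a, h₁.1 a]
    _ = 2 := by rw [sum_add_distrib, h₀.2, h₁.2]; norm_num

/-- Effect on the probability of an event of mixing a single coordinate. -/
theorem abs_sum_mul_completedProb_update_le (hv : ∀ a, 0 ≤ v a) (hvM : ∀ a, v a ≤ M)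
    (hM0 : 0 < M) (hM : M ≤ 1 / 2) {w₀ w₁ : ι → ℝ} (h₀ : IsProbVec w₀) (h₁ : IsProbVec w₁)
    {L : ℕ} (hmom : ∀ j ≤ L, ∑ a, (w₁ a - w₀ a) * v a ^ j = 0) {t : ℝ} (ht : 1 ≤ t) {N n : ℕ}
    (A : Finset (Fin n → Fin (N + 1))) (i : Fin N) (k : Fin N → ι) :
    |∑ a, (w₁ a - w₀ a) * completedProb v A (Function.update k i a)|
      ≤ 2 * (t ^ (L + 1))⁻¹ * Real.exp (2 * n * M * t)
        + 2 * Real.exp ((∑ j, v (k j) - 1 / 2) / M) := by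
  have hδ : 0 ≤ 2 * (t ^ (L + 1))⁻¹ * Real.exp (2 * n * M * t) := by positivity
  set s := ∑ j ∈ univ.erase i, v (k j) with hs
  have hs0 : 0 ≤ s := sum_nonneg fun j _ => hv _
  have hsum : ∀ a, ∑ j, v (Function.update k i a j) = s + v a := fun a => by
    rw [← sum_erase_add univ _ (mem_univ i), Function.update_self, hs]
    congr 1
    exact sum_congr rfl fun j hj => by rw [Function.update_of_ne (ne_of_mem_erase hj)]
  rcases le_or_gt s (1 / 2) with h | h
  · set p : Fin (N + 1) → ℝ := Fin.cons (1 - s) fun j => if j = i then 0 else v (k j) with hp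
    set q : Fin (N + 1) → ℝ := Fin.cons (-1) (Pi.single i 1) with hq
    have hvec : ∀ a, completedVec v (Function.update k i a) = fun l => p l + v a * q l := by
      intro a
      ext l
      induction l using Fin.cases with
      | zero => simp only [completedVec, hp, hq, Fin.cons_zero, hsum]; ring
      | succ j =>
        simp only [completedVec, hp, hq, Fin.cons_succ]
        by_cases hj : j = i
        · subst hj; simp
        · simp [hj]
    have hprob : ∀ a, completedProb v A (Function.update k i a)
        = ∑ x ∈ A, ∏ j, (p (x j) + v a * q (x j)) := fun a => by
      rw [completedProb, if_pos (by rw [hsum]; linarith [hvM a]), hvec]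
      rfl
    simp_rw [hprob]
    refine (abs_sum_mul_prob_le (L := L) (fun l => ?_) ?_ ?_ (h₀.sum_abs_sub_le h₁) hv hvM hM0.le
      ht hmom A).trans (le_add_of_nonneg_right (by positivity))
    · induction l using Fin.cases with
      | zero => simp only [hp, Fin.cons_zero]; linarith
      | succ j => simp only [hp, Fin.cons_succ]; split_ifs; exacts [le_rfl, hv _]
    · rw [Fin.sum_univ_succ]
      simp only [hp, Fin.cons_zero, Fin.cons_succ]
      have : ∑ j, (if j = i then 0 else v (k j)) = s := by
        rw [← sum_erase_add univ _ (mem_univ i), if_pos rfl, add_zero, hs]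
        exact sum_congr rfl fun j hj => if_neg (ne_of_mem_erase hj)
      rw [this]; ring
    · rw [Fin.sum_univ_succ]
      simp only [hq, Fin.cons_zero, Fin.cons_succ]
      have : ∑ j, |(Pi.single i (1 : ℝ) : Fin N → ℝ) j| = 1 := by
        rw [sum_eq_single i]
        · simp
        · intro j _ hj; simp [hj]
        · simp
      rw [this]; norm_num
  · have h1 : |∑ a, (w₁ a - w₀ a) * completedProb v A (Function.update k i a)| ≤ 2 := by
      refine (abs_sum_le_sum_abs _ _).trans ((sum_le_sum fun a _ => ?_).trans
        (h₀.sum_abs_sub_le h₁))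
      have := completedProb_mem_Icc hv A (Function.update k i a)
      rw [abs_mul, abs_of_nonneg this.1]
      exact mul_le_of_le_one_right (abs_nonneg _) this.2
    have h2 : s ≤ ∑ j, v (k j) := sum_le_sum_of_subset_of_nonneg (erase_subset _ _)
      fun j _ _ => hv _
    have h3 : 1 ≤ Real.exp ((∑ j, v (k j) - 1 / 2) / M) :=
      Real.one_le_exp (div_nonneg (by linarith) hM0.le)
    linarith

/-- Chernoff bound for sums of independent coordinates with values in `[0, M]`. -/
theorem prodExp_exp_le (hv : ∀ a, 0 ≤ v a) (hvM : ∀ a, v a ≤ M) (hM0 : 0 < M) {N : ℕ} {m : ℝ}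
    (hm : N * m ≤ 1 / 8) {W : Fin N → ι → ℝ} (hW : ∀ i, IsProbVec (W i))
    (hmean : ∀ i, ∑ a, W i a * v a ≤ m) :
    prodExp W (fun k => Real.exp ((∑ j, v (k j) - 1 / 2) / M)) ≤ Real.exp (-(1 / (4 * M))) := by
  have hx : ∀ x : ℝ, 0 ≤ x → x ≤ 1 → Real.exp x ≤ 1 + 2 * x := fun x h0 h1 => by
    have := Real.abs_exp_sub_one_le (x := x) (by rwa [abs_of_nonneg h0])
    rw [abs_of_nonneg h0] at this
    linarith [le_abs_self (Real.exp x - 1)]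
  have e : ∀ k : Fin N → ι, Real.exp ((∑ j, v (k j) - 1 / 2) / M)
      = Real.exp (-(1 / (2 * M))) * ∏ j, Real.exp (v (k j) / M) := fun k => by
    rw [← Real.exp_sum, ← Real.exp_add, ← sum_div]
    congr 1
    field_simp
    ring
  simp_rw [e]
  rw [prodExp_const_mul, prodExp_prod W fun _ a => Real.exp (v a / M)]
  have h1 : ∀ i, ∑ a, W i a * Real.exp (v a / M) ≤ Real.exp (2 * m / M) := fun i => by
    calc ∑ a, W i a * Real.exp (v a / M) ≤ ∑ a, W i a * (1 + 2 * (v a / M)) :=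
          sum_le_sum fun a _ => mul_le_mul_of_nonneg_left
            (hx _ (div_nonneg (hv a) hM0.le) ((div_le_one hM0).2 (hvM a))) ((hW i).1 a)
      _ = ∑ a, W i a + 2 / M * ∑ a, W i a * v a := by
          rw [mul_sum, ← sum_add_distrib]
          exact sum_congr rfl fun a _ => by ring
      _ ≤ 2 * m / M + 1 := by
          have := mul_le_mul_of_nonneg_left (hmean i) (show 0 ≤ 2 / M by positivity)
          have e2 : 2 / M * m = 2 * m / M := by ring
          linarith [(hW i).2]
      _ ≤ _ := Real.add_one_le_exp _
  calc Real.exp (-(1 / (2 * M))) * ∏ i, ∑ a, W i a * Real.exp (v a / M)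
      ≤ Real.exp (-(1 / (2 * M))) * ∏ _i : Fin N, Real.exp (2 * m / M) :=
        mul_le_mul_of_nonneg_left (prod_le_prod (fun i _ => sum_nonneg fun a _ =>
          mul_nonneg ((hW i).1 a) (Real.exp_pos _).le) fun i _ => h1 i) (Real.exp_pos _).le
    _ = Real.exp (-(1 / (2 * M)) + N * (2 * m / M)) := by
        rw [prod_const, card_univ, Fintype.card_fin, ← Real.exp_nat_mul, ← Real.exp_add]
    _ ≤ _ := by
        refine Real.exp_le_exp.2 ?_
        have : -(1 / (2 * M)) + N * (2 * m / M) = -(1 / (4 * M)) + (2 * (N * m) - 1 / 4) / M := by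
          field_simp; ring
        rw [this]
        have : (2 * (N * m) - 1 / 4) / M ≤ 0 :=
          div_nonpos_of_nonpos_of_nonneg (by linarith) hM0.le
        linarith

/-- The mixtures of the laws of `n` samples over two priors with matching moments are close. -/
theorem abs_prodExp_completedProb_sub_le (hv : ∀ a, 0 ≤ v a) (hvM : ∀ a, v a ≤ M) (hM0 : 0 < M)
    (hM : M ≤ 1 / 2) {w₀ w₁ : ι → ℝ} (h₀ : IsProbVec w₀) (h₁ : IsProbVec w₁) {N n : ℕ} {m : ℝ}
    (hm : N * m ≤ 1 / 8) (hm₀ : ∑ a, w₀ a * v a ≤ m) (hm₁ : ∑ a, w₁ a * v a ≤ m) {L : ℕ}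
    (hmom : ∀ j ≤ L, ∑ a, (w₁ a - w₀ a) * v a ^ j = 0) {t : ℝ} (ht : 1 ≤ t)
    (A : Finset (Fin n → Fin (N + 1))) :
    |prodExp (fun _ => w₁) (completedProb v A) - prodExp (fun _ => w₀) (completedProb v A)|
      ≤ N * (2 * (t ^ (L + 1))⁻¹ * Real.exp (2 * n * M * t)
        + 2 * Real.exp (-(1 / (4 * M)))) := by
  have := abs_prodExp_sub_prodExp_le (J := Fin N) h₀ h₁ (h := completedProb v A)
    (abs_sum_mul_completedProb_update_le hv hvM hM0 hM h₀ h₁ hmom ht A)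
    (ε := 2 * (t ^ (L + 1))⁻¹ * Real.exp (2 * n * M * t) + 2 * Real.exp (-(1 / (4 * M)))) ?_
  · rwa [Fintype.card_fin] at this
  · intro W hW
    have hWp : ∀ i, IsProbVec (W i) := fun i => by rcases hW i with h | h <;> rw [h] <;> assumption
    have hWm : ∀ i, ∑ a, W i a * v a ≤ m := fun i => by
      rcases hW i with h | h <;> rw [h] <;> assumption
    rw [prodExp_add, prodExp_const hWp, prodExp_const_mul]
    have := prodExp_exp_le hv hvM hM0 hm hWp hWm
    linarith

open Classical in
/-- The random vector `completedVec` has atypical mass or power sum with probability at most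
`1 / 4`. -/
theorem prodExp_bad_le {α : ℝ} (hα : 1 ≤ α) (hv : ∀ a, 0 ≤ v a)
    (hvM : ∀ a, v a ≤ M) (hM0 : 0 < M) (hM : M ≤ 1 / 2) {w : ι → ℝ} (hw : IsProbVec w) {N : ℕ}
    (hm : N * ∑ a, w a * v a ≤ 1 / 8) {Δ : ℝ} (hΔ0 : 0 < Δ) (hMΔ : 160 * M ≤ Δ ^ 2) :
    prodExp (fun _ : Fin N => w) (fun k =>
        (if |∑ i, v (k i) - N * ∑ a, w a * v a| ≤ Δ / 16 then 0 else 1)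
        + (if |∑ i, v (k i) ^ α - N * ∑ a, w a * v a ^ α| ≤ Δ / 8 then 0 else 1)) ≤ 1 / 4 := by
  have hsq : N * ∑ a, w a * v a ^ 2 ≤ M / 8 := by
    have : ∑ a, w a * v a ^ 2 ≤ M * ∑ a, w a * v a := by
      rw [mul_sum]
      refine sum_le_sum fun a _ => ?_
      nlinarith [mul_nonneg (mul_nonneg (hw.1 a) (hv a)) (sub_nonneg.2 (hvM a))]
    calc N * ∑ a, w a * v a ^ 2 ≤ N * (M * ∑ a, w a * v a) := by gcongr
      _ = M * (N * ∑ a, w a * v a) := by ring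
      _ ≤ M * (1 / 8) := by gcongr
      _ = M / 8 := by ring
  have hsqα : N * ∑ a, w a * (v a ^ α) ^ 2 ≤ M / 8 := by
    refine le_trans ?_ hsq
    refine mul_le_mul_of_nonneg_left (sum_le_sum fun a _ => ?_) (Nat.cast_nonneg _)
    refine mul_le_mul_of_nonneg_left (pow_le_pow_left₀ (Real.rpow_nonneg (hv a) _) ?_ 2) (hw.1 a)
    simpa using Real.rpow_le_rpow_of_exponent_ge' (hv a) ((hvM a).trans (by linarith))
      zero_le_one hα
  have c1 := prodExp_indicator_le (J := Fin N) hw v (ε := Δ / 16) (by positivity)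
  have c2 := prodExp_indicator_le (J := Fin N) hw (fun a => v a ^ α) (ε := Δ / 8) (by positivity)
  rw [Fintype.card_fin] at c1 c2
  have d1 : (N * ∑ a, w a * v a ^ 2) / (Δ / 16) ^ 2 ≤ 1 / 5 := by
    rw [div_le_iff₀ (by positivity)]; linarith
  have d2 : (N * ∑ a, w a * (v a ^ α) ^ 2) / (Δ / 8) ^ 2 ≤ 1 / 20 := by
    rw [div_le_iff₀ (by positivity)]; linarith
  rw [prodExp_add]
  linarith

open Classical in
/-- Two-prior lower bound for the minimax risk of the power sum. -/
theorem ofReal_le_multMinimax_Falpha {α : ℝ} (hα : 1 ≤ α) (hα2 : α ≤ 2) (hv : ∀ a, 0 ≤ v a)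
    (hvM : ∀ a, v a ≤ M) (hM0 : 0 < M) (hM : M ≤ 1 / 2) {w₀ w₁ : ι → ℝ} (h₀ : IsProbVec w₀)
    (h₁ : IsProbVec w₁) {N n : ℕ} {m : ℝ} (hm : N * m ≤ 1 / 8) (hm₀ : ∑ a, w₀ a * v a ≤ m)
    (hm₁ : ∑ a, w₁ a * v a ≤ m) {L : ℕ} (hL : 1 ≤ L)
    (hmom : ∀ j ≤ L, ∑ a, (w₁ a - w₀ a) * v a ^ j = 0) {t : ℝ} (ht : 1 ≤ t) {Δ : ℝ} (hΔ0 : 0 < Δ)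
    (hΔ : Δ ≤ 1) (hMΔ : 160 * M ≤ Δ ^ 2) (hgap : Δ ≤ N * ∑ a, (w₁ a - w₀ a) * v a ^ α)
    (hclose : N * (2 * (t ^ (L + 1))⁻¹ * Real.exp (2 * n * M * t)
        + 2 * Real.exp (-(1 / (4 * M)))) ≤ 1 / 4) :
    ENNReal.ofReal (Δ ^ 2 / 256) ≤ multMinimax (N + 1) n (Falpha (N + 1) α) := by
  refine le_iInf fun est => ?_
  by_contra! hlt
  have hrisk : ∀ P ∈ simplex (N + 1),
      multRisk (N + 1) n P (Falpha (N + 1) α P) est ≤ ENNReal.ofReal (Δ ^ 2 / 256) := fun P hP =>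
    (le_iSup₂ (f := fun P (_ : P ∈ simplex (N + 1)) =>
      multRisk (N + 1) n P (Falpha (N + 1) α P) est) P hP).trans hlt.le
  have hN0 : (0 : ℝ) ≤ N := Nat.cast_nonneg _
  have hme : ∑ a, w₁ a * v a = ∑ a, w₀ a * v a := by
    have := hmom 1 hL
    simp only [pow_one, sub_mul, sum_sub_distrib] at this
    linarith
  have hm8 : N * ∑ a, w₀ a * v a ≤ 1 / 8 := (mul_le_mul_of_nonneg_left hm₀ hN0).trans hm
  have hm8' : N * ∑ a, w₁ a * v a ≤ 1 / 8 := (mul_le_mul_of_nonneg_left hm₁ hN0).trans hm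
  have hm0 : 0 ≤ N * ∑ a, w₀ a * v a :=
    mul_nonneg hN0 (sum_nonneg fun a _ => mul_nonneg (h₀.1 a) (hv a))
  set f₀ := (1 - N * ∑ a, w₀ a * v a) ^ α + N * ∑ a, w₀ a * v a ^ α with hf₀
  set f₁ := (1 - N * ∑ a, w₁ a * v a) ^ α + N * ∑ a, w₁ a * v a ^ α with hf₁
  have hf : Δ ≤ f₁ - f₀ := by
    have : f₁ - f₀ = N * ∑ a, (w₁ a - w₀ a) * v a ^ α := by
      simp only [hf₁, hf₀, hme, sub_mul, sum_sub_distrib]; ring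
    rwa [this]
  set A : Finset (Fin n → Fin (N + 1)) := univ.filter fun x => (f₀ + f₁) / 2 < est x with hA
  have hR : 0 ≤ Δ ^ 2 / 256 := by positivity
  have hb₀ := prodExp_bad_le hα hv hvM hM0 hM h₀ hm8 hΔ0 hMΔ
  have hb₁ := prodExp_bad_le hα hv hvM hM0 hM h₁ hm8' hΔ0 hMΔ
  have hE₀ : prodExp (fun _ : Fin N => w₀) (completedProb v A) ≤ 1 / 16 + 1 / 4 := by
    refine le_trans ?_ (add_le_add_right hb₀ (1 / 16))
    rw [← prodExp_const (w := fun _ : Fin N => w₀) (fun _ => h₀) (1 / 16), ← prodExp_add]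
    refine prodExp_mono (fun _ => h₀) fun k => ?_
    have hc := completedProb_mem_Icc hv A k
    split_ifs with i1 i2 i2
    · obtain ⟨hs, hF⟩ := abs_Falpha_completedVec_sub_le hα hα2 hv hm8 hm0 hΔ i1 i2
      have hP := completedVec_mem_simplex hv hs
      have := sum_multPMF_mul_sq_le hP hR (hrisk _ hP) (A := A) (d := Δ / 4) (by positivity)
        fun x hx => by
          have hx := (mem_filter.1 hx).2
          have := (abs_le.1 hF).2
          rw [← hf₀] at this
          exact le_trans (by linarith) (le_abs_self _)
      rw [completedProb, if_pos hs]
      have hΔ2 : 0 < Δ ^ 2 := by positivity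
      nlinarith
    all_goals linarith [hc.2]
  have hE₁ : 15 / 16 - 1 / 4 ≤ prodExp (fun _ : Fin N => w₁) (completedProb v A) := by
    refine (sub_le_sub_left hb₁ (15 / 16)).trans ?_
    rw [← prodExp_const (w := fun _ : Fin N => w₁) (fun _ => h₁) (15 / 16), ← prodExp_sub]
    refine prodExp_mono (fun _ => h₁) fun k => ?_
    have hc := completedProb_mem_Icc hv A k
    split_ifs with i1 i2 i2
    · obtain ⟨hs, hF⟩ := abs_Falpha_completedVec_sub_le hα hα2 hv hm8' (hme ▸ hm0) hΔ i1 i2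
      have hP := completedVec_mem_simplex hv hs
      have := sum_multPMF_mul_sq_le hP hR (hrisk _ hP) (A := Aᶜ) (d := Δ / 4) (by positivity)
        fun x hx => by
          have hx : est x ≤ (f₀ + f₁) / 2 := by simpa [hA] using hx
          have := (abs_le.1 hF).1
          rw [← hf₁] at this
          exact le_trans (by linarith) (neg_le_abs _)
      have htot := sum_multPMF (n := n) hP
      rw [← sum_add_sum_compl A] at htot
      rw [completedProb, if_pos hs]
      have hΔ2 : 0 < Δ ^ 2 := by positivity
      nlinarith
    all_goals linarith [hc.1]
  have := abs_prodExp_completedProb_sub_le hv hvM hM0 hM h₀ h₁ hm hm₀ hm₁ hmom ht A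
  linarith [le_abs_self (prodExp (fun _ : Fin N => w₁) (completedProb v A)
    - prodExp (fun _ : Fin N => w₀) (completedProb v A))]

end

open Filter in
/-- The growth conditions on the sample size used in the lower bound hold eventually. -/
theorem eventually_growth_conditions {α : ℝ} (hα2 : α < 3 / 2) {c : ℝ} (hc : 0 < c) :
    ∀ᶠ n : ℕ in atTop, 16 ≤ n ∧ 2 ≤ Real.log n ∧ 6 * Real.log n ^ 2 ≤ n ∧
      Real.log n * ((n : ℝ) * Real.log n) ^ (2 * (α - 1)) ≤ c * n := by
  have hcast : Tendsto (fun n : ℕ => (n : ℝ)) atTop atTop := tendsto_natCast_atTop_atTop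
  have h2 := (Real.tendsto_log_atTop.comp hcast).eventually_ge_atTop 2
  have h3 := hcast.eventually
    ((isLittleO_log_rpow_atTop (r := 1 / 2) (by norm_num)).bound (c := 1 / 3) (by norm_num))
  have h4 := hcast.eventually
    ((isLittleO_log_rpow_rpow_atTop (2 * α - 1) (s := 3 - 2 * α) (by linarith)).bound hc)
  filter_upwards [eventually_ge_atTop 16, h2, h3, h4] with n h1 h2 h3 h4
  simp only [Function.comp_apply] at h2
  have hn : (0 : ℝ) < n := by positivity
  have hl : 0 < Real.log n := by linarith
  refine ⟨h1, h2, ?_, ?_⟩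
  · rw [Real.norm_eq_abs, Real.norm_eq_abs, abs_of_pos hl, abs_of_nonneg (by positivity),
      ← Real.sqrt_eq_rpow] at h3
    nlinarith [Real.sq_sqrt hn.le, Real.sqrt_nonneg (n : ℝ)]
  · rw [Real.norm_eq_abs, Real.norm_eq_abs, abs_of_nonneg (by positivity),
      abs_of_nonneg (by positivity)] at h4
    calc Real.log n * ((n : ℝ) * Real.log n) ^ (2 * (α - 1))
        = Real.log n ^ (2 * α - 1) * (n : ℝ) ^ (2 * (α - 1)) := by
          have e : 2 * α - 1 = 1 + 2 * (α - 1) := by ring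
          rw [Real.mul_rpow hn.le hl.le, e, Real.rpow_add hl, Real.rpow_one]; ring
      _ ≤ c * (n : ℝ) ^ (3 - 2 * α) * (n : ℝ) ^ (2 * (α - 1)) := by gcongr
      _ = c * n := by
          rw [mul_assoc, ← Real.rpow_add hn]; ring_nf; rw [Real.rpow_one]

/-- Smallness of the distance between the two mixtures. -/
theorem closeness_bound {n D N : ℕ} {M : ℝ} (hn : 16 ≤ n) (hl : 2 ≤ Real.log n)
    (hl2 : 6 * Real.log n ^ 2 ≤ n) (hD : Real.log n ≤ D) (hD2 : D ≤ 2 * Real.log n)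
    (hN : N ≤ n * Real.log n) (hM : M = Real.exp (-4) / 2 * D / n) :
    N * (2 * (Real.exp 4 ^ (D + 1))⁻¹ * Real.exp (2 * n * M * Real.exp 4)
        + 2 * Real.exp (-(1 / (4 * M)))) ≤ 1 / 4 := by
  have hn16 : (16 : ℝ) ≤ n := by exact_mod_cast hn
  have hn0 : (0 : ℝ) < n := by linarith
  have hD0 : (0 : ℝ) < D := by linarith
  have he : Real.exp (-4) * Real.exp 4 = 1 := by rw [← Real.exp_add]; simp
  have he4 : Real.exp (-4) ≤ 1 / 2 := by
    nlinarith [Real.add_one_le_exp (4 : ℝ), Real.exp_pos (-4)]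
  have hn3 : Real.exp (-(3 * Real.log n)) = ((n : ℝ) ^ 3)⁻¹ := by
    rw [Real.exp_neg, mul_comm, Real.exp_mul, Real.exp_log hn0]; norm_cast
  have h1 : (Real.exp 4 ^ (D + 1))⁻¹ * Real.exp (2 * n * M * Real.exp 4) ≤ ((n : ℝ) ^ 3)⁻¹ := by
    have e : 2 * n * M * Real.exp 4 = D := by
      rw [hM]
      field_simp
      linear_combination he
    rw [e, ← Real.exp_nat_mul, ← Real.exp_neg, ← Real.exp_add, ← hn3]
    refine Real.exp_le_exp.2 ?_
    push_cast
    linarith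
  have h2 : Real.exp (-(1 / (4 * M))) ≤ ((n : ℝ) ^ 3)⁻¹ := by
    rw [← hn3]
    refine Real.exp_le_exp.2 (neg_le_neg ?_)
    have hM0 : 0 < M := by rw [hM]; positivity
    rw [le_div_iff₀ (by positivity)]
    have hMD : M * n ≤ D / 4 := by
      rw [hM, div_mul_cancel₀ _ hn0.ne']; nlinarith
    have : 3 * Real.log n * (4 * M) * n ≤ 1 * n := by
      calc 3 * Real.log n * (4 * M) * n = 12 * Real.log n * (M * n) := by ring
        _ ≤ 12 * Real.log n * (D / 4) := by gcongr
        _ ≤ 1 * n := by nlinarith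
    exact le_of_mul_le_mul_right this hn0
  have hlog : Real.log n ≤ n := (Real.log_le_sub_one_of_pos hn0).trans (by linarith)
  have hN2 : (N : ℝ) ≤ (n : ℝ) ^ 2 := hN.trans (by nlinarith)
  calc _ ≤ (n : ℝ) ^ 2 * (2 * ((n : ℝ) ^ 3)⁻¹ + 2 * ((n : ℝ) ^ 3)⁻¹) := by
        rw [mul_assoc 2]
        gcongr
    _ = 4 / n := by field_simp; norm_num
    _ ≤ 1 / 4 := by rw [div_le_div_iff₀ hn0 (by norm_num)]; linarith

/-- Scaling of the separation between the two priors. -/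
theorem mul_rpow_le_mul_div_rpow {α c κ b y z N : ℝ} (hα : 1 ≤ α) (hc : 0 ≤ c) (hκ : 0 ≤ κ)
    (hy : 0 ≤ y) (hz : 0 < z) (hzy : z ≤ 2 * y) (hb : b ≤ c * κ ^ α / 4 * 2 ^ (1 - α))
    (hN : z / 4 ≤ N) : b * y ^ (1 - α) ≤ N * ((κ / z) ^ α * c) :=
  calc b * y ^ (1 - α) ≤ c * κ ^ α / 4 * 2 ^ (1 - α) * y ^ (1 - α) := by gcongr
    _ = c * κ ^ α / 4 * (2 * y) ^ (1 - α) := by rw [Real.mul_rpow (by norm_num) hy]; ring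
    _ ≤ c * κ ^ α / 4 * z ^ (1 - α) :=
        mul_le_mul_of_nonneg_left (Real.rpow_le_rpow_of_nonpos hz hzy (by linarith))
          (by positivity)
    _ = z / 4 * ((κ / z) ^ α * c) := by
        rw [Real.div_rpow hκ hz.le, Real.rpow_sub hz, Real.rpow_one]; ring
    _ ≤ N * ((κ / z) ^ α * c) := by gcongr

/-- Lower bound for a fixed sample size satisfying explicit growth conditions. -/
theorem ofReal_le_multMinimax_of_growth {α c κ b y : ℝ} (hα1 : 1 < α) (hα2 : α < 3 / 2) (hc : 0 < c)
    (hκ : κ = Real.exp (-4) / 2) (hb0 : 0 < b) (hb1 : b ≤ 1)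
    (hb2 : b ≤ c * κ ^ α / 4 * 2 ^ (1 - α)) {n D N : ℕ} (hn : 16 ≤ n) (hl : 2 ≤ Real.log n)
    (hl2 : 6 * Real.log n ^ 2 ≤ n) (hydef : y = n * Real.log n)
    (hgrow : Real.log n * y ^ (2 * (α - 1)) ≤ b ^ 2 / (320 * κ) * n) (hD : Real.log n ≤ D)
    (hD2 : D ≤ 2 * Real.log n) (hNle : N ≤ y) (hNge : (n * D : ℝ) / 4 ≤ N)
    {w₀ w₁ : Bool ⊕ Fin (D + 1) → ℝ} (h₀ : IsProbVec w₀) (h₁ : IsProbVec w₁)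
    (hm₀ : ∑ i, w₀ i * squareNode D i ≤ 1) (hm₁ : ∑ i, w₁ i * squareNode D i ≤ 1)
    (hmom : ∀ j ≤ D, ∑ i, (w₁ i - w₀ i) * squareNode D i ^ j = 0)
    (hgap : c ≤ ∑ i, (w₁ i - w₀ i) * squareNode D i ^ α) :
    ENNReal.ofReal (b ^ 2 / 256 * y ^ (-(2 * (α - 1))))
      ≤ multMinimax (N + 1) n (Falpha (N + 1) α) := by
  have hκ0 : 0 < κ := by rw [hκ]; positivity
  have hκ8 : κ ≤ 1 / 8 := by
    have he : Real.exp (-4) * Real.exp 4 = 1 := by rw [← Real.exp_add]; simp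
    nlinarith [Real.add_one_le_exp (4 : ℝ), Real.exp_pos (-4)]
  have hn16 : (16 : ℝ) ≤ n := by exact_mod_cast hn
  have hn0 : (0 : ℝ) < n := by linarith
  have hD2' : 2 ≤ D := by exact_mod_cast hl.trans hD
  have hD0 : (0 : ℝ) < D := by linarith
  have hy : 32 ≤ y := by
    rw [hydef]
    linarith [mul_le_mul hn16 hl zero_le_two hn0.le]
  set u := κ / (n * D) with hu
  have hu0 : 0 < u := by positivity
  clear_value u
  have hmean : ∀ w : Bool ⊕ Fin (D + 1) → ℝ, ∑ i, w i * squareNode D i ≤ 1 →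
      ∑ i, w i * (u * squareNode D i) ≤ u := fun w hw => by
    have : ∑ i, w i * (u * squareNode D i) = u * ∑ i, w i * squareNode D i := by
      rw [Finset.mul_sum]; exact Finset.sum_congr rfl fun i _ => by ring
    rw [this]
    exact mul_le_of_le_one_right hu0.le hw
  have hyα : 0 < y ^ (1 - α) := by positivity
  have hyα1 : y ^ (1 - α) ≤ 1 := Real.rpow_le_one_of_one_le_of_nonpos (by linarith) (by linarith)
  have hM : u * (D : ℝ) ^ 2 = κ * D / n := by rw [hu]; field_simp
  have hyy : (b * y ^ (1 - α)) ^ 2 = b ^ 2 * y ^ (-(2 * (α - 1))) := by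
    rw [mul_pow, ← Real.rpow_mul_natCast (by linarith)]; congr 2; push_cast; ring
  have hMΔ : 160 * (u * (D : ℝ) ^ 2) ≤ (b * y ^ (1 - α)) ^ 2 := by
    have hpos : 0 < y ^ (2 * (α - 1)) := by positivity
    rw [hM, hyy, Real.rpow_neg (by linarith), ← div_eq_mul_inv, le_div_iff₀ hpos]
    calc 160 * (κ * D / n) * y ^ (2 * (α - 1))
        ≤ 160 * (κ * (2 * Real.log n) / n) * y ^ (2 * (α - 1)) := by gcongr
      _ = 320 * κ / n * (Real.log n * y ^ (2 * (α - 1))) := by ring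
      _ ≤ 320 * κ / n * (b ^ 2 / (320 * κ) * n) := by gcongr
      _ = b ^ 2 := by field_simp
  have hΔ1 : b * y ^ (1 - α) ≤ 1 := mul_le_one₀ hb1 hyα.le hyα1
  have hΔ0 : 0 < b * y ^ (1 - α) := by positivity
  have hgapN : b * y ^ (1 - α) ≤ N * ∑ i, (w₁ i - w₀ i) * (u * squareNode D i) ^ α := by
    have e : ∑ i, (w₁ i - w₀ i) * (u * squareNode D i) ^ α
        = u ^ α * ∑ i, (w₁ i - w₀ i) * squareNode D i ^ α := by
      rw [Finset.mul_sum]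
      refine Finset.sum_congr rfl fun i _ => ?_
      rw [Real.mul_rpow hu0.le (squareNode_nonneg D i)]; ring
    rw [e]
    refine (mul_rpow_le_mul_div_rpow hα1.le hc.le hκ0.le (by linarith) (by positivity)
      (by rw [hydef]; linarith [mul_le_mul_of_nonneg_left hD2 hn0.le]) hb2 hNge).trans ?_
    rw [← hu]
    gcongr
  have key := ofReal_le_multMinimax_Falpha (ι := Bool ⊕ Fin (D + 1))
    (v := fun i => u * squareNode D i) (M := u * (D : ℝ) ^ 2) (L := D) (m := u) (N := N) (n := n)
    (t := Real.exp 4) hα1.le (by linarith)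
    (fun i => mul_nonneg hu0.le (squareNode_nonneg D i))
    (fun i => mul_le_mul_of_nonneg_left (squareNode_le hD2' i) hu0.le)
    (by positivity) (by linarith [pow_le_one₀ (n := 2) hΔ0.le hΔ1]) h₀ h₁ ?_
    (hmean w₀ hm₀) (hmean w₁ hm₁) (by omega) (fun j hj => ?_) (Real.one_le_exp (by norm_num))
    hΔ0 hΔ1 hMΔ hgapN
    (closeness_bound hn hl hl2 hD hD2 (hydef ▸ hNle) (hκ ▸ hM))
  · refine le_trans (le_of_eq ?_) key
    rw [hyy]; congr 1; ring
  · have : (N : ℝ) ≤ n * D := hNle.trans (by rw [hydef]; gcongr)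
    calc N * u ≤ n * D * u := by gcongr
      _ = κ := by rw [hu]; field_simp
      _ ≤ 1 / 8 := hκ8
  · have e : ∑ i, (w₁ i - w₀ i) * (u * squareNode D i) ^ j
        = u ^ j * ∑ i, (w₁ i - w₀ i) * squareNode D i ^ j := by
      rw [Finset.mul_sum]
      exact Finset.sum_congr rfl fun i _ => by rw [mul_pow]; ring
    rw [e, hmom j hj, mul_zero]

theorem Falpha_minimax_lower_bound_large_alpha (α : ℝ) (hα1 : 1 < α) (hα2 : α < 3 / 2) :
    ∃ c₀ c : ℝ, 0 < c₀ ∧ 0 < c ∧ ∃ N : ℕ,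
      ∀ n : ℕ, N ≤ n →
        ENNReal.ofReal (c * ((n : ℝ) * Real.log n) ^ (-(2 * (α - 1))))
          ≤ multMinimax (Nat.ceil (c₀ * (n : ℝ) * Real.log n)) n
              (Falpha (Nat.ceil (c₀ * (n : ℝ) * Real.log n)) α) := by
  obtain ⟨c, hc, hmatch⟩ := exists_moment_matching (p := α) ⟨hα1, by linarith⟩
  set κ : ℝ := Real.exp (-4) / 2 with hκ
  have hκ0 : 0 < κ := by positivity
  set b : ℝ := min 1 (c * κ ^ α / 4 * 2 ^ (1 - α))
  have hb0 : 0 < b := lt_min one_pos (by positivity)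
  have hb1 : b ≤ 1 := min_le_left _ _
  have hb2 : b ≤ c * κ ^ α / 4 * 2 ^ (1 - α) := min_le_right _ _
  clear_value κ b
  obtain ⟨N₀, hN₀⟩ := Filter.eventually_atTop.1
    (eventually_growth_conditions hα2 (c := b ^ 2 / (320 * κ)) (by positivity))
  refine ⟨1, b ^ 2 / 256, one_pos, by positivity, N₀, fun n hnN => ?_⟩
  obtain ⟨hn, hl, hl2, hgrow⟩ := hN₀ n hnN
  have hn16 : (16 : ℝ) ≤ n := by exact_mod_cast hn
  have hn0 : (0 : ℝ) < n := by linarith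
  have hl0 : 0 < Real.log n := by linarith
  set D := ⌈Real.log n⌉₊
  have hD : Real.log n ≤ D := Nat.le_ceil _
  have hD2 : (D : ℝ) ≤ 2 * Real.log n := by linarith [Nat.ceil_lt_add_one hl0.le]
  have hD32 : (D : ℝ) ≤ 3 / 2 * Real.log n := by linarith [Nat.ceil_lt_add_one hl0.le]
  have hD2' : 2 ≤ D := by exact_mod_cast hl.trans hD
  have hD0 : (0 : ℝ) < D := by linarith
  clear_value D
  have hy : 32 ≤ (n : ℝ) * Real.log n := by nlinarith
  set y := (n : ℝ) * Real.log n with hydef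
  rw [one_mul, ← hydef]
  clear_value y
  obtain ⟨N, hN⟩ : ∃ N, ⌈y⌉₊ = N + 1 :=
    Nat.exists_eq_succ_of_ne_zero (Nat.ceil_pos.2 (by linarith)).ne'
  rw [hN]
  have hNle : (N : ℝ) ≤ y := by
    have := Nat.ceil_lt_add_one (show 0 ≤ y by linarith)
    rw [hN] at this; push_cast at this; linarith
  have hNge : (n * D : ℝ) / 4 ≤ N := by
    have := Nat.le_ceil y
    rw [hN] at this; push_cast at this
    have : (n : ℝ) * D ≤ 3 / 2 * y := by
      rw [hydef]; nlinarith
    linarith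
  obtain ⟨w₀, w₁, ⟨hw₀, hs₀, hm₀⟩, ⟨hw₁, hs₁, hm₁⟩, hmom, hgap⟩ := hmatch D hD2'
  exact ofReal_le_multMinimax_of_growth hα1 hα2 hc hκ hb0 hb1 hb2 hn hl hl2 hydef hgrow hD hD2 hNle
    hNge ⟨hw₀, hs₀⟩ ⟨hw₁, hs₁⟩ hm₀ hm₁ hmom hgap
end
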